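/- arXiv:2005.10337 — 5 statements merged into one kernel-verified Lean document; each statement's English description precedes it below -/
import Mathlib

section
/- (Descartes rule of signs for the Laplace transform.) Let φ : [0,∞) → ℝ be continuous and not identically zero, and let s₀ ∈ ℝ be such that t ↦ φ(t)e^{−st} is integrable on (0,∞) for every s > s₀. Suppose there exist n ∈ ℕ and real numbers 0 < s₁ < s₂ < ⋯ < s_n such that the function t ↦ φ(t)·∏_{i=1}^{n}(t − s_i) does not change sign on (0,∞) (i.e. it is everywhere ≥ 0 or everywhere ≤ 0 there). Then the Laplace transform L[φ](s) = ∫_0^∞ φ(t) e^{−st} dt has at most n zeros in the interval (s₀, ∞), i.e. the set { s ∈ ℝ : s > s₀ and L[φ](s) = 0 } has at most n elements. -/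
open MeasureTheory Real

/-- A quantitative form of Rolle's theorem: if the derivative has at most `n` zeros on an open
half-line, then the function has at most `n + 1` zeros there. -/
lemma encard_zeros_Ioi_le_of_hasDerivAt {f f' : ℝ → ℝ} {a : ℝ}
    (hf : ∀ x, a < x → HasDerivAt f (f' x) x) {n : ℕ}
    (hf' : {x | a < x ∧ f' x = 0}.encard ≤ n) :
    {x | a < x ∧ f x = 0}.encard ≤ (n + 1 : ℕ) := by
  by_contra! hlt
  obtain ⟨u, hu, hucard⟩ := Set.exists_subset_encard_eq (Order.add_one_le_of_lt hlt)
  have hufin : u.Finite := Set.finite_of_encard_eq_coe (k := n + 1 + 1) (by simpa using hucard)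
  have hfin : {x | a < x ∧ f' x = 0}.Finite := Set.finite_of_encard_le_coe hf'
  have hcard : hufin.toFinset.card ≤ hfin.toFinset.card + 1 := by
    refine Finset.card_le_of_interleaved fun x hx y hy hxy _ => ?_
    obtain ⟨hax, hfx⟩ := hu (hufin.mem_toFinset.1 hx)
    obtain ⟨hay, hfy⟩ := hu (hufin.mem_toFinset.1 hy)
    obtain ⟨z, hz, hfz⟩ := exists_hasDerivAt_eq_zero hxy
      (fun w hw => (hf w (hax.trans_le hw.1)).continuousAt.continuousWithinAt)
      (hfx.trans hfy.symm) (fun w hw => hf w (hax.trans hw.1))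
    exact ⟨z, hfin.mem_toFinset.2 ⟨hax.trans hz.1, hfz⟩, hz⟩
  rw [hufin.encard_eq_coe_toFinset_card] at hucard
  rw [hfin.encard_eq_coe_toFinset_card] at hf'
  norm_cast at hucard hf'
  omega

/-- Multiplication by the variable preserves absolute convergence of the Laplace transform on an
open half-line. -/
lemma integrableOn_id_mul_mul_exp {φ : ℝ → ℝ} {a : ℝ}
    (hint : ∀ x, a < x → IntegrableOn (fun t => φ t * exp (-x * t)) (Set.Ioi 0))
    {x : ℝ} (hx : a < x) :
    IntegrableOn (fun t => t * (φ t * exp (-x * t))) (Set.Ioi 0) := by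
  obtain ⟨y, hay, hyx⟩ := exists_between hx
  have hδ : 0 < x - y := sub_pos.2 hyx
  refine Integrable.mono' ((hint y hay).norm.const_mul (x - y)⁻¹)
    (continuous_id.aestronglyMeasurable.mul (hint x hx).aestronglyMeasurable) ?_
  filter_upwards [ae_restrict_mem measurableSet_Ioi] with t (ht : 0 < t)
  have hle : (x - y) * t ≤ exp ((x - y) * t) := by linarith [add_one_le_exp ((x - y) * t)]
  have hexp : exp (-y * t) = exp ((x - y) * t) * exp (-x * t) := by
    rw [← exp_add]; ring_nf
  rw [norm_mul, norm_mul, norm_mul, norm_of_nonneg ht.le, norm_of_nonneg (exp_pos _).le,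
    norm_of_nonneg (exp_pos _).le, hexp, inv_mul_eq_div, le_div_iff₀ hδ]
  calc t * (‖φ t‖ * exp (-x * t)) * (x - y)
      = ((x - y) * t) * (‖φ t‖ * exp (-x * t)) := by ring
    _ ≤ exp ((x - y) * t) * (‖φ t‖ * exp (-x * t)) := by gcongr
    _ = ‖φ t‖ * (exp ((x - y) * t) * exp (-x * t)) := by ring

/-- The Laplace transform may be differentiated under the integral sign. -/
lemma hasDerivAt_integral_mul_exp {φ : ℝ → ℝ} {a : ℝ}
    (hint : ∀ x, a < x → IntegrableOn (fun t => φ t * exp (-x * t)) (Set.Ioi 0))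
    {x : ℝ} (hx : a < x) :
    HasDerivAt (fun x => ∫ t in Set.Ioi (0 : ℝ), φ t * exp (-x * t))
      (∫ t in Set.Ioi (0 : ℝ), -(t * (φ t * exp (-x * t)))) x := by
  obtain ⟨y, hay, hyx⟩ := exists_between hx
  refine (hasDerivAt_integral_of_dominated_loc_of_deriv_le (μ := volume.restrict (Set.Ioi (0 : ℝ)))
    (F := fun x t => φ t * exp (-x * t)) (F' := fun x t => -(t * (φ t * exp (-x * t))))
    (bound := fun t => ‖t * (φ t * exp (-y * t))‖)
    (Ioi_mem_nhds hyx) ?_ (hint x hx) (integrableOn_id_mul_mul_exp hint hx).neg.aestronglyMeasurable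
    ?_ (integrableOn_id_mul_mul_exp hint hay).norm ?_).2
  · filter_upwards [Ioi_mem_nhds hx] with z hz using (hint z hz).aestronglyMeasurable
  · filter_upwards [ae_restrict_mem measurableSet_Ioi] with t (ht : 0 < t) z (hz : y < z)
    rw [norm_neg, norm_mul, norm_mul, norm_mul, norm_mul, norm_of_nonneg (exp_pos _).le,
      norm_of_nonneg (exp_pos _).le]
    gcongr
  · refine .of_forall fun t z _ => ?_
    exact ((((hasDerivAt_id z).neg.mul_const t).exp).const_mul (φ t)).congr_deriv
      (by simp only [Pi.neg_apply, id]; ring)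

/-- Descartes' rule of signs for the Laplace transform of a function that is only assumed
not to vanish almost everywhere. -/
lemma encard_zeros_laplace_le {n : ℕ} (s : Fin n → ℝ) {φ : ℝ → ℝ} {a : ℝ}
    (hne : ¬ ∀ᵐ t ∂volume.restrict (Set.Ioi (0 : ℝ)), φ t = 0)
    (hint : ∀ x, a < x → IntegrableOn (fun t => φ t * exp (-x * t)) (Set.Ioi 0))
    (hsign : ∀ t, 0 < t → 0 ≤ φ t * ∏ i, (t - s i)) :
    {x | a < x ∧ ∫ t in Set.Ioi (0 : ℝ), φ t * exp (-x * t) = 0}.encard ≤ n := by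
  induction n generalizing φ with
  | zero =>
    suffices {x | a < x ∧ ∫ t in Set.Ioi (0 : ℝ), φ t * exp (-x * t) = 0} = ∅ by rw [this]; simp
    refine Set.eq_empty_of_forall_notMem fun x ⟨hx, hzero⟩ => hne ?_
    have hnonneg : 0 ≤ᵐ[volume.restrict (Set.Ioi 0)] fun t => φ t * exp (-x * t) := by
      filter_upwards [ae_restrict_mem measurableSet_Ioi] with t ht
      exact mul_nonneg (by simpa using hsign t ht) (exp_pos _).le
    filter_upwards [(integral_eq_zero_iff_of_nonneg_ae hnonneg (hint x hx)).1 hzero] with t ht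
    simpa [exp_ne_zero] using ht
  | succ n ih =>
    have hint' : ∀ x, a < x →
        IntegrableOn (fun t => φ t * (t - s 0) * exp (-x * t)) (Set.Ioi 0) := fun x hx => by
      refine ((integrableOn_id_mul_mul_exp hint hx).sub ((hint x hx).const_mul (s 0))).congr
        (.of_forall fun t => ?_)
      simp only [Pi.sub_apply]; ring
    have hne' : ¬ ∀ᵐ t ∂volume.restrict (Set.Ioi (0 : ℝ)), φ t * (t - s 0) = 0 := fun h => by
      refine hne ?_
      filter_upwards [h, Measure.ae_ne _ (s 0)] with t ht hts
      exact (mul_eq_zero.1 ht).resolve_right (sub_ne_zero.2 hts)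
    have key := ih (fun i => s i.succ) hne' hint' fun t ht => by
      simpa [Fin.prod_univ_succ, mul_assoc] using hsign t ht
    have hderiv : ∀ x, a < x → HasDerivAt
        (fun x => exp (s 0 * x) * ∫ t in Set.Ioi (0 : ℝ), φ t * exp (-x * t))
        (-exp (s 0 * x) * ∫ t in Set.Ioi (0 : ℝ), φ t * (t - s 0) * exp (-x * t)) x := by
      intro x hx
      have hsplit : ∫ t in Set.Ioi (0 : ℝ), φ t * (t - s 0) * exp (-x * t) =
          (∫ t in Set.Ioi (0 : ℝ), t * (φ t * exp (-x * t))) -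
            s 0 * ∫ t in Set.Ioi (0 : ℝ), φ t * exp (-x * t) := by
        rw [← integral_const_mul, ← integral_sub (integrableOn_id_mul_mul_exp hint hx)
          ((hint x hx).const_mul _)]
        exact integral_congr_ae (.of_forall fun t => by ring)
      refine ((((hasDerivAt_id x).const_mul (s 0)).exp).mul
        (hasDerivAt_integral_mul_exp hint hx)).congr_deriv ?_
      rw [hsplit, integral_neg]
      simp only [id]; ring
    have hzeros := encard_zeros_Ioi_le_of_hasDerivAt hderiv (n := n)
      (by simpa [exp_ne_zero] using key)
    simpa [exp_ne_zero] using hzeros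

theorem stmt5 (φ : ℝ → ℝ) (hcont : ContinuousOn φ (Set.Ici 0))
    (hne : ∃ t : ℝ, 0 ≤ t ∧ φ t ≠ 0)
    (s₀ : ℝ)
    (hint : ∀ s : ℝ, s₀ < s →
      IntegrableOn (fun t : ℝ => φ t * Real.exp (-s * t)) (Set.Ioi 0))
    (n : ℕ) (s : Fin n → ℝ) (hpos : ∀ i, 0 < s i) (hmono : StrictMono s)
    -- `t ↦ φ(t) ∏ (t - s i)` does not change sign on `(0, ∞)`
    (hsign : (∀ t : ℝ, 0 < t → 0 ≤ φ t * ∏ i : Fin n, (t - s i)) ∨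
             (∀ t : ℝ, 0 < t → φ t * ∏ i : Fin n, (t - s i) ≤ 0)) :
    Set.encard {x : ℝ | s₀ < x ∧
        (∫ t in Set.Ioi (0 : ℝ), φ t * Real.exp (-x * t)) = 0} ≤ (n : ℕ∞) := by
  have hae : ¬ ∀ᵐ t ∂volume.restrict (Set.Ioi (0 : ℝ)), φ t = 0 := fun h => by
    obtain ⟨t, ht, hφt⟩ := hne
    rw [restrict_Ioi_eq_restrict_Ici] at h
    exact hφt (Measure.eqOn_of_ae_eq h hcont continuousOn_const (by simp) ht)
  rcases hsign with hsign | hsign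
  · exact encard_zeros_laplace_le s hae hint hsign
  · have hneg := encard_zeros_laplace_le s (φ := fun t => -φ t) (a := s₀) (by simpa using hae)
      (fun x hx => by simpa using (hint x hx).neg) (fun t ht => by simpa using hsign t ht)
    simpa [integral_neg] using hneg
end

section
/- For every real t > 0, the identity ∑_{n∈ℤ} (−1)^n e^{−π n² t} = t^{−1/2} · ∑_{n∈ℤ} e^{−π (2n+1)²/(4t)} holds; in particular, ∑_{n∈ℤ} (−1)^n e^{−π n² t} > 0 for every t > 0. -/
open Real

/-- The real Gaussian series `∑ exp (-π n² c - 2 π n y)` over the integers converges. -/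
lemma summable_exp_neg_quadratic_int {c : ℝ} (hc : 0 < c) (y : ℝ) :
    Summable (fun n : ℤ => Real.exp (-π * (n : ℝ) ^ 2 * c - 2 * π * n * y)) := by
  have h := ((summable_jacobiTheta₂_term_iff (y * Complex.I) (c * Complex.I)).2
    (by simpa using hc)).norm
  simpa [norm_jacobiTheta₂_term] using h

lemma summable_exp_neg_odd_sq {t : ℝ} (ht : 0 < t) :
    Summable (fun n : ℤ => Real.exp (-π * (2 * (n : ℝ) + 1) ^ 2 / (4 * t))) := by
  refine ((summable_exp_neg_quadratic_int (inv_pos.2 ht) (1 / (2 * t))).mul_right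
    (Real.exp (-π / (4 * t)))).congr fun n => ?_
  rw [← Real.exp_add]
  congr 1
  field_simp
  ring

lemma Complex.exp_neg_pi_mul_I_mul_int (n : ℤ) :
    Complex.exp (2 * π * (-Complex.I / 2) * n) = (-1) ^ n := by
  rw [show 2 * (π : ℂ) * (-Complex.I / 2) * n = n * -(π * Complex.I) by ring,
    Complex.exp_int_mul, Complex.exp_neg, Complex.exp_pi_mul_I]
  norm_num

/-- Poisson summation for the alternating Gaussian series. -/
lemma tsum_alternating_exp_neg_sq {t : ℝ} (ht : 0 < t) :
    (∑' n : ℤ, (-1 : ℝ) ^ n * Real.exp (-π * (n : ℝ) ^ 2 * t)) =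
      t ^ (-(1/2) : ℝ) * (∑' n : ℤ, Real.exp (-π * (2 * (n : ℝ) + 1) ^ 2 / (4 * t))) := by
  have h := Complex.tsum_exp_neg_quadratic (a := t) (by simpa using ht) (-Complex.I / 2)
  have hl (n : ℤ) : Complex.exp (-π * t * n ^ 2 + 2 * π * (-Complex.I / 2) * n) =
      (((-1 : ℝ) ^ n * Real.exp (-π * (n : ℝ) ^ 2 * t) : ℝ) : ℂ) := by
    rw [Complex.exp_add, Complex.exp_neg_pi_mul_I_mul_int, mul_comm]
    push_cast
    ring_nf
  have hr (n : ℤ) : Complex.exp (-π / t * (n + Complex.I * (-Complex.I / 2)) ^ 2) =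
      ((Real.exp (-π * (2 * (n : ℝ) + 1) ^ 2 / (4 * t)) : ℝ) : ℂ) := by
    have htc : (t : ℂ) ≠ 0 := by exact_mod_cast ht.ne'
    have hI : Complex.I * (-Complex.I / 2) = 1 / 2 := by
      linear_combination (-1 / 2) * Complex.I_mul_I
    rw [hI]
    push_cast
    congr 1
    field_simp
    ring
  have hp : 1 / (t : ℂ) ^ (1 / 2 : ℂ) = ((t ^ (-(1/2) : ℝ) : ℝ) : ℂ) := by
    rw [Complex.ofReal_cpow ht.le, one_div, ← Complex.cpow_neg]
    push_cast
    rfl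
  simp_rw [hl, hr, hp, ← Complex.ofReal_tsum] at h
  exact_mod_cast h

theorem stmt6 (t : ℝ) (ht : 0 < t) :
    -- both series converge absolutely
    Summable (fun n : ℤ => |(-1 : ℝ) ^ n * Real.exp (-π * (n : ℝ) ^ 2 * t)|) ∧
    Summable (fun n : ℤ => |Real.exp (-π * (2 * (n : ℝ) + 1) ^ 2 / (4 * t))|) ∧
    -- the theta transformation identity
    ((∑' n : ℤ, (-1 : ℝ) ^ n * Real.exp (-π * (n : ℝ) ^ 2 * t)) =
      t ^ (-(1/2) : ℝ) * (∑' n : ℤ, Real.exp (-π * (2 * (n : ℝ) + 1) ^ 2 / (4 * t)))) ∧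
    -- in particular the alternating theta value is positive
    0 < ∑' n : ℤ, (-1 : ℝ) ^ n * Real.exp (-π * (n : ℝ) ^ 2 * t) := by
  have hs := summable_exp_neg_odd_sq ht
  refine ⟨?_, hs.abs, tsum_alternating_exp_neg_sq ht, ?_⟩
  · simpa [abs_mul, abs_zpow] using summable_exp_neg_quadratic_int ht 0
  · rw [tsum_alternating_exp_neg_sq ht]
    exact mul_pos (Real.rpow_pos_of_pos ht _)
      (hs.tsum_pos (fun n => (Real.exp_pos _).le) 0 (Real.exp_pos _))
end

section
/- Let α ∈ (0, 2/9). There exists c_α > 0 such that for every c with 0 < c < c_α the following holds: if f : ℝ → ℂ is an even, real-valued Schwartz function satisfying f(c·n^α) = 0 and f̂(c·n^α) = 0 for every n ∈ ℕ (including n = 0), then f ≡ 0. -/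
/-- Cauchy-Schwarz against the constant function on an interval. -/
theorem sq_intervalIntegral_le {g : ℝ → ℝ} (hg : Continuous g) {a b : ℝ} (hab : a ≤ b) :
    (∫ x in a..b, g x) ^ 2 ≤ (b - a) * ∫ x in a..b, g x ^ 2 := by
  rcases hab.eq_or_lt with rfl | hlt
  · simp
  have hL : 0 < b - a := sub_pos.2 hlt
  set m := (∫ x in a..b, g x) / (b - a) with hm
  have hI : ∫ x in a..b, g x = m * (b - a) := by rw [hm]; field_simp
  have h0 : 0 ≤ ∫ x in a..b, (g x - m) ^ 2 :=
    intervalIntegral.integral_nonneg hab fun x _ => sq_nonneg _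
  have h1 : ∫ x in a..b, (g x - m) ^ 2
      = (∫ x in a..b, g x ^ 2) - 2 * m * (∫ x in a..b, g x) + m ^ 2 * (b - a) := by
    have hexp : ∀ x, (g x - m) ^ 2 = g x ^ 2 - 2 * m * g x + m ^ 2 := fun x => by ring
    simp only [hexp]
    rw [intervalIntegral.integral_add, intervalIntegral.integral_sub,
      intervalIntegral.integral_const_mul, intervalIntegral.integral_const, smul_eq_mul]
    · ring
    all_goals exact Continuous.intervalIntegrable (by fun_prop) _ _
  rw [h1, hI] at h0
  rw [hI]
  nlinarith [mul_nonneg hL.le h0]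

/-- A Poincaré inequality on an interval for functions vanishing at the left endpoint. -/
theorem intervalIntegral_norm_sq_le_of_eq_zero (f : SchwartzMap ℝ ℂ) {a b : ℝ} (hab : a ≤ b)
    (hfa : f a = 0) :
    ∫ x in a..b, ‖f x‖ ^ 2 ≤ (b - a) ^ 2 * ∫ x in a..b, ‖deriv f x‖ ^ 2 := by
  have hd : Continuous (deriv f) := (SchwartzMap.derivCLM ℝ ℂ f).continuous
  have hpt : ∀ x ∈ Set.Icc a b, ‖f x‖ ^ 2 ≤ (b - a) * ∫ y in a..b, ‖deriv f y‖ ^ 2 := by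
    intro x hx
    have hfx : ∫ y in a..x, deriv f y = f x := by
      rw [intervalIntegral.integral_eq_sub_of_hasDerivAt
        (fun y _ => f.differentiableAt.hasDerivAt) (hd.intervalIntegrable _ _), hfa, sub_zero]
    have hle : ‖f x‖ ≤ ∫ y in a..x, ‖deriv f y‖ :=
      hfx ▸ intervalIntegral.norm_integral_le_integral_norm hx.1
    have hmono : ∫ y in a..x, ‖deriv f y‖ ^ 2 ≤ ∫ y in a..b, ‖deriv f y‖ ^ 2 :=
      intervalIntegral.integral_mono_interval le_rfl hx.1 hx.2
        (Filter.Eventually.of_forall fun y => sq_nonneg _)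
        ((hd.norm.pow 2).intervalIntegrable _ _)
    have h0 : 0 ≤ ∫ y in a..x, ‖deriv f y‖ ^ 2 :=
      intervalIntegral.integral_nonneg hx.1 fun y _ => sq_nonneg _
    calc ‖f x‖ ^ 2 ≤ (∫ y in a..x, ‖deriv f y‖) ^ 2 := by gcongr
      _ ≤ (x - a) * ∫ y in a..x, ‖deriv f y‖ ^ 2 := sq_intervalIntegral_le hd.norm hx.1
      _ ≤ (b - a) * ∫ y in a..b, ‖deriv f y‖ ^ 2 := by
        gcongr
        exact hx.2
  calc ∫ x in a..b, ‖f x‖ ^ 2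
      ≤ ∫ x in a..b, (b - a) * ∫ y in a..b, ‖deriv f y‖ ^ 2 :=
        intervalIntegral.integral_mono_on hab
          ((f.continuous.norm.pow 2).intervalIntegrable _ _) (by simp) hpt
    _ = (b - a) ^ 2 * ∫ x in a..b, ‖deriv f x‖ ^ 2 := by
        rw [intervalIntegral.integral_const, smul_eq_mul]; ring

theorem intervalIntegral_norm_smul_sq_le_of_eq_zero (f : SchwartzMap ℝ ℂ) {a b K : ℝ}
    (ha : 0 ≤ a) (hab : a ≤ b) (hK : b * (b - a) ≤ K) (hfa : f a = 0) :
    ∫ x in a..b, ‖x • f x‖ ^ 2 ≤ K ^ 2 * ∫ x in a..b, ‖deriv f x‖ ^ 2 := by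
  have hcf := f.continuous
  have h0 : 0 ≤ ∫ y in a..b, ‖deriv f y‖ ^ 2 :=
    intervalIntegral.integral_nonneg hab fun y _ => sq_nonneg _
  have hb : 0 ≤ b := ha.trans hab
  calc ∫ x in a..b, ‖x • f x‖ ^ 2
      ≤ ∫ x in a..b, b ^ 2 * ‖f x‖ ^ 2 := by
        refine intervalIntegral.integral_mono_on hab
          (Continuous.intervalIntegrable (by fun_prop) _ _)
          (Continuous.intervalIntegrable (by fun_prop) _ _) fun x hx => ?_
        have hx0 : 0 ≤ x := ha.trans hx.1
        rw [norm_smul, mul_pow, Real.norm_of_nonneg hx0]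
        gcongr
        exact hx.2
    _ = b ^ 2 * ∫ x in a..b, ‖f x‖ ^ 2 := intervalIntegral.integral_const_mul _ _
    _ ≤ b ^ 2 * ((b - a) ^ 2 * ∫ x in a..b, ‖deriv f x‖ ^ 2) := by
        gcongr
        exact intervalIntegral_norm_sq_le_of_eq_zero f hab hfa
    _ = (b * (b - a)) ^ 2 * ∫ x in a..b, ‖deriv f x‖ ^ 2 := by ring
    _ ≤ K ^ 2 * ∫ x in a..b, ‖deriv f x‖ ^ 2 := by
        have : 0 ≤ b * (b - a) := mul_nonneg hb (sub_nonneg.2 hab)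
        gcongr

theorem SchwartzMap.integrable_norm_sq (f : SchwartzMap ℝ ℂ) :
    MeasureTheory.Integrable fun x => ‖f x‖ ^ 2 :=
  MeasureTheory.MemLp.integrable_norm_pow (p := 2) (f.memLp 2) two_ne_zero

theorem SchwartzMap.integrable_norm_smul_sq (f : SchwartzMap ℝ ℂ) :
    MeasureTheory.Integrable fun x : ℝ => ‖x • f x‖ ^ 2 := by
  have h := (SchwartzMap.smulLeftCLM (𝕜 := ℝ) ℂ (fun x : ℝ => x) f).integrable_norm_sq
  simpa only [SchwartzMap.smulLeftCLM_apply_apply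
    (show Function.HasTemperateGrowth fun x : ℝ => x by fun_prop)] using h

theorem SchwartzMap.integrable_norm_deriv_sq (f : SchwartzMap ℝ ℂ) :
    MeasureTheory.Integrable fun x : ℝ => ‖deriv f x‖ ^ 2 :=
  (SchwartzMap.derivCLM ℝ ℂ f).integrable_norm_sq

theorem integral_eq_two_mul_integral_Ioi_of_even {h : ℝ → ℝ} (hh : ∀ x, h (-x) = h x) :
    ∫ x, h x = 2 * ∫ x in Set.Ioi 0, h x := by
  rw [← integral_comp_abs]
  congr 1 with x
  rcases abs_choice x with hx | hx <;> simp [hx, hh]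

/-- If an even Schwartz function vanishes on a sequence increasing from `0` to infinity whose gaps
are at most inversely proportional to the position, then its second moment is controlled by its
Dirichlet energy. -/
theorem integral_norm_smul_sq_le_of_even {f : SchwartzMap ℝ ℂ} (hf : ∀ x, f (-x) = f x)
    {u : ℕ → ℝ} (hu0 : u 0 = 0) (hu : Monotone u) (hlim : Filter.Tendsto u .atTop .atTop) {K : ℝ}
    (hK : ∀ n, u (n + 1) * (u (n + 1) - u n) ≤ K) (hfu : ∀ n, f (u n) = 0) :
    ∫ x : ℝ, ‖x • f x‖ ^ 2 ≤ K ^ 2 * ∫ x, ‖deriv f x‖ ^ 2 := by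
  have hcf := f.continuous
  have hd : Continuous (deriv f) := (SchwartzMap.derivCLM ℝ ℂ f).continuous
  have hN : ∀ n, ∫ x in (0 : ℝ)..u n, ‖x • f x‖ ^ 2
      ≤ K ^ 2 * ∫ x in (0 : ℝ)..u n, ‖deriv f x‖ ^ 2 := by
    intro n
    induction n with
    | zero => simp [hu0]
    | succ n ih =>
      have hstep := intervalIntegral_norm_smul_sq_le_of_eq_zero f
        (hu0 ▸ hu n.zero_le) (hu n.le_succ) (hK n) (hfu n)
      rw [← intervalIntegral.integral_add_adjacent_intervals (b := u n) (c := u (n + 1))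
          (Continuous.intervalIntegrable (by fun_prop) _ _)
          (Continuous.intervalIntegrable (by fun_prop) _ _),
        ← intervalIntegral.integral_add_adjacent_intervals (b := u n) (c := u (n + 1))
          (f := fun x => ‖deriv f x‖ ^ 2)
          (Continuous.intervalIntegrable (by fun_prop) _ _)
          (Continuous.intervalIntegrable (by fun_prop) _ _), mul_add]
      exact add_le_add ih hstep
  have hhalf := le_of_tendsto_of_tendsto'
    (MeasureTheory.intervalIntegral_tendsto_integral_Ioi 0
      f.integrable_norm_smul_sq.integrableOn hlim)
    ((MeasureTheory.intervalIntegral_tendsto_integral_Ioi 0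
      f.integrable_norm_deriv_sq.integrableOn hlim).const_mul (K ^ 2)) hN
  have hderiv : ∀ x, deriv f (-x) = -deriv f x := by
    intro x
    have h := deriv_comp_neg f x
    simp only [hf] at h
    rw [h, neg_neg]
  rw [integral_eq_two_mul_integral_Ioi_of_even (fun x => by simp [hf]),
    integral_eq_two_mul_integral_Ioi_of_even (h := fun x => ‖deriv f x‖ ^ 2)
      (fun x => by simp [hderiv])]
  linarith

open FourierTransform in
theorem SchwartzMap.integral_norm_deriv_sq (f : SchwartzMap ℝ ℂ) :
    ∫ x, ‖deriv f x‖ ^ 2 = (2 * Real.pi) ^ 2 * ∫ x : ℝ, ‖x • (𝓕 f) x‖ ^ 2 := by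
  have h := (SchwartzMap.derivCLM ℝ ℂ f).integral_norm_sq_fourier
  have hF : ∀ x : ℝ, 𝓕 (SchwartzMap.derivCLM ℝ ℂ f) x = (2 * Real.pi * Complex.I * x) • 𝓕 f x :=
    fun x => congrFun (Real.fourier_deriv f.integrable f.differentiable
      (SchwartzMap.derivCLM ℝ ℂ f).integrable) x
  simp only [SchwartzMap.derivCLM_apply] at h
  rw [← h, ← MeasureTheory.integral_const_mul]
  congr 1 with x
  rw [hF, norm_smul, norm_smul, ← mul_pow, ← mul_assoc]
  simp [abs_of_pos Real.pi_pos]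

open FourierTransform in
theorem SchwartzMap.fourier_neg_of_even {f : SchwartzMap ℝ ℂ} (hf : ∀ x, f (-x) = f x) (x : ℝ) :
    (𝓕 f) (-x) = (𝓕 f) x := by
  rw [SchwartzMap.fourier_coe, ← Real.fourierInv_eq_fourier_neg, Real.fourierInv_eq_fourier_comp_neg]
  simp only [hf]

open FourierTransform in
theorem SchwartzMap.fourier_fourier_of_even {f : SchwartzMap ℝ ℂ} (hf : ∀ x, f (-x) = f x) :
    𝓕 (𝓕 f) = f := by
  ext x
  rw [SchwartzMap.fourier_coe, ← neg_neg x, ← Real.fourierInv_eq_fourier_neg,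
    ← SchwartzMap.fourierInv_coe, FourierTransform.fourierInv_fourier_eq, neg_neg, hf]

/-- A uniqueness criterion for an even function and its Fourier transform vanishing on a common
sequence with small gaps. -/
theorem eq_zero_of_even_of_fourier_vanish {f : SchwartzMap ℝ ℂ} (hf : ∀ x, f (-x) = f x)
    {u : ℕ → ℝ} (hu0 : u 0 = 0) (hu : Monotone u) (hlim : Filter.Tendsto u .atTop .atTop) {K : ℝ}
    (hK : ∀ n, u (n + 1) * (u (n + 1) - u n) ≤ K) (hK1 : 2 * Real.pi * K < 1)
    (hfu : ∀ n, f (u n) = 0) (hfu' : ∀ n, FourierTransform.fourier (⇑f) (u n) = 0) (x : ℝ) :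
    f x = 0 := by
  have hK0 : 0 ≤ K := (mul_nonneg (hu0 ▸ hu (Nat.zero_le _))
    (sub_nonneg.2 (hu (Nat.le_succ 0)))).trans (hK 0)
  have hA := integral_norm_smul_sq_le_of_even hf hu0 hu hlim hK hfu
  have hB := integral_norm_smul_sq_le_of_even (SchwartzMap.fourier_neg_of_even hf) hu0 hu hlim hK
    hfu'
  rw [SchwartzMap.integral_norm_deriv_sq, ← mul_assoc, ← mul_pow] at hA hB
  rw [SchwartzMap.fourier_fourier_of_even hf] at hB
  set A := ∫ x : ℝ, ‖x • f x‖ ^ 2 with hAdef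
  have hA0 : 0 ≤ A := MeasureTheory.integral_nonneg fun x => sq_nonneg _
  have hk : (K * (2 * Real.pi)) ^ 2 < 1 := by
    have : 0 ≤ K * (2 * Real.pi) := by positivity
    nlinarith
  have hk0 : 0 ≤ (K * (2 * Real.pi)) ^ 2 := sq_nonneg _
  have hAA := hA.trans (mul_le_mul_of_nonneg_left hB hk0)
  have hA' : A = 0 := by nlinarith [mul_nonneg hk0 hA0]
  have hcf := f.continuous
  have hzero := (Continuous.ae_eq_iff_eq MeasureTheory.volume
    (show Continuous fun x : ℝ => ‖x • f x‖ ^ 2 by fun_prop) continuous_zero).1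
    ((MeasureTheory.integral_eq_zero_iff_of_nonneg (fun x => sq_nonneg _)
      f.integrable_norm_smul_sq).1 (hAdef ▸ hA'))
  rcases eq_or_ne x 0 with rfl | hx
  · simpa [hu0] using hfu 0
  · simpa [hx] using congrFun hzero x

theorem rpow_mul_rpow_sub_rpow_le_one {α : ℝ} (h0 : 0 ≤ α) (h1 : 2 * α ≤ 1) (n : ℕ) :
    ((n + 1 : ℕ) : ℝ) ^ α * (((n + 1 : ℕ) : ℝ) ^ α - (n : ℝ) ^ α) ≤ 1 := by
  have hn : (0 : ℝ) ≤ n := n.cast_nonneg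
  have hsq : ∀ y : ℝ, 0 ≤ y → y ^ (2 * α) = y ^ α * y ^ α := fun y hy => by
    rw [mul_comm, Real.rpow_mul hy, Real.rpow_two, sq]
  have h := Real.rpow_add_le_add_rpow hn zero_le_one (mul_nonneg zero_le_two h0) h1
  rw [hsq _ hn, hsq _ (by positivity), Real.one_rpow] at h
  have hmono : (n : ℝ) ^ α ≤ (n + 1 : ℝ) ^ α := by gcongr; linarith
  push_cast
  nlinarith [Real.rpow_nonneg hn α]

open MeasureTheory FourierTransform Real

theorem stmt7 (α : ℝ) (hα : α ∈ Set.Ioo (0 : ℝ) (2/9)) :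
    ∃ cα : ℝ, 0 < cα ∧
      ∀ c : ℝ, 0 < c → c < cα →
        ∀ f : SchwartzMap ℝ ℂ,
          (∀ x : ℝ, f (-x) = f x) →            -- f is even
          (∀ x : ℝ, (f x).im = 0) →            -- f is real-valued
          (∀ n : ℕ, f (c * (n : ℝ) ^ α) = 0) →
          (∀ n : ℕ, 𝓕 (⇑f) (c * (n : ℝ) ^ α) = 0) →
          ∀ x : ℝ, f x = 0 := by
  refine ⟨1 / 3, by norm_num, fun c hc hc3 f hf _ hfu hfu' => ?_⟩
  obtain ⟨hα0, hα1⟩ := hα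
  refine eq_zero_of_even_of_fourier_vanish (u := fun n : ℕ => c * (n : ℝ) ^ α) (K := c ^ 2) hf
    (by simp [hα0.ne']) ?_ ?_ ?_ ?_ hfu hfu'
  · intro m n hmn
    dsimp only
    gcongr
  · exact ((tendsto_rpow_atTop hα0).comp tendsto_natCast_atTop_atTop).const_mul_atTop hc
  · intro n
    have h := rpow_mul_rpow_sub_rpow_le_one hα0.le (by linarith) n
    nlinarith [mul_le_mul_of_nonneg_left h (sq_nonneg c)]
  · have hc2 : c ^ 2 < 1 / 9 := by nlinarith
    nlinarith [Real.pi_lt_four, Real.pi_pos]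
end

section
/- There exists δ > 0 such that the following holds: let (ε_n)_{n≥1} be a sequence of real numbers with |ε_n| ≤ δ·n^{−7/4} for all n ≥ 1. If f : ℝ → ℂ is an odd, real-valued Schwartz function satisfying f(√(n+ε_n)) = 0 and f̂(√(n+ε_n)) = 0 for every integer n ≥ 1, and moreover f'(0) = 0 and (f̂)'(0) = 0, then f ≡ 0. -/
open MeasureTheory FourierTransform Real

/-- A function `U` with continuous derivative `u`, vanishing at `0` and satisfying a weight `3/2`
inversion law. -/
structure InversionPair (c : ℂ) (U u : ℝ → ℂ) : Prop where
  norm_c : ‖c‖ = 1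
  re_c : c.re ^ 2 ≤ 1 / 2
  deriv : ∀ x, HasDerivAt U (u x) x
  cont : Continuous u
  zero : U 0 = 0
  inv : ∀ x, 0 < x → U x = c * ((x ^ (-(3 / 2) : ℝ) : ℝ) : ℂ) * U (-x⁻¹)

/-- An `InversionPair` such that the sums of `U` and of `u` over `x + 2ℤ`, truncated at `K`, are
bounded by `M` for `x ∈ [-1, 1]`. -/
structure InversionSystem (c : ℂ) (U u : ℝ → ℂ) (K : ℕ) (M : ℝ) : Prop
    extends InversionPair c U u where
  one_le : 1 ≤ K
  sum_U : ∀ x, |x| ≤ 1 →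
    ‖U x + ∑ j ∈ Finset.range K, (U (x + 2 * (j + 1)) + U (x - 2 * (j + 1)))‖ ≤ M
  sum_u : ∀ x, |x| ≤ 1 →
    ‖u x + ∑ j ∈ Finset.range K, (u (x + 2 * (j + 1)) + u (x - 2 * (j + 1)))‖ ≤ M

namespace InversionPair

variable {c : ℂ} {U u : ℝ → ℂ}

lemma inv_neg (h : InversionPair c U u) {x : ℝ} (hx : 0 < x) :
    U (-x) = (starRingEnd ℂ) c * ((x ^ (-(3 / 2) : ℝ) : ℝ) : ℂ) * U x⁻¹ := by
  have h1 := h.inv x⁻¹ (inv_pos.2 hx)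
  rw [inv_inv] at h1
  have h2 : (starRingEnd ℂ) c * c = 1 := by
    rw [mul_comm, Complex.mul_conj, Complex.normSq_eq_norm_sq, h.norm_c]; simp
  have h3 : x ^ (-(3 / 2) : ℝ) * x⁻¹ ^ (-(3 / 2) : ℝ) = 1 := by
    rw [← Real.mul_rpow hx.le (inv_pos.2 hx).le, mul_inv_cancel₀ hx.ne', Real.one_rpow]
  have h4 : ((x ^ (-(3 / 2) : ℝ) : ℝ) : ℂ) * ((x⁻¹ ^ (-(3 / 2) : ℝ) : ℝ) : ℂ) = 1 := by
    rw [← Complex.ofReal_mul, h3]; simp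
  rw [h1]
  linear_combination (-U (-x)) * h2 - (starRingEnd ℂ c * c * U (-x)) * h4

lemma mirror (h : InversionPair c U u) :
    InversionPair ((starRingEnd ℂ) c) (fun x => U (-x)) (fun x => -u (-x)) where
  norm_c := by simp [h.norm_c]
  re_c := by simpa using h.re_c
  deriv x := by
    simpa [Function.comp_def] using (h.deriv (-x)).scomp x (hasDerivAt_neg x)
  cont := by have := h.cont; fun_prop
  zero := by simp [h.zero]
  inv x hx := by simpa using h.inv_neg hx

lemma norm_inv_pos (h : InversionPair c U u) {x : ℝ} (hx : 0 < x) :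
    ‖U x‖ = x ^ (-(3 / 2) : ℝ) * ‖U (-x⁻¹)‖ := by
  rw [h.inv x hx, norm_mul, norm_mul, h.norm_c, one_mul, Complex.norm_real, Real.norm_eq_abs,
    abs_of_nonneg (Real.rpow_nonneg hx.le _)]

lemma norm_deriv_inv_pos (h : InversionPair c U u) {x : ℝ} (hx : 0 < x) :
    ‖u x‖ ≤ 3 / 2 * x ^ (-(5 / 2) : ℝ) * ‖U (-x⁻¹)‖ + x ^ (-(7 / 2) : ℝ) * ‖u (-x⁻¹)‖ := by
  have e1 : HasDerivAt (fun y : ℝ => -y⁻¹) ((x ^ 2)⁻¹) x := by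
    simpa using (hasDerivAt_inv hx.ne').fun_neg
  have e2 : HasDerivAt (fun y : ℝ => U (-y⁻¹)) ((x ^ 2)⁻¹ • u (-x⁻¹)) x :=
    (h.deriv (-x⁻¹)).scomp x e1
  have e3 : HasDerivAt (fun y : ℝ => y ^ (-(3 / 2) : ℝ)) (-(3 / 2) * x ^ (-(5 / 2) : ℝ)) x := by
    convert Real.hasDerivAt_rpow_const (p := -(3 / 2)) (Or.inl hx.ne') using 3
    norm_num
  have e4 := (e3.ofReal_comp.const_mul c).mul e2
  have e5 : HasDerivAt U _ x := e4.congr_of_eventuallyEq (by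
    filter_upwards [lt_mem_nhds hx] with y hy using h.inv y hy)
  rw [(h.deriv x).unique e5]
  refine (norm_add_le _ _).trans (add_le_add ?_ ?_)
  · rw [norm_mul, norm_mul, h.norm_c, one_mul, Complex.norm_real, norm_mul, norm_neg,
      Real.norm_of_nonneg (Real.rpow_nonneg hx.le _), Real.norm_of_nonneg (by norm_num)]
  · rw [norm_mul, norm_mul, h.norm_c, one_mul, Complex.norm_real, norm_smul,
      Real.norm_of_nonneg (Real.rpow_nonneg hx.le _), Real.norm_of_nonneg (by positivity),
      ← mul_assoc]
    have : x ^ (-(3 / 2) : ℝ) * (x ^ 2)⁻¹ = x ^ (-(7 / 2) : ℝ) := by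
      rw [← Real.rpow_natCast, ← Real.rpow_neg hx.le, ← Real.rpow_add hx]; norm_num
    rw [this]

lemma continuous_fun (h : InversionPair c U u) : Continuous U :=
  continuous_iff_continuousAt.2 fun x => (h.deriv x).continuousAt

end InversionPair

namespace InversionSystem

variable {c : ℂ} {U u : ℝ → ℂ} {K : ℕ} {M : ℝ}

lemma mirror (h : InversionSystem c U u K M) :
    InversionSystem ((starRingEnd ℂ) c) (fun x => U (-x)) (fun x => -u (-x)) K M where
  toInversionPair := h.toInversionPair.mirror
  one_le := h.one_le
  sum_U x hx := by
    have := h.sum_U (-x) (by simpa using hx)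
    refine le_of_eq_of_le (congrArg _ ?_) this
    congr 1
    refine Finset.sum_congr rfl fun j _ => ?_
    rw [add_comm]
    congr 2 <;> ring
  sum_u x hx := by
    have := h.sum_u (-x) (by simpa using hx)
    rw [← norm_neg] at this
    refine le_of_eq_of_le (congrArg _ ?_) this
    rw [neg_add, ← Finset.sum_neg_distrib]
    congr 1
    refine Finset.sum_congr rfl fun j _ => ?_
    ring_nf

lemma nonneg (h : InversionSystem c U u K M) : 0 ≤ M :=
  (norm_nonneg _).trans (h.sum_U 0 (by simp))

end InversionSystem

lemma sum_range_one_div_succ_sq_le (K : ℕ) :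
    ∑ j ∈ Finset.range K, 1 / ((j : ℝ) + 1) ^ 2 ≤ 2 := by
  have h : ∑ j ∈ Finset.range K, 1 / ((j : ℝ) + 1) ^ 2 ≤ 2 - 1 / ((K : ℝ) + 1 / 2) := by
    induction K with
    | zero => norm_num
    | succ k ih =>
      rw [Finset.sum_range_succ]
      have hk : (0 : ℝ) ≤ k := Nat.cast_nonneg k
      have : 1 / ((k : ℝ) + 1) ^ 2 ≤ 1 / ((k : ℝ) + 1 / 2) - 1 / ((k : ℝ) + 1 + 1 / 2) := by
        rw [div_sub_div _ _ (by positivity) (by positivity),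
          div_le_div_iff₀ (by positivity) (by positivity)]
        nlinarith
      push_cast
      linarith
  have : 0 ≤ 1 / ((K : ℝ) + 1 / 2) := by positivity
  linarith

lemma sum_range_one_div_sq_sub_one_le {x : ℝ} (hx : |x| < 1) (K : ℕ) :
    ∑ j ∈ Finset.range K, (1 / ((2 * ((j : ℝ) + 1) + x) ^ 2 - 1) +
      1 / ((2 * ((j : ℝ) + 1) - x) ^ 2 - 1)) ≤ 1 / (1 - x ^ 2) := by
  obtain ⟨h1, h2⟩ := abs_lt.1 hx
  have h : ∑ j ∈ Finset.range K, (1 / ((2 * ((j : ℝ) + 1) + x) ^ 2 - 1) +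
      1 / ((2 * ((j : ℝ) + 1) - x) ^ 2 - 1)) =
      1 / (1 - x ^ 2) - 1 / 2 * (1 / (2 * K + 1 + x) + 1 / (2 * K + 1 - x)) := by
    induction K with
    | zero =>
      have : 1 + x ≠ 0 := by linarith
      have : 1 - x ≠ 0 := by linarith
      have : 1 - x ^ 2 ≠ 0 := by nlinarith
      simp only [Finset.range_zero, Finset.sum_empty, Nat.cast_zero, mul_zero, zero_add]
      field_simp
      ring
    | succ k ih =>
      rw [Finset.sum_range_succ, ih]
      have hk : (0 : ℝ) ≤ k := Nat.cast_nonneg k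
      have a1 : 2 * (k : ℝ) + 1 + x ≠ 0 := by linarith
      have a2 : 2 * (k : ℝ) + 1 - x ≠ 0 := by linarith
      have a3 : 2 * ((k : ℝ) + 1) + 1 + x ≠ 0 := by linarith
      have a4 : 2 * ((k : ℝ) + 1) + 1 - x ≠ 0 := by linarith
      have b1 : (2 * ((k : ℝ) + 1) + x) ^ 2 - 1 =
        (2 * (k : ℝ) + 1 + x) * (2 * ((k : ℝ) + 1) + 1 + x) := by ring
      have b2 : (2 * ((k : ℝ) + 1) - x) ^ 2 - 1 =
        (2 * (k : ℝ) + 1 - x) * (2 * ((k : ℝ) + 1) + 1 - x) := by ring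
      have c1 : 1 / ((2 * (k : ℝ) + 1 + x) * (2 * ((k : ℝ) + 1) + 1 + x)) =
        1 / 2 * (1 / (2 * (k : ℝ) + 1 + x) - 1 / (2 * ((k : ℝ) + 1) + 1 + x)) := by
        field_simp; ring
      have c2 : 1 / ((2 * (k : ℝ) + 1 - x) * (2 * ((k : ℝ) + 1) + 1 - x)) =
        1 / 2 * (1 / (2 * (k : ℝ) + 1 - x) - 1 / (2 * ((k : ℝ) + 1) + 1 - x)) := by
        field_simp; ring
      rw [b1, b2, c1, c2]
      push_cast
      ring
  rw [h]
  have hk : (0 : ℝ) ≤ K := Nat.cast_nonneg K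
  have a1 : 0 ≤ 1 / (2 * (K : ℝ) + 1 + x) := by apply div_nonneg <;> linarith
  have a2 : 0 ≤ 1 / (2 * (K : ℝ) + 1 - x) := by apply div_nonneg <;> linarith
  linarith

namespace InversionSystem

variable {c : ℂ} {U u : ℝ → ℂ} {K : ℕ} {M E N : ℝ}

lemma norm_deriv_le_of_one_lt (h : InversionSystem c U u K M) (hE : ∀ y, |y| ≤ 1 → ‖U y‖ ≤ E)
    (hN : ∀ y, |y| ≤ 1 → (1 - y ^ 2) * ‖u y‖ ≤ N) {s : ℝ} (hs : 1 < s) :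
    ‖u s‖ ≤ 3 / 2 * s ^ (-(5 / 2) : ℝ) * E + N * (s ^ (-(3 / 2) : ℝ) / (s ^ 2 - 1)) := by
  have s0 : 0 < s := by linarith
  have hi : |-s⁻¹| ≤ 1 := by
    rw [abs_neg, abs_of_pos (inv_pos.2 s0)]; exact inv_le_one_of_one_le₀ hs.le
  refine (h.norm_deriv_inv_pos s0).trans (add_le_add ?_ ?_)
  · have := hE _ hi
    have : 0 ≤ s ^ (-(5 / 2) : ℝ) := by positivity
    gcongr
  · have h1 := hN _ hi
    have h2 : 0 < s ^ 2 - 1 := by nlinarith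
    have h3 : s ^ (-(7 / 2) : ℝ) = s ^ (-(3 / 2) : ℝ) * (s ^ 2)⁻¹ := by
      rw [← Real.rpow_natCast, ← Real.rpow_neg s0.le, ← Real.rpow_add s0]; norm_num
    have h4 : 1 - (-s⁻¹) ^ 2 = (s ^ 2 - 1) * (s ^ 2)⁻¹ := by
      field_simp
    rw [h4] at h1
    have h5 : (s ^ 2)⁻¹ * ‖u (-s⁻¹)‖ ≤ N / (s ^ 2 - 1) := by
      rw [le_div_iff₀ h2]; linarith
    calc s ^ (-(7 / 2) : ℝ) * ‖u (-s⁻¹)‖ = s ^ (-(3 / 2) : ℝ) * ((s ^ 2)⁻¹ * ‖u (-s⁻¹)‖) := by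
          rw [h3]; ring
      _ ≤ s ^ (-(3 / 2) : ℝ) * (N / (s ^ 2 - 1)) := by gcongr
      _ = _ := by ring

lemma norm_deriv_neg_le_of_one_lt (h : InversionSystem c U u K M)
    (hE : ∀ y, |y| ≤ 1 → ‖U y‖ ≤ E)
    (hN : ∀ y, |y| ≤ 1 → (1 - y ^ 2) * ‖u y‖ ≤ N) {s : ℝ} (hs : 1 < s) :
    ‖u (-s)‖ ≤ 3 / 2 * s ^ (-(5 / 2) : ℝ) * E + N * (s ^ (-(3 / 2) : ℝ) / (s ^ 2 - 1)) := by
  simpa using h.mirror.norm_deriv_le_of_one_lt (E := E) (N := N)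
    (fun y hy => hE (-y) (by simpa using hy))
    (fun y hy => by simpa using hN (-y) (by simpa using hy)) hs

lemma rpow_neg_five_half_le {s : ℝ} (j : ℕ) (hs : (j : ℝ) + 1 ≤ s) :
    s ^ (-(5 / 2) : ℝ) ≤ 1 / ((j : ℝ) + 1) ^ 2 := by
  have hj : (0 : ℝ) ≤ j := Nat.cast_nonneg j
  have s1 : 1 ≤ s := by linarith
  calc s ^ (-(5 / 2) : ℝ) ≤ s ^ (-(2 : ℝ)) := Real.rpow_le_rpow_of_exponent_le s1 (by norm_num)
    _ = 1 / s ^ 2 := by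
      rw [Real.rpow_neg (by linarith), one_div, ← Real.rpow_natCast]; norm_num
    _ ≤ _ := by gcongr

lemma one_sub_sq_mul_norm_deriv_le (h : InversionSystem c U u K M)
    (hE : ∀ y, |y| ≤ 1 → ‖U y‖ ≤ E)
    (hN : ∀ y, |y| ≤ 1 → (1 - y ^ 2) * ‖u y‖ ≤ N) {x : ℝ} (hx0 : 0 ≤ x) (hx1 : x < 1) :
    ‖u x‖ ≤ M + 6 * E + N * (1 / (1 - x ^ 2) - 1 / 16) := by
  have E0 : 0 ≤ E := (norm_nonneg _).trans (hE 0 (by simp))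
  have N0 : 0 ≤ N := le_trans (by simp) (hN 0 (by simp))
  have key : ∀ s : ℝ, 1 < s → s ^ (-(3 / 2) : ℝ) / (s ^ 2 - 1) ≤ 1 / (s ^ 2 - 1) := by
    intro s hs
    have : 0 < s ^ 2 - 1 := by nlinarith
    gcongr
    exact Real.rpow_le_one_of_one_le_of_nonpos hs.le (by norm_num)
  have key2 : ∀ s : ℝ, 2 ≤ s → s ≤ 3 →
      s ^ (-(3 / 2) : ℝ) / (s ^ 2 - 1) ≤ 1 / (s ^ 2 - 1) - 1 / 16 := by
    intro s hs hs3
    have h1 : 0 < s ^ 2 - 1 := by nlinarith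
    have h2 : s ^ (-(3 / 2) : ℝ) ≤ 1 / 2 := by
      calc s ^ (-(3 / 2) : ℝ) ≤ s ^ (-1 : ℝ) :=
            Real.rpow_le_rpow_of_exponent_le (by linarith) (by norm_num)
        _ = s⁻¹ := Real.rpow_neg_one s
        _ ≤ 1 / 2 := by rw [one_div]; gcongr
    rw [div_le_iff₀ h1, sub_mul, div_mul_cancel₀ _ h1.ne']
    nlinarith
  have term : ∀ j ∈ Finset.range K, ‖u (x + 2 * (j + 1)) + u (x - 2 * (j + 1))‖ ≤
      3 * E * (1 / ((j : ℝ) + 1) ^ 2) + N * (1 / ((2 * ((j : ℝ) + 1) + x) ^ 2 - 1) +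
      1 / ((2 * ((j : ℝ) + 1) - x) ^ 2 - 1)) - (if j = 0 then N / 16 else 0) := by
    intro j _
    have hj : (0 : ℝ) ≤ j := Nat.cast_nonneg j
    have h1 := h.norm_deriv_le_of_one_lt hE hN (s := 2 * ((j : ℝ) + 1) + x) (by linarith)
    have h2 := h.norm_deriv_neg_le_of_one_lt hE hN (s := 2 * ((j : ℝ) + 1) - x) (by linarith)
    have h3 := rpow_neg_five_half_le j (s := 2 * ((j : ℝ) + 1) + x) (by linarith)
    have h4 := rpow_neg_five_half_le j (s := 2 * ((j : ℝ) + 1) - x) (by linarith)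
    have h5 := key (2 * ((j : ℝ) + 1) - x) (by linarith)
    have h6 : N * ((2 * ((j : ℝ) + 1) + x) ^ (-(3 / 2) : ℝ) / ((2 * ((j : ℝ) + 1) + x) ^ 2 - 1)) ≤
        N * (1 / ((2 * ((j : ℝ) + 1) + x) ^ 2 - 1)) - (if j = 0 then N / 16 else 0) := by
      split_ifs with hj0
      · have := key2 (2 * ((j : ℝ) + 1) + x) (by linarith) (by subst hj0; norm_num; linarith)
        nlinarith
      · have := key (2 * ((j : ℝ) + 1) + x) (by linarith)
        nlinarith
    have h7 := mul_le_mul_of_nonneg_left h3 E0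
    have h8 := mul_le_mul_of_nonneg_left h4 E0
    have h9 := mul_le_mul_of_nonneg_left h5 N0
    rw [neg_sub] at h2
    rw [add_comm _ x] at h1
    refine (norm_add_le _ _).trans ?_
    rw [add_comm x] at h1 ⊢
    linarith
  have hs := h.sum_u x (by rw [abs_of_nonneg hx0]; exact hx1.le)
  set S := ∑ j ∈ Finset.range K, (u (x + 2 * (j + 1)) + u (x - 2 * (j + 1))) with hS
  have h1 : ‖S‖ ≤ 6 * E + N * (1 / (1 - x ^ 2) - 1 / 16) := by
    refine (norm_sum_le_of_le _ term).trans ?_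
    rw [Finset.sum_sub_distrib, Finset.sum_add_distrib, ← Finset.mul_sum, ← Finset.mul_sum,
      Finset.sum_ite_eq' (Finset.range K) 0, if_pos (Finset.mem_range.2 h.one_le)]
    have a1 := mul_le_mul_of_nonneg_left (sum_range_one_div_succ_sq_le K) E0
    have a2 := mul_le_mul_of_nonneg_left (sum_range_one_div_sq_sub_one_le
      (x := x) (by rw [abs_of_nonneg hx0]; exact hx1) K) N0
    linarith
  have h2 : ‖u x‖ ≤ ‖u x + S‖ + ‖S‖ := by
    simpa using norm_sub_le (u x + S) S
  linarith

/-- The weighted sup norm of `u` is controlled by the sup norm of `U`. -/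
lemma exists_weighted_bound (h : InversionSystem c U u K M) (hE : ∀ y, |y| ≤ 1 → ‖U y‖ ≤ E) :
    ∀ y, |y| ≤ 1 → (1 - y ^ 2) * ‖u y‖ ≤ 16 * M + 96 * E := by
  have hc : ContinuousOn (fun y : ℝ => (1 - y ^ 2) * ‖u y‖) (Set.Icc (-1) 1) := by
    have := h.cont
    fun_prop
  obtain ⟨x, hx, hmax⟩ := isCompact_Icc.exists_isMaxOn (Set.nonempty_Icc.2 (by norm_num)) hc
  set N := (1 - x ^ 2) * ‖u x‖ with hNdef
  have hN : ∀ y, |y| ≤ 1 → (1 - y ^ 2) * ‖u y‖ ≤ N := fun y hy => hmax (abs_le.1 hy)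
  have E0 : 0 ≤ E := (norm_nonneg _).trans (hE 0 (by simp))
  have M0 := h.nonneg
  suffices hle : N ≤ 16 * M + 96 * E from fun y hy => (hN y hy).trans hle
  by_cases h1 : 1 - x ^ 2 ≤ 0
  · have : N ≤ 0 := mul_nonpos_of_nonpos_of_nonneg h1 (norm_nonneg _)
    linarith
  push Not at h1
  have hab : |x| < 1 := by rw [← sq_lt_one_iff_abs_lt_one]; linarith
  obtain ⟨ha, hb⟩ := abs_lt.1 hab
  have main : ‖u x‖ ≤ M + 6 * E + N * (1 / (1 - x ^ 2) - 1 / 16) := by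
    rcases le_total 0 x with h0 | h0
    · exact h.one_sub_sq_mul_norm_deriv_le hE hN h0 hb
    · have := h.mirror.one_sub_sq_mul_norm_deriv_le (E := E) (N := N)
        (fun y hy => hE (-y) (by simpa using hy))
        (fun y hy => by simpa using hN (-y) (by simpa using hy)) (x := -x) (by linarith)
        (by linarith)
      simpa using this
  have e1 : N * (1 / (1 - x ^ 2)) = ‖u x‖ := by
    rw [hNdef]; field_simp
  rw [mul_sub, e1] at main
  linarith

end InversionSystem

lemma sum_range_succ_rpow_neg_three_half_le (K : ℕ) :
    ∑ j ∈ Finset.range K, ((j : ℝ) + 1) ^ (-(3 / 2) : ℝ) ≤ 3 := by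
  rcases Nat.eq_zero_or_pos K with rfl | hK
  · simp
  have h : ∑ j ∈ Finset.range K, ((j : ℝ) + 1) ^ (-(3 / 2) : ℝ) ≤ 3 - 2 / √(K : ℝ) := by
    induction K, hK using Nat.le_induction with
    | base => norm_num
    | succ k hk ih =>
      rw [Finset.sum_range_succ]
      have hk : (1 : ℝ) ≤ k := by exact_mod_cast hk
      have e : ((k : ℝ) + 1) ^ (-(3 / 2) : ℝ) = 1 / √((k : ℝ) + 1) ^ 3 := by
        rw [Real.sqrt_eq_rpow, ← Real.rpow_natCast, ← Real.rpow_mul (by positivity), one_div,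
          ← Real.rpow_neg (by positivity)]
        norm_num
      rw [e]
      push_cast
      have ha : 0 < √(k : ℝ) := Real.sqrt_pos.2 (by linarith)
      have hb : 0 < √((k : ℝ) + 1) := Real.sqrt_pos.2 (by linarith)
      have ha2 : √(k : ℝ) ^ 2 = k := Real.sq_sqrt (by linarith)
      have hb2 : √((k : ℝ) + 1) ^ 2 = k + 1 := Real.sq_sqrt (by linarith)
      have hab : √(k : ℝ) ≤ √((k : ℝ) + 1) := Real.sqrt_le_sqrt (by linarith)
      set a := √(k : ℝ)
      set b := √((k : ℝ) + 1)
      have h1 : a ≤ 2 * b ^ 2 * (b - a) := by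
        have : a * (a + b) ≤ 2 * b ^ 2 * (b - a) * (a + b) := by nlinarith
        exact le_of_mul_le_mul_right this (by linarith)
      have h2 : 1 / b ^ 3 ≤ 2 / a - 2 / b := by
        rw [div_sub_div _ _ ha.ne' hb.ne', div_le_div_iff₀ (by positivity) (by positivity)]
        nlinarith
      linarith
  have : 0 ≤ 2 / √(K : ℝ) := by positivity
  linarith

lemma half_le_norm_one_add_sq {c : ℂ} (hc : ‖c‖ = 1) (hre : c.re ^ 2 ≤ 1 / 2) (r : ℝ) :
    1 / 2 ≤ ‖1 + c * (r : ℂ)‖ := by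
  have h1 : ‖1 + c * (r : ℂ)‖ ^ 2 = 1 + 2 * (r * c.re) + r ^ 2 := by
    rw [← Complex.normSq_eq_norm_sq, Complex.normSq_apply]
    have : c.re * c.re + c.im * c.im = 1 := by
      rw [← Complex.normSq_apply, Complex.normSq_eq_norm_sq, hc]; norm_num
    simp
    linear_combination r ^ 2 * this
  have h2 : 1 / 2 ≤ ‖1 + c * (r : ℂ)‖ ^ 2 := by
    rw [h1]
    nlinarith [sq_nonneg (2 * c.re + r), sq_nonneg (r + c.re)]
  nlinarith [norm_nonneg (1 + c * (r : ℂ))]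

namespace InversionSystem

variable {c : ℂ} {U u : ℝ → ℂ} {K : ℕ} {M N F b : ℝ}

lemma norm_le_of_two_le (h : InversionSystem c U u K M) (hb : 1 / 2 ≤ b)
    (hF : ∀ y, |y| ≤ b → ‖U y‖ ≤ F) {s : ℝ} (j : ℕ) (hs : 2 ≤ s) (hj : (j : ℝ) + 1 ≤ s) :
    ‖U s‖ ≤ F * ((j : ℝ) + 1) ^ (-(3 / 2) : ℝ) := by
  have s0 : 0 < s := by linarith
  have hi : |-s⁻¹| ≤ b := by
    rw [abs_neg, abs_of_pos (inv_pos.2 s0)]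
    exact (inv_anti₀ (by norm_num) hs).trans (by linarith)
  rw [h.norm_inv_pos s0, mul_comm]
  have h1 := hF _ hi
  have h2 : s ^ (-(3 / 2) : ℝ) ≤ ((j : ℝ) + 1) ^ (-(3 / 2) : ℝ) :=
    Real.rpow_le_rpow_of_nonpos (by positivity) hj (by norm_num)
  exact mul_le_mul h1 h2 (by positivity) ((norm_nonneg _).trans h1)

lemma norm_neg_le_of_two_le (h : InversionSystem c U u K M) (hb : 1 / 2 ≤ b)
    (hF : ∀ y, |y| ≤ b → ‖U y‖ ≤ F) {s : ℝ} (j : ℕ) (hs : 2 ≤ s) (hj : (j : ℝ) + 1 ≤ s) :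
    ‖U (-s)‖ ≤ F * ((j : ℝ) + 1) ^ (-(3 / 2) : ℝ) := by
  simpa using h.mirror.norm_le_of_two_le hb (F := F) (fun y hy => hF (-y) (by simpa using hy))
    j hs hj

/-- Increment bound near the endpoint `1`. -/
lemma norm_sub_inv_two_sub_le (h : InversionSystem c U u K M)
    (hN : ∀ y, |y| ≤ 1 → (1 - y ^ 2) * ‖u y‖ ≤ N) {x : ℝ} (hx0 : 0 ≤ x) (hx1 : x ≤ 1) :
    ‖U (2 - x)⁻¹ - U x‖ ≤ (1 - x) * N := by
  have N0 : 0 ≤ N := le_trans (by simp) (hN 0 (by simp))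
  rcases hx1.eq_or_lt with rfl | hx1
  · norm_num
  have p : 0 < 2 - x := by linarith
  have e1 : (2 - x)⁻¹ - x = (1 - x) ^ 2 * (2 - x)⁻¹ := by field_simp; ring
  have e2 : 1 - (2 - x)⁻¹ = (1 - x) * (2 - x)⁻¹ := by field_simp; ring
  have hpi : 0 < (2 - x)⁻¹ := inv_pos.2 p
  have hs : x ≤ (2 - x)⁻¹ := by
    have : 0 ≤ (1 - x) ^ 2 * (2 - x)⁻¹ := by positivity
    linarith
  have hpos : 0 < (1 - x) * (2 - x)⁻¹ := mul_pos (by linarith) hpi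
  set s := (2 - x)⁻¹
  have bound : ∀ y ∈ Set.Ico x s, ‖u y‖ ≤ N / (1 - s) := by
    intro y hy
    have y0 : 0 ≤ y := hx0.trans hy.1
    have h1 := hN y (by rw [abs_of_nonneg y0]; linarith [hy.2])
    rw [le_div_iff₀ (by linarith)]
    have : 1 - s ≤ 1 - y ^ 2 := by nlinarith [hy.2]
    nlinarith [norm_nonneg (u y)]
  have := norm_image_sub_le_of_norm_deriv_right_le_segment (f := U) (f' := u) (a := x) (b := s)
    h.continuous_fun.continuousOn (fun y _ => (h.deriv y).hasDerivWithinAt) bound s ⟨hs, le_rfl⟩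
  refine this.trans (le_of_eq ?_)
  rw [e1, e2]
  have : 1 - x ≠ 0 := by linarith
  field_simp

lemma norm_le_near_one (h : InversionSystem c U u K M) (hb : 1 / 2 ≤ b)
    (hF : ∀ y, |y| ≤ b → ‖U y‖ ≤ F) (hN : ∀ y, |y| ≤ 1 → (1 - y ^ 2) * ‖u y‖ ≤ N)
    {x : ℝ} (hx0 : b ≤ x) (hx1 : x ≤ 1) :
    ‖U x‖ ≤ 2 * (M + 6 * F + (1 - b) * N) := by
  have N0 : 0 ≤ N := le_trans (by simp) (hN 0 (by simp))
  have F0 : 0 ≤ F := (norm_nonneg _).trans (hF 0 (by simp; linarith))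
  have hx : |x| ≤ 1 := by rw [abs_of_nonneg (by linarith)]; exact hx1
  set R := ∑ j ∈ Finset.range K,
    (U (x + 2 * (j + 1)) + if j = 0 then 0 else U (x - 2 * (j + 1))) with hR
  have hsum : ∑ j ∈ Finset.range K, (U (x + 2 * (j + 1)) + U (x - 2 * (j + 1))) =
      U (x - 2) + R := by
    have : U (x - 2) = ∑ j ∈ Finset.range K, if j = 0 then U (x - 2) else 0 := by
      rw [Finset.sum_ite_eq' (Finset.range K) 0, if_pos (Finset.mem_range.2 h.one_le)]
    rw [this, hR, ← Finset.sum_add_distrib]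
    refine Finset.sum_congr rfl fun j _ => ?_
    split_ifs with hj
    · subst hj; simp [add_comm]
    · simp
  have hRb : ‖R‖ ≤ 6 * F := by
    have term : ∀ j ∈ Finset.range K,
        ‖U (x + 2 * (j + 1)) + if j = 0 then 0 else U (x - 2 * (j + 1))‖ ≤
        2 * F * ((j : ℝ) + 1) ^ (-(3 / 2) : ℝ) := by
      intro j _
      have hj0 : (0 : ℝ) ≤ j := Nat.cast_nonneg j
      have h1 := h.norm_le_of_two_le hb hF j (s := x + 2 * (j + 1)) (by linarith) (by linarith)
      have h2 : ‖if j = 0 then 0 else U (x - 2 * (j + 1))‖ ≤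
          F * ((j : ℝ) + 1) ^ (-(3 / 2) : ℝ) := by
        split_ifs with hj
        · rw [norm_zero]; positivity
        · have hj1 : (1 : ℝ) ≤ j := by exact_mod_cast Nat.one_le_iff_ne_zero.2 hj
          have := h.norm_neg_le_of_two_le hb hF j (s := 2 * (j + 1) - x) (by linarith)
            (by linarith)
          rwa [neg_sub] at this
      refine (norm_add_le _ _).trans ?_
      linarith
    refine (norm_sum_le_of_le _ term).trans ?_
    rw [← Finset.mul_sum]
    have := mul_le_mul_of_nonneg_left (sum_range_succ_rpow_neg_three_half_le K) F0
    linarith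
  have hs := h.sum_U x hx
  rw [hsum] at hs
  have e1 : U (x - 2) = (starRingEnd ℂ) c * (((2 - x) ^ (-(3 / 2) : ℝ) : ℝ) : ℂ) *
      U (2 - x)⁻¹ := by
    have := h.inv_neg (x := 2 - x) (by linarith)
    rwa [neg_sub] at this
  set r := (2 - x) ^ (-(3 / 2) : ℝ) with hr
  have r0 : 0 ≤ r := Real.rpow_nonneg (by linarith) _
  have r1 : r ≤ 1 := Real.rpow_le_one_of_one_le_of_nonpos (by linarith) (by norm_num)
  have hd := h.norm_sub_inv_two_sub_le hN (by linarith) hx1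
  have hlow := half_le_norm_one_add_sq (c := (starRingEnd ℂ) c) (by simp [h.norm_c])
    (by simpa using h.re_c) r
  have e2 : (1 + (starRingEnd ℂ) c * (r : ℂ)) * U x = (U x + (U (x - 2) + R)) - R -
      (starRingEnd ℂ) c * (r : ℂ) * (U (2 - x)⁻¹ - U x) := by
    rw [e1]; ring
  have h3 : ‖(starRingEnd ℂ) c * (r : ℂ) * (U (2 - x)⁻¹ - U x)‖ ≤ (1 - b) * N := by
    rw [norm_mul, norm_mul, Complex.norm_conj, h.norm_c, one_mul, Complex.norm_real,
      Real.norm_of_nonneg r0]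
    calc r * ‖U (2 - x)⁻¹ - U x‖ ≤ 1 * ‖U (2 - x)⁻¹ - U x‖ := by gcongr
      _ ≤ (1 - x) * N := by linarith
      _ ≤ _ := by gcongr
  have h4 : ‖1 + (starRingEnd ℂ) c * (r : ℂ)‖ * ‖U x‖ ≤ M + 6 * F + (1 - b) * N := by
    rw [← norm_mul, e2]
    refine (norm_sub_le _ _).trans (add_le_add ((norm_sub_le _ _).trans ?_) h3)
    linarith
  nlinarith [norm_nonneg (U x)]

end InversionSystem

lemma sum_integral_shift {g : ℝ → ℝ} (hg : Continuous g) (K : ℕ) :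
    ∑ j ∈ Finset.range K, ∫ x in (-1 : ℝ)..1, g (x + 2 * (j + 1)) =
      ∫ x in (1 : ℝ)..(2 * K + 1), g x := by
  induction K with
  | zero => simp
  | succ k ih =>
    have e1 : -1 + 2 * ((k : ℝ) + 1) = 2 * k + 1 := by ring
    have e2 : 1 + 2 * ((k : ℝ) + 1) = 2 * (k + 1) + 1 := by ring
    rw [Finset.sum_range_succ, ih, intervalIntegral.integral_comp_add_right, e1, e2,
      intervalIntegral.integral_add_adjacent_intervals
        (hg.intervalIntegrable _ _) (hg.intervalIntegrable _ _)]
    push_cast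
    rfl

namespace InversionSystem

variable {c : ℂ} {U u : ℝ → ℂ} {K : ℕ} {M b q : ℝ}

lemma intervalIntegrable_norm (h : InversionSystem c U u K M) (a b : ℝ) :
    IntervalIntegrable (fun x => ‖u x‖) volume a b :=
  h.cont.norm.intervalIntegrable a b

lemma norm_sub_le_integral (h : InversionSystem c U u K M) {a b : ℝ} (hab : a ≤ b) :
    ‖U b - U a‖ ≤ ∫ x in a..b, ‖u x‖ := by
  rw [← intervalIntegral.integral_eq_sub_of_hasDerivAt (fun x _ => h.deriv x)
    (h.cont.intervalIntegrable a b)]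
  exact intervalIntegral.norm_integral_le_integral_norm hab

/-- The excess of the length of the path `U` on `[0, y]` over the length of its chord is monotone. -/
lemma excess_mono (h : InversionSystem c U u K M) {a b : ℝ} (hab : a ≤ b) :
    (∫ x in (0 : ℝ)..a, ‖u x‖) - ‖U a‖ ≤ (∫ x in (0 : ℝ)..b, ‖u x‖) - ‖U b‖ := by
  have h1 := h.norm_sub_le_integral hab
  have h2 := intervalIntegral.integral_add_adjacent_intervals
    (h.intervalIntegrable_norm 0 a) (h.intervalIntegrable_norm a b)
  have h3 : ‖U b‖ ≤ ‖U a‖ + ‖U b - U a‖ := by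
    simpa using norm_add_le (U a) (U b - U a)
  linarith

lemma excess_nonneg (h : InversionSystem c U u K M) {a : ℝ} (ha : 0 ≤ a) :
    0 ≤ (∫ x in (0 : ℝ)..a, ‖u x‖) - ‖U a‖ := by
  simpa [h.zero] using h.excess_mono ha

lemma integral_norm_le_sub (h : InversionSystem c U u K M) {a b l : ℝ} (ha : 0 < a) (hab : a ≤ b)
    (hl : ∀ s ∈ Set.Icc a b, l ≤ (∫ x in (0 : ℝ)..s⁻¹, ‖u (-x)‖) - ‖U (-s⁻¹)‖) :
    ∫ x in a..b, ‖u x‖ ≤ a ^ (-(3 / 2) : ℝ) * ((∫ x in (0 : ℝ)..a⁻¹, ‖u (-x)‖) - l) -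
      b ^ (-(3 / 2) : ℝ) * ((∫ x in (0 : ℝ)..b⁻¹, ‖u (-x)‖) - l) := by
  have hcm : Continuous fun x => ‖u (-x)‖ := by have := h.cont; fun_prop
  set V : ℝ → ℝ := fun y => ∫ x in (0 : ℝ)..y, ‖u (-x)‖ with hV
  have dV : ∀ y, HasDerivAt V ‖u (-y)‖ y := fun y =>
    intervalIntegral.integral_hasDerivAt_right (hcm.intervalIntegrable _ _)
      hcm.stronglyMeasurable.stronglyMeasurableAtFilter hcm.continuousAt
  have dF : ∀ y, HasDerivAt (fun y => ∫ x in a..y, ‖u x‖) ‖u y‖ y := fun y =>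
    intervalIntegral.integral_hasDerivAt_right (h.intervalIntegrable_norm _ _)
      h.cont.norm.stronglyMeasurable.stronglyMeasurableAtFilter h.cont.norm.continuousAt
  have dH : ∀ s, 0 < s → HasDerivAt (fun s => a ^ (-(3 / 2) : ℝ) * (V a⁻¹ - l) -
      s ^ (-(3 / 2) : ℝ) * (V s⁻¹ - l))
      (3 / 2 * s ^ (-(5 / 2) : ℝ) * (V s⁻¹ - l) + s ^ (-(7 / 2) : ℝ) * ‖u (-s⁻¹)‖) s := by
    intro s hs
    have e1 : HasDerivAt (fun y : ℝ => V y⁻¹ - l) (‖u (-s⁻¹)‖ * (-(s ^ 2)⁻¹)) s :=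
      ((dV s⁻¹).comp s (hasDerivAt_inv hs.ne')).sub_const l
    have e3 : HasDerivAt (fun y : ℝ => y ^ (-(3 / 2) : ℝ)) (-(3 / 2) * s ^ (-(5 / 2) : ℝ)) s := by
      convert Real.hasDerivAt_rpow_const (p := -(3 / 2)) (Or.inl hs.ne') using 3
      norm_num
    have h7 : s ^ (-(7 / 2) : ℝ) = s ^ (-(3 / 2) : ℝ) * (s ^ 2)⁻¹ := by
      rw [← Real.rpow_natCast, ← Real.rpow_neg hs.le, ← Real.rpow_add hs]; norm_num
    refine ((e3.mul e1).const_sub (a ^ (-(3 / 2) : ℝ) * (V a⁻¹ - l))).congr_deriv ?_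
    rw [h7]; ring
  have pos : ∀ s ∈ Set.Icc a b, 0 < s := fun s hs => ha.trans_le hs.1
  refine image_le_of_deriv_right_le_deriv_boundary (f := fun y => ∫ x in a..y, ‖u x‖)
    (f' := fun y => ‖u y‖) (a := a) (b := b)
    (fun s _ => (dF s).continuousAt.continuousWithinAt) (fun s _ => (dF s).hasDerivWithinAt)
    (B := fun s => a ^ (-(3 / 2) : ℝ) * (V a⁻¹ - l) - s ^ (-(3 / 2) : ℝ) * (V s⁻¹ - l))
    (by simp) (fun s hs => (dH s (pos s hs)).continuousAt.continuousWithinAt)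
    (fun s hs => (dH s (pos s ⟨hs.1, hs.2.le⟩)).hasDerivWithinAt) ?_ ⟨hab, le_rfl⟩
  intro s hs
  have hs0 := pos s ⟨hs.1, hs.2.le⟩
  refine (h.norm_deriv_inv_pos hs0).trans ?_
  have := hl s ⟨hs.1, hs.2.le⟩
  have : 0 ≤ s ^ (-(5 / 2) : ℝ) := by positivity
  gcongr
  simp only [hV]
  linarith

lemma integral_norm_tail_le (h : InversionSystem c U u K M) (hq0 : 0 < q) (hq1 : q ≤ 1) {X : ℝ}
    (hX : q⁻¹ ≤ X) :
    ∫ x in (1 : ℝ)..X, ‖u x‖ ≤ (∫ x in (0 : ℝ)..1, ‖u (-x)‖) -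
      (1 - q) * ((∫ x in (0 : ℝ)..q, ‖u (-x)‖) - ‖U (-q)‖) := by
  have hq : 1 ≤ q⁻¹ := one_le_inv_iff₀.2 ⟨hq0, hq1⟩
  have hm := h.mirror
  have D0 : 0 ≤ (∫ x in (0 : ℝ)..q, ‖u (-x)‖) - ‖U (-q)‖ := by
    simpa using hm.excess_nonneg hq0.le
  have h1 := h.integral_norm_le_sub (a := 1) (b := q⁻¹)
    (l := (∫ x in (0 : ℝ)..q, ‖u (-x)‖) - ‖U (-q)‖) one_pos hq (by
      intro s hs
      have : q ≤ s⁻¹ := by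
        rw [le_inv_comm₀ hq0 (by linarith [hs.1])]; exact hs.2
      simpa using hm.excess_mono this)
  have h2 := h.integral_norm_le_sub (a := q⁻¹) (b := X) (l := 0) (by positivity) hX (by
      intro s hs
      have : 0 ≤ s⁻¹ := inv_nonneg.2 (by linarith [hs.1])
      simpa using hm.excess_nonneg this)
  have h3 := intervalIntegral.integral_add_adjacent_intervals
    (h.intervalIntegrable_norm 1 q⁻¹) (h.intervalIntegrable_norm q⁻¹ X)
  have h4 : 0 ≤ X ^ (-(3 / 2) : ℝ) * ((∫ x in (0 : ℝ)..X⁻¹, ‖u (-x)‖) - 0) := by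
    have : 0 ≤ X⁻¹ := inv_nonneg.2 (by linarith)
    refine mul_nonneg (Real.rpow_nonneg (by linarith) _) ?_
    rw [sub_zero]
    exact intervalIntegral.integral_nonneg this fun _ _ => norm_nonneg _
  have h5 : q⁻¹ ^ (-(3 / 2) : ℝ) ≤ q := by
    rw [Real.inv_rpow hq0.le, ← Real.rpow_neg hq0.le, neg_neg]
    calc q ^ (3 / 2 : ℝ) ≤ q ^ (1 : ℝ) :=
          Real.rpow_le_rpow_of_exponent_ge hq0 hq1 (by norm_num)
      _ = q := Real.rpow_one q
  rw [Real.one_rpow, inv_inv, inv_one] at h1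
  rw [inv_inv] at h2
  nlinarith

lemma continuous_sum_shift (h : InversionSystem c U u K M) : Continuous fun x : ℝ =>
    ∑ j ∈ Finset.range K, (‖u (x + 2 * (j + 1))‖ + ‖u (x - 2 * (j + 1))‖) := by
  have := h.cont
  fun_prop

lemma norm_le_sum_shift (h : InversionSystem c U u K M) {x : ℝ} (hx : |x| ≤ 1) :
    ‖u x‖ ≤ M + ∑ j ∈ Finset.range K, (‖u (x + 2 * (j + 1))‖ + ‖u (x - 2 * (j + 1))‖) := by
  have h1 := h.sum_u x hx
  set S := ∑ j ∈ Finset.range K, (u (x + 2 * (j + 1)) + u (x - 2 * (j + 1)))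
  have h2 : ‖S‖ ≤ ∑ j ∈ Finset.range K, (‖u (x + 2 * (j + 1))‖ + ‖u (x - 2 * (j + 1))‖) :=
    norm_sum_le_of_le _ fun j _ => norm_add_le _ _
  have h3 : ‖u x‖ ≤ ‖u x + S‖ + ‖S‖ := by
    simpa using norm_sub_le (u x + S) S
  linarith

lemma integral_sum_shift_le (h : InversionSystem c U u K M) (hq0 : 1 / 3 ≤ q) (hq1 : q ≤ 1) :
    ∫ x in (-1 : ℝ)..1, ∑ j ∈ Finset.range K,
      (‖u (x + 2 * (j + 1))‖ + ‖u (x - 2 * (j + 1))‖) ≤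
      (∫ x in (0 : ℝ)..1, ‖u x‖) + (∫ x in (0 : ℝ)..1, ‖u (-x)‖) -
        (1 - q) * ((∫ x in (0 : ℝ)..q, ‖u x‖) - ‖U q‖) := by
  have hc := h.cont
  have hK : (1 : ℝ) ≤ K := by exact_mod_cast h.one_le
  have hX : q⁻¹ ≤ 2 * K + 1 := by
    have : q⁻¹ ≤ (1 / 3 : ℝ)⁻¹ := inv_anti₀ (by norm_num) hq0
    norm_num at this
    linarith
  have e : ∫ x in (-1 : ℝ)..1, ∑ j ∈ Finset.range K,
      (‖u (x + 2 * (j + 1))‖ + ‖u (x - 2 * (j + 1))‖) =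
      (∫ x in (1 : ℝ)..(2 * K + 1), ‖u x‖) + ∫ x in (1 : ℝ)..(2 * K + 1), ‖u (-x)‖ := by
    rw [← sum_integral_shift (g := fun x => ‖u x‖) (by fun_prop),
      ← sum_integral_shift (g := fun x => ‖u (-x)‖) (by fun_prop), ← Finset.sum_add_distrib,
      intervalIntegral.integral_finsetSum
        (fun j _ => Continuous.intervalIntegrable (by fun_prop) _ _)]
    refine Finset.sum_congr rfl fun j _ => ?_
    rw [intervalIntegral.integral_add (Continuous.intervalIntegrable (by fun_prop) _ _)
      (Continuous.intervalIntegrable (by fun_prop) _ _)]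
    congr 1
    have := intervalIntegral.integral_comp_neg (a := -1) (b := 1)
      (fun x => ‖u (x - 2 * ((j : ℝ) + 1))‖)
    rw [neg_neg] at this
    rw [← this]
    refine intervalIntegral.integral_congr fun x _ => ?_
    congr 2
    ring
  have h1 := h.integral_norm_tail_le (q := q) (by linarith) hq1 hX
  have h2 : ∫ x in (1 : ℝ)..(2 * K + 1), ‖u (-x)‖ ≤ (∫ x in (0 : ℝ)..1, ‖u x‖) -
      (1 - q) * ((∫ x in (0 : ℝ)..q, ‖u x‖) - ‖U q‖) := by
    simpa using h.mirror.integral_norm_tail_le (q := q) (by linarith) hq1 hX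
  have h3 : 0 ≤ (1 - q) * ((∫ x in (0 : ℝ)..q, ‖u (-x)‖) - ‖U (-q)‖) := by
    refine mul_nonneg (by linarith) ?_
    simpa using h.mirror.excess_nonneg (a := q) (by linarith)
  rw [e]
  linarith

lemma integral_neg_one_zero (g : ℝ → ℝ) : ∫ x in (-1 : ℝ)..0, g x = ∫ x in (0 : ℝ)..1, g (-x) := by
  simp

lemma excess_le (h : InversionSystem c U u K M) (hq0 : 1 / 3 ≤ q) (hq1 : q ≤ 1) :
    (1 - q) * ((∫ x in (0 : ℝ)..q, ‖u x‖) - ‖U q‖) ≤ 2 * M := by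
  have h1 := h.integral_sum_shift_le hq0 hq1
  have h2 : ∫ x in (-1 : ℝ)..1, ‖u x‖ ≤ ∫ x in (-1 : ℝ)..1, (M + ∑ j ∈ Finset.range K,
      (‖u (x + 2 * (j + 1))‖ + ‖u (x - 2 * (j + 1))‖)) :=
    intervalIntegral.integral_mono_on (by norm_num) (h.intervalIntegrable_norm _ _)
      ((continuous_const.add h.continuous_sum_shift).intervalIntegrable _ _)
      fun x hx => h.norm_le_sum_shift (abs_le.2 hx)
  rw [intervalIntegral.integral_add (by simp) (h.continuous_sum_shift.intervalIntegrable _ _),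
    ← intervalIntegral.integral_add_adjacent_intervals (b := 0)
      (h.intervalIntegrable_norm _ _) (h.intervalIntegrable_norm _ _), integral_neg_one_zero] at h2
  simp only [intervalIntegral.integral_const, smul_eq_mul] at h2
  linarith

lemma integral_sum_shift_zero_le (h : InversionSystem c U u K M) {b : ℝ} (hb0 : 0 ≤ b)
    (hb1 : b ≤ 1) :
    ∫ x in (0 : ℝ)..b, ∑ j ∈ Finset.range K,
      (‖u (x + 2 * (j + 1))‖ + ‖u (x - 2 * (j + 1))‖) ≤ (∫ x in (0 : ℝ)..b, ‖u x‖) + 2 * M := by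
  have h1 := h.integral_sum_shift_le (q := 1) (by norm_num) le_rfl
  have key : ∀ p r, -1 ≤ p → p ≤ r → r ≤ 1 → ∫ x in p..r, ‖u x‖ ≤ M * (r - p) +
      ∫ x in p..r, ∑ j ∈ Finset.range K,
      (‖u (x + 2 * (j + 1))‖ + ‖u (x - 2 * (j + 1))‖) := by
    intro p r hp hpr hr
    have : ∫ x in p..r, ‖u x‖ ≤ ∫ x in p..r, (M + ∑ j ∈ Finset.range K,
        (‖u (x + 2 * (j + 1))‖ + ‖u (x - 2 * (j + 1))‖)) :=
      intervalIntegral.integral_mono_on hpr (h.intervalIntegrable_norm _ _)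
        ((continuous_const.add h.continuous_sum_shift).intervalIntegrable _ _)
        fun x hx => h.norm_le_sum_shift (abs_le.2 ⟨by linarith [hx.1], by linarith [hx.2]⟩)
    rw [intervalIntegral.integral_add (by simp)
      (h.continuous_sum_shift.intervalIntegrable _ _)] at this
    simp only [intervalIntegral.integral_const, smul_eq_mul] at this
    linarith
  have h2 := key (-1) 0 (by norm_num) (by norm_num) (by norm_num)
  have h3 := key b 1 (by linarith) hb1 le_rfl
  rw [integral_neg_one_zero] at h2
  have ic := fun p r => h.continuous_sum_shift.intervalIntegrable (μ := volume) p r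
  have h4 := intervalIntegral.integral_add_adjacent_intervals (ic (-1) 0) (ic 0 b)
  have h5 := intervalIntegral.integral_add_adjacent_intervals (ic (-1) b) (ic b 1)
  have h6 := intervalIntegral.integral_add_adjacent_intervals
    (h.intervalIntegrable_norm 0 b) (h.intervalIntegrable_norm b 1)
  have := h.nonneg
  nlinarith

end InversionSystem

lemma exists_norm_one_mul_eq_norm (w : ℂ) : ∃ ω : ℂ, ‖ω‖ = 1 ∧ ω * w = (‖w‖ : ℂ) := by
  by_cases hw : w = 0
  · exact ⟨1, by simp, by simp [hw]⟩
  · have hn : (‖w‖ : ℂ) ≠ 0 := by simpa using hw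
    refine ⟨(starRingEnd ℂ) w / ‖w‖, by simp [hw], ?_⟩
    rw [div_mul_eq_mul_div, mul_comm, Complex.mul_conj, Complex.normSq_eq_norm_sq]
    field_simp
    push_cast
    ring

lemma norm_one_sub_le {c : ℂ} (hc : ‖c‖ = 1) (hre : c.re ^ 2 ≤ 1 / 2) : ‖1 - c‖ ≤ 37 / 20 := by
  have h1 : ‖1 - c‖ ^ 2 = 2 - 2 * c.re := by
    rw [← Complex.normSq_eq_norm_sq, Complex.normSq_apply]
    have : c.re * c.re + c.im * c.im = 1 := by
      rw [← Complex.normSq_apply, Complex.normSq_eq_norm_sq, hc]; norm_num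
    simp
    linear_combination this
  have h2 : -c.re ≤ 71 / 100 := by nlinarith
  nlinarith [norm_nonneg (1 - c)]

namespace InversionSystem

variable {c : ℂ} {U u : ℝ → ℂ} {K : ℕ} {M q : ℝ}

/-- Increments of `U` on `[0, q]` nearly point in the direction of `U q`. -/
lemma norm_sub_le_re (h : InversionSystem c U u K M) {ω : ℂ} (hω : ‖ω‖ = 1)
    (hq : ω * U q = (‖U q‖ : ℂ)) {m : ℝ} (hm : (∫ x in (0 : ℝ)..q, ‖u x‖) ≤ ‖U q‖ + m) {a b : ℝ}
    (ha : 0 ≤ a) (hab : a ≤ b) (hb : b ≤ q) :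
    ‖U b - U a‖ - m ≤ (ω * (U b - U a)).re := by
  have i := h.intervalIntegrable_norm
  have h1 := h.norm_sub_le_integral ha
  have h2 := h.norm_sub_le_integral hab
  have h3 := h.norm_sub_le_integral hb
  have h4 := intervalIntegral.integral_add_adjacent_intervals (i 0 a) (i a b)
  have h5 := intervalIntegral.integral_add_adjacent_intervals (i 0 b) (i b q)
  rw [h.zero, sub_zero] at h1
  have h6 : (ω * (U a + (U q - U b))).re ≤ ‖U a‖ + ‖U q - U b‖ :=
    (Complex.re_le_norm _).trans (by rw [norm_mul, hω, one_mul]; exact norm_add_le _ _)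
  have h7 : (ω * (U b - U a)).re = ‖U q‖ - (ω * (U a + (U q - U b))).re := by
    have : ω * (U b - U a) = ω * U q - ω * (U a + (U q - U b)) := by ring
    rw [this, hq, Complex.sub_re, Complex.ofReal_re]
  linarith

/-- The difference of the truncated sums at `b` and `0`. -/
lemma norm_add_sub_le (h : InversionSystem c U u K M) {b : ℝ} (hb0 : 0 ≤ b) (hb1 : b ≤ 1) :
    ‖U b + (U (b - 2) - U (-2))‖ ≤
      (∫ x in (0 : ℝ)..b, ‖u x‖) + 4 * M - ‖U (b - 2) - U (-2)‖ := by
  have hc := h.cont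
  have s1 := h.sum_U b (by rw [abs_of_nonneg hb0]; exact hb1)
  have s0 := h.sum_U 0 (by simp)
  rw [h.zero] at s0
  have hshift : ∀ a, U (b + a) - U a = ∫ x in (0 : ℝ)..b, u (x + a) := by
    intro a
    rw [intervalIntegral.integral_comp_add_right, zero_add,
      intervalIntegral.integral_eq_sub_of_hasDerivAt (fun x _ => h.deriv x)
      (h.cont.intervalIntegrable _ _)]
  have hW := h.integral_sum_shift_zero_le hb0 hb1
  set w : ℕ → ℝ → ℝ := fun j x => ‖u (x + 2 * (j + 1))‖ + ‖u (x - 2 * (j + 1))‖ with hw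
  obtain ⟨z, hz⟩ : ∃ z : ℕ → ℂ, z = fun j : ℕ => (U (b + 2 * (j + 1)) + U (b - 2 * (j + 1))) -
    (U (0 + 2 * (j + 1)) + U (0 - 2 * (j + 1))) := ⟨_, rfl⟩
  set d := U (b - 2) - U (-2) with hd
  have iw : ∀ j, IntervalIntegrable (w j) volume 0 b := fun j =>
    Continuous.intervalIntegrable (by fun_prop) _ _
  have hterm : ∀ j : ℕ, ‖U (b + 2 * (j + 1)) - U (0 + 2 * (j + 1))‖ ≤
      ∫ x in (0 : ℝ)..b, ‖u (x + 2 * (j + 1))‖ := fun j => by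
    rw [zero_add, hshift]
    exact intervalIntegral.norm_integral_le_integral_norm hb0
  have hterm' : ∀ j : ℕ, ‖U (b - 2 * (j + 1)) - U (0 - 2 * (j + 1))‖ ≤
      ∫ x in (0 : ℝ)..b, ‖u (x - 2 * (j + 1))‖ := fun j => by
    rw [zero_sub, sub_eq_add_neg b, hshift]
    simp only [← sub_eq_add_neg]
    exact intervalIntegral.norm_integral_le_integral_norm hb0
  have hsplit : ∀ j, ∫ x in (0 : ℝ)..b, w j x = (∫ x in (0 : ℝ)..b, ‖u (x + 2 * (j + 1))‖) +
      ∫ x in (0 : ℝ)..b, ‖u (x - 2 * (j + 1))‖ := fun j =>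
    intervalIntegral.integral_add (Continuous.intervalIntegrable (by fun_prop) _ _)
      (Continuous.intervalIntegrable (by fun_prop) _ _)
  have hzj : ∀ j ∈ Finset.range K, ‖z j - (if j = 0 then d else 0)‖ ≤
      (∫ x in (0 : ℝ)..b, w j x) - (if j = 0 then ‖d‖ else 0) := by
    intro j _
    rw [hsplit]
    split_ifs with hj
    · subst hj
      have e : z 0 - d = U (b + 2 * ((0 : ℕ) + 1)) - U (0 + 2 * ((0 : ℕ) + 1)) := by
        simp only [hz, hd, Nat.cast_zero, zero_add, mul_one, zero_sub]
        ring
      have h1 := hterm 0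
      have h2 := hterm' 0
      have e2 : U (b - 2 * ((0 : ℕ) + 1)) - U (0 - 2 * ((0 : ℕ) + 1)) = d := by
        simp [hd]
      rw [e2] at h2
      rw [e]
      linarith
    · have e : z j = (U (b + 2 * (j + 1)) - U (0 + 2 * (j + 1))) +
        (U (b - 2 * (j + 1)) - U (0 - 2 * (j + 1))) := by
        simp only [hz]; ring
      rw [sub_zero, sub_zero, e]
      exact (norm_add_le _ _).trans (add_le_add (hterm j) (hterm' j))
  have hsum := norm_sum_le_of_le _ hzj
  rw [Finset.sum_sub_distrib, Finset.sum_sub_distrib, Finset.sum_ite_eq' (Finset.range K) 0,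
    Finset.sum_ite_eq' (Finset.range K) 0, if_pos (Finset.mem_range.2 h.one_le),
    if_pos (Finset.mem_range.2 h.one_le),
    ← intervalIntegral.integral_finsetSum (fun j _ => iw j)] at hsum
  set Z := ∑ j ∈ Finset.range K, z j with hZ
  have e3 : U b + Z = (U b + ∑ j ∈ Finset.range K, (U (b + 2 * (j + 1)) + U (b - 2 * (j + 1)))) -
      (0 + ∑ j ∈ Finset.range K, (U (0 + 2 * (j + 1)) + U (0 - 2 * (j + 1)))) := by
    rw [hZ, hz, Finset.sum_sub_distrib]; ring
  have e4 : ‖U b + Z‖ ≤ 2 * M := by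
    rw [e3]; exact (norm_sub_le _ _).trans (by linarith)
  have e5 : U b + d = (U b + Z) - (Z - d) := by ring
  rw [e5]
  refine (norm_sub_le _ _).trans ?_
  linarith

lemma integral_norm_le (h : InversionSystem c U u K M) :
    ∫ x in (0 : ℝ)..(399 / 400), ‖u x‖ ≤ 40000 * M := by
  have M0 := h.nonneg
  set q : ℝ := 399 / 400 with hq
  set b : ℝ := 398 / 399 with hb
  have hqb : (2 - b)⁻¹ = q := by norm_num [hq, hb]
  have i := h.intervalIntegrable_norm
  set V := ∫ x in (0 : ℝ)..q, ‖u x‖ with hV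
  set m := 800 * M with hm
  have hD : V ≤ ‖U q‖ + m := by
    have := h.excess_le (q := q) (by norm_num [hq]) (by norm_num [hq])
    norm_num [hq] at this
    linarith
  obtain ⟨ω, hω, hωq⟩ := exists_norm_one_mul_eq_norm (U q)
  have inc := fun {a b : ℝ} => h.norm_sub_le_re hω hωq hD (a := a) (b := b)
  have ib := inc (a := 0) (b := b) le_rfl (by norm_num [hb]) (by norm_num [hb, hq])
  have ih := inc (a := 0) (b := 1 / 2) le_rfl (by norm_num) (by norm_num [hq])
  have iq := inc (a := 1 / 2) (b := q) (by norm_num) (by norm_num [hq]) le_rfl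
  have hVb : (∫ x in (0 : ℝ)..b, ‖u x‖) ≤ ‖U b‖ + m := by
    have := h.excess_mono (a := b) (b := q) (by norm_num [hq, hb])
    linarith
  have hVh : ‖U (1 / 2)‖ ≤ ‖U q‖ + m := by
    have h1 := h.excess_nonneg (a := 1 / 2) (by norm_num)
    have h2 := intervalIntegral.integral_add_adjacent_intervals (i 0 (1 / 2)) (i (1 / 2) q)
    have h3 : 0 ≤ ∫ x in (1 / 2 : ℝ)..q, ‖u x‖ :=
      intervalIntegral.integral_nonneg (by norm_num [hq]) fun _ _ => norm_nonneg _
    linarith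
  rw [h.zero, sub_zero] at ib ih
  have main := h.norm_add_sub_le (b := b) (by norm_num [hb]) (by norm_num [hb])
  have e1 : U (b - 2) = (starRingEnd ℂ) c * (((2 - b) ^ (-(3 / 2) : ℝ) : ℝ) : ℂ) * U q := by
    have := h.inv_neg (x := 2 - b) (by norm_num [hb])
    rwa [neg_sub, hqb] at this
  have e2 : U (-2) = (starRingEnd ℂ) c * (((2 : ℝ) ^ (-(3 / 2) : ℝ) : ℝ) : ℂ) * U (1 / 2) := by
    have := h.inv_neg (x := 2) (by norm_num)
    rwa [inv_eq_one_div] at this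
  set β := (2 - b) ^ (-(3 / 2) : ℝ) with hβ
  set γ := (2 : ℝ) ^ (-(3 / 2) : ℝ) with hγ
  have hβ1 : β ≤ 1 := Real.rpow_le_one_of_one_le_of_nonpos (by norm_num [hb]) (by norm_num)
  have hγ0 : 0 ≤ γ := by positivity
  have hγ2 : γ ^ 2 = 1 / 8 := by
    rw [hγ, ← Real.rpow_natCast, ← Real.rpow_mul (by norm_num)]
    norm_num
  have hγ1 : γ ≤ 36 / 100 := by nlinarith
  have hβ2 : 99 / 100 ≤ β := by
    have : (2 - b) ^ (-(2 : ℝ)) ≤ β :=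
      Real.rpow_le_rpow_of_exponent_le (by norm_num [hb]) (by norm_num)
    refine le_trans ?_ this
    norm_num [hb]
  set e : ℂ := β * U q - γ * U (1 / 2) with he
  have hd : U (b - 2) - U (-2) = (starRingEnd ℂ) c * e := by rw [e1, e2]; ring
  have hdn : ‖U (b - 2) - U (-2)‖ = ‖e‖ := by
    rw [hd, norm_mul, Complex.norm_conj, h.norm_c, one_mul]
  rw [hdn, hd] at main
  set v := ω * e with hv
  have hvn : ‖v‖ = ‖e‖ := by rw [hv, norm_mul, hω, one_mul]
  have m1 : (ω * U b).re + ((starRingEnd ℂ) c * v).re ≤ ‖U b + (starRingEnd ℂ) c * e‖ := by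
    have : (ω * U b).re + ((starRingEnd ℂ) c * v).re = (ω * (U b + (starRingEnd ℂ) c * e)).re := by
      rw [← Complex.add_re, hv]; congr 1; ring
    rw [this]
    refine (Complex.re_le_norm _).trans ?_
    rw [norm_mul, hω, one_mul]
  have hev : e = ((β - γ : ℝ) : ℂ) * U (1 / 2) + (β : ℂ) * (U q - U (1 / 2)) := by
    rw [he]; push_cast; ring
  have hvre : v.re = (β - γ) * (ω * U (1 / 2)).re + β * (ω * (U q - U (1 / 2))).re := by
    rw [hv, hev, ← Complex.re_ofReal_mul, ← Complex.re_ofReal_mul, ← Complex.add_re]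
    congr 1; ring
  have hen : ‖e‖ ≤ (β - γ) * ‖U (1 / 2)‖ + β * ‖U q - U (1 / 2)‖ := by
    rw [hev]
    refine (norm_add_le _ _).trans ?_
    rw [norm_mul, norm_mul, Complex.norm_real, Complex.norm_real,
      Real.norm_of_nonneg (by linarith : 0 ≤ β - γ), Real.norm_of_nonneg (by linarith : 0 ≤ β)]
  have m0 : 0 ≤ m := by positivity
  have m2 : ‖e‖ - 2 * m ≤ v.re := by
    rw [hvre]
    have h1 := mul_le_mul_of_nonneg_left ih (by linarith : 0 ≤ β - γ)
    have h2 := mul_le_mul_of_nonneg_left iq (by linarith : 0 ≤ β)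
    nlinarith
  have m3 : ‖e‖ + ((starRingEnd ℂ) c * v).re ≤ 2 * m + 4 * M := by linarith
  have m4 : v.re - ((starRingEnd ℂ) c * v).re ≤ 37 / 20 * ‖e‖ := by
    have : v.re - ((starRingEnd ℂ) c * v).re = ((1 - (starRingEnd ℂ) c) * v).re := by
      rw [← Complex.sub_re]; congr 1; ring
    rw [this]
    refine (Complex.re_le_norm _).trans ?_
    rw [norm_mul, hvn]
    have := norm_one_sub_le (c := (starRingEnd ℂ) c) (by simp [h.norm_c]) (by simpa using h.re_c)
    gcongr
  have m5 : β * ‖U q‖ - γ * ‖U (1 / 2)‖ ≤ ‖e‖ := by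
    have : v.re = β * ‖U q‖ - γ * (ω * U (1 / 2)).re := by
      have : v = (β : ℂ) * (ω * U q) - (γ : ℂ) * (ω * U (1 / 2)) := by rw [hv, he]; ring
      rw [this, hωq, Complex.sub_re, Complex.re_ofReal_mul, Complex.re_ofReal_mul,
        Complex.ofReal_re]
    have h2 : (ω * U (1 / 2)).re ≤ ‖U (1 / 2)‖ :=
      (Complex.re_le_norm _).trans (by rw [norm_mul, hω, one_mul])
    have h3 : v.re ≤ ‖e‖ := hvn ▸ Complex.re_le_norm v
    nlinarith
  nlinarith [norm_nonneg (U q)]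

lemma norm_le_of_abs_le (h : InversionSystem c U u K M) {y : ℝ} (hy : |y| ≤ 399 / 400) :
    ‖U y‖ ≤ 40000 * M := by
  have key : ∀ {c : ℂ} {U u : ℝ → ℂ}, InversionSystem c U u K M → ∀ y, 0 ≤ y → y ≤ 399 / 400 →
      ‖U y‖ ≤ 40000 * M := by
    intro c U u h y hy0 hy1
    have h1 := h.excess_nonneg hy0
    have i := h.intervalIntegrable_norm
    have h2 := intervalIntegral.integral_add_adjacent_intervals (i 0 y) (i y (399 / 400))
    have h3 : 0 ≤ ∫ x in y..(399 / 400), ‖u x‖ :=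
      intervalIntegral.integral_nonneg hy1 fun _ _ => norm_nonneg _
    linarith [h.integral_norm_le]
  obtain ⟨h1, h2⟩ := abs_le.1 hy
  rcases le_total 0 y with h0 | h0
  · exact key h y h0 h2
  · simpa using key h.mirror (-y) (by linarith) (by linarith)

/-- The a priori bound. -/
theorem norm_le (h : InversionSystem c U u K M) {y : ℝ} (hy : |y| ≤ 1) :
    ‖U y‖ ≤ 10 ^ 6 * M := by
  have M0 := h.nonneg
  obtain ⟨x, hx, hmax⟩ := isCompact_Icc.exists_isMaxOn
    (Set.nonempty_Icc.2 (by norm_num : (-1 : ℝ) ≤ 1)) h.continuous_fun.norm.continuousOn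
  set E := ‖U x‖ with hEdef
  have hE : ∀ y, |y| ≤ 1 → ‖U y‖ ≤ E := fun y hy => hmax (abs_le.1 hy)
  have hN := h.exists_weighted_bound hE
  suffices hle : E ≤ 10 ^ 6 * M from (hE y hy).trans hle
  have hF : ∀ y, |y| ≤ 399 / 400 → ‖U y‖ ≤ 40000 * M := fun y hy => h.norm_le_of_abs_le hy
  by_cases h1 : |x| ≤ 399 / 400
  · linarith [hF x h1]
  push Not at h1
  have main : E ≤ 2 * (M + 6 * (40000 * M) + (1 - 399 / 400) * (16 * M + 96 * E)) := by
    rcases le_total 0 x with h0 | h0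
    · rw [abs_of_nonneg h0] at h1
      exact h.norm_le_near_one (by norm_num) hF hN h1.le hx.2
    · rw [abs_of_nonpos h0] at h1
      have := h.mirror.norm_le_near_one (b := 399 / 400) (F := 40000 * M)
        (N := 16 * M + 96 * E) (by norm_num) (fun y hy => hF (-y) (by simpa using hy))
        (fun y hy => by simpa using hN (-y) (by simpa using hy)) h1.le (by linarith [hx.1])
      simpa using this
  linarith

theorem one_sub_sq_mul_norm_le (h : InversionSystem c U u K M) {y : ℝ} (hy : |y| ≤ 1) :
    (1 - y ^ 2) * ‖u y‖ ≤ 10 ^ 8 * M := by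
  have := h.exists_weighted_bound (fun y hy => h.norm_le hy) y hy
  have := h.nonneg
  linarith

end InversionSystem

lemma norm_cexp_neg_pi_mul_sq_le {b : ℂ} (hb : 0 ≤ b.re) (x : ℝ) :
    ‖Complex.exp (-π * b * x ^ 2)‖ ≤ 1 := by
  rw [Complex.norm_exp]
  have : (-π * b * x ^ 2 : ℂ).re = -(π * b.re * x ^ 2) := by
    have : (-π * b * x ^ 2 : ℂ) = ((-π * x ^ 2 : ℝ) : ℂ) * b := by push_cast; ring
    rw [this, Complex.re_ofReal_mul]; ring
  rw [this]
  have : 0 ≤ π * b.re * x ^ 2 := by have := pi_pos; positivity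
  exact Real.exp_le_one_iff.2 (by linarith)

lemma MeasureTheory.Integrable.mul_cexp_neg_pi_mul_sq {g : ℝ → ℂ} (hg : Integrable g) {b : ℂ}
    (hb : 0 ≤ b.re) : Integrable fun x : ℝ => g x * Complex.exp (-π * b * x ^ 2) := by
  refine hg.mul_bdd (c := 1) (Continuous.aestronglyMeasurable (by fun_prop))
    (Filter.Eventually.of_forall fun x => norm_cexp_neg_pi_mul_sq_le hb x)

lemma SchwartzMap.integrable_pow_smul (h : SchwartzMap ℝ ℂ) (k : ℕ) :
    Integrable fun x : ℝ => (x : ℂ) ^ k * h x := by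
  refine (h.integrable_pow_mul volume k).mono' ?_ ?_
  · exact Continuous.aestronglyMeasurable (by have := h.continuous; fun_prop)
  · exact Filter.Eventually.of_forall fun x => by simp

lemma SchwartzMap.integrable_deriv (h : SchwartzMap ℝ ℂ) : Integrable (deriv (⇑h)) := by
  have e : ⇑(SchwartzMap.derivCLM ℂ ℂ h) = deriv (⇑h) :=
    funext fun x => SchwartzMap.derivCLM_apply ℂ h x
  exact e ▸ (SchwartzMap.derivCLM ℂ ℂ h).integrable

/-- The Gaussian moment `∫ x h(x) exp(-π b x²) dx`. -/
noncomputable def gaussianMoment (h : SchwartzMap ℝ ℂ) (b : ℂ) : ℂ :=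
  ∫ x : ℝ, ((x : ℂ) ^ 1 * h x) * Complex.exp (-π * b * x ^ 2)

lemma integral_deriv_mul_gaussian (h : SchwartzMap ℝ ℂ) {b : ℂ} (hb : 0 ≤ b.re) :
    ∫ x : ℝ, deriv (⇑h) x * Complex.exp (-π * b * x ^ 2) = 2 * π * b * gaussianMoment h b := by
  have d1 : ∀ x : ℝ, HasDerivAt (⇑h) (deriv (⇑h) x) x := fun x =>
    h.differentiableAt.hasDerivAt
  have d2 : ∀ x : ℝ, HasDerivAt (fun x : ℝ => Complex.exp (-π * b * x ^ 2))
      (Complex.exp (-π * b * x ^ 2) * (-π * b * (2 * x))) x := by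
    intro x
    have : HasDerivAt (fun x : ℝ => (-π * b * (x : ℂ) ^ 2)) (-π * b * (2 * x)) x := by
      have := (((hasDerivAt_id x).ofReal_comp).pow 2).const_mul (-π * b)
      simpa using this
    exact this.cexp
  have i0 := h.integrable_deriv
  have i1 := i0.mul_cexp_neg_pi_mul_sq hb
  have i2 := ((h.integrable_pow_smul 1).mul_cexp_neg_pi_mul_sq hb).const_mul (-(2 * π * b))
  have i3 := (h.integrable (μ := volume)).mul_cexp_neg_pi_mul_sq hb
  have := integral_eq_zero_of_hasDerivAt_of_integrable
    (f := fun x : ℝ => h x * Complex.exp (-π * b * x ^ 2))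
    (f' := fun x : ℝ => deriv (⇑h) x * Complex.exp (-π * b * x ^ 2) +
      -(2 * π * b) * (((x : ℂ) ^ 1 * h x) * Complex.exp (-π * b * x ^ 2)))
    (fun x => ((d1 x).mul (d2 x)).congr_deriv (by ring)) (i1.add i2) i3
  rw [integral_add i1 i2, integral_const_mul] at this
  rw [gaussianMoment]
  linear_combination this

lemma gaussianMoment_inv (h : SchwartzMap ℝ ℂ) {κ : ℂ}
    (hF : ∀ ξ, 𝓕 (⇑h) ξ = -(Complex.I * κ) * h ξ) {b : ℂ} (hb : 0 < b.re) :
    κ * gaussianMoment h b = (b ^ (1 / 2 : ℂ))⁻¹ * b⁻¹ * gaussianMoment h b⁻¹ := by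
  have i0 := h.integrable_deriv
  have b0 : b ≠ 0 := fun h0 => by simp [h0] at hb
  have hb' : 0 ≤ (b⁻¹).re := by
    rw [Complex.inv_re]; exact div_nonneg hb.le (Complex.normSq_nonneg b)
  have ig : Integrable fun x : ℝ => Complex.exp (-π * b * x ^ 2) := by
    have := integrable_cexp_neg_mul_sq (b := π * b) (by
      rw [Complex.re_ofReal_mul]; exact mul_pos pi_pos hb)
    simpa [neg_mul] using this
  have flip : ∫ ξ, 𝓕 (deriv (⇑h)) ξ * Complex.exp (-π * b * ξ ^ 2) =
      ∫ x, deriv (⇑h) x * 𝓕 (fun x : ℝ => Complex.exp (-π * b * x ^ 2)) x := by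
    have := VectorFourier.integral_fourierIntegral_smul_eq_flip (L := innerₗ ℝ) (μ := volume)
      (ν := volume) continuous_fourierChar continuous_inner i0 ig
    rw [flip_innerₗ] at this
    exact this
  rw [fourier_gaussian_pi hb, Real.fourier_deriv h.integrable h.differentiable i0] at flip
  have e1 : ∫ ξ : ℝ, ((2 * π * Complex.I * ξ) • 𝓕 (⇑h) ξ) * Complex.exp (-π * b * ξ ^ 2) =
      2 * π * κ * gaussianMoment h b := by
    rw [gaussianMoment, ← integral_const_mul]
    refine integral_congr_ae (Filter.Eventually.of_forall fun ξ => ?_)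
    simp only [hF, smul_eq_mul]
    linear_combination (-2 * π * κ * ξ * h ξ * Complex.exp (-π * b * ξ ^ 2)) * Complex.I_sq
  have e2 : ∫ x : ℝ, deriv (⇑h) x * (1 / b ^ (1 / 2 : ℂ) * Complex.exp (-π / b * x ^ 2)) =
      (b ^ (1 / 2 : ℂ))⁻¹ * (2 * π * b⁻¹ * gaussianMoment h b⁻¹) := by
    rw [← integral_deriv_mul_gaussian h hb', ← integral_const_mul]
    refine integral_congr_ae (Filter.Eventually.of_forall fun ξ => ?_)
    simp only [div_eq_mul_inv]
    ring
  have e3 := e1.symm.trans (flip.trans e2)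
  have : (2 * π : ℂ) ≠ 0 := by simp [pi_ne_zero]
  refine mul_left_cancel₀ this ?_
  linear_combination e3

lemma continuousOn_gaussianMoment (h : SchwartzMap ℝ ℂ) :
    ContinuousOn (gaussianMoment h) {b | 0 ≤ b.re} := by
  rw [continuousOn_iff_continuous_domRestrict]
  refine continuous_of_dominated (bound := fun x : ℝ => ‖(x : ℂ) ^ 1 * h x‖) (fun b => ?_)
    (fun b => Filter.Eventually.of_forall fun x => ?_) (h.integrable_pow_smul 1).norm
    (Filter.Eventually.of_forall fun x => ?_)
  · exact Continuous.aestronglyMeasurable (by have := h.continuous; fun_prop)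
  · rw [norm_mul]
    exact mul_le_of_le_one_right (norm_nonneg _) (norm_cexp_neg_pi_mul_sq_le b.2 x)
  · fun_prop

/-- The boundary values of the Gaussian moment. -/
noncomputable def oscillatoryMoment (h : SchwartzMap ℝ ℂ) (τ : ℝ) : ℂ :=
  gaussianMoment h (-(Complex.I * τ))

/-- The inversion multiplier. -/
noncomputable def inversionMultiplier (κ : ℂ) : ℂ := κ * (((-Complex.I) ^ (1 / 2 : ℂ))⁻¹ * Complex.I)

lemma inversionMultiplier_sq {κ : ℂ} (hκ : κ ^ 2 = 1) :
    inversionMultiplier κ ^ 2 = -Complex.I := by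
  have : ((-Complex.I) ^ (1 / 2 : ℂ)) ^ 2 = -Complex.I := by
    rw [one_div]; exact_mod_cast Complex.cpow_nat_inv_pow (-Complex.I) two_ne_zero
  rw [inversionMultiplier, mul_pow, mul_pow, hκ, inv_pow, this, Complex.I_sq]
  simp

lemma oscillatoryMoment_inv (h : SchwartzMap ℝ ℂ) {κ : ℂ} (hκ : κ ^ 2 = 1)
    (hF : ∀ ξ, 𝓕 (⇑h) ξ = -(Complex.I * κ) * h ξ) {τ : ℝ} (hτ : 0 < τ) :
    oscillatoryMoment h τ = inversionMultiplier κ * ((τ ^ (-(3 / 2) : ℝ) : ℝ) : ℂ) *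
      oscillatoryMoment h (-τ⁻¹) := by
  set b₀ : ℂ := -(Complex.I * τ) with hb₀
  have hb0 : b₀ ≠ 0 := by simp [hb₀, hτ.ne']
  have hb0inv : b₀⁻¹ = -(Complex.I * ((-τ⁻¹ : ℝ) : ℂ)) := by
    have : (τ : ℂ) ≠ 0 := by exact_mod_cast hτ.ne'
    rw [hb₀, inv_neg, mul_inv, Complex.inv_I]
    push_cast
    ring
  have l1 : Filter.Tendsto (fun y : ℝ => (y : ℂ) + b₀) (nhdsWithin 0 (Set.Ioi 0)) (nhds b₀) := by
    have : Continuous fun y : ℝ => (y : ℂ) + b₀ := by fun_prop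
    simpa using (this.tendsto 0).mono_left nhdsWithin_le_nhds
  have re0 : b₀.re = 0 := by simp [hb₀]
  have re0' : (b₀⁻¹).re = 0 := by rw [hb0inv]; simp
  have ev : ∀ᶠ y : ℝ in nhdsWithin 0 (Set.Ioi 0), 0 < ((y : ℂ) + b₀).re := by
    filter_upwards [self_mem_nhdsWithin] with y hy
    simpa [re0] using hy
  have l2 : Filter.Tendsto (fun y : ℝ => gaussianMoment h ((y : ℂ) + b₀))
      (nhdsWithin 0 (Set.Ioi 0)) (nhds (gaussianMoment h b₀)) :=
    ((continuousOn_gaussianMoment h) b₀ re0.ge).tendsto.comp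
      (tendsto_nhdsWithin_iff.2 ⟨l1, ev.mono fun y hy => le_of_lt hy⟩)
  have l3 : Filter.Tendsto (fun y : ℝ => gaussianMoment h ((y : ℂ) + b₀)⁻¹)
      (nhdsWithin 0 (Set.Ioi 0)) (nhds (gaussianMoment h b₀⁻¹)) := by
    refine ((continuousOn_gaussianMoment h) b₀⁻¹ re0'.ge).tendsto.comp
      (tendsto_nhdsWithin_iff.2 ⟨l1.inv₀ hb0, ev.mono fun y hy => ?_⟩)
    rw [Set.mem_ofPred_eq, Complex.inv_re]; exact div_nonneg (le_of_lt hy) (Complex.normSq_nonneg _)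
  have slit : b₀ ∈ Complex.slitPlane := by
    rw [Complex.mem_slitPlane_iff]; right; simp [hb₀, hτ.ne']
  have l4 : Filter.Tendsto (fun y : ℝ => ((y : ℂ) + b₀) ^ (1 / 2 : ℂ))
      (nhdsWithin 0 (Set.Ioi 0)) (nhds (b₀ ^ (1 / 2 : ℂ))) :=
    l1.cpow tendsto_const_nhds slit
  have hp : b₀ ^ (1 / 2 : ℂ) ≠ 0 := by simp [Complex.cpow_eq_zero_iff, hb0]
  have lim := tendsto_nhds_unique (l2.const_mul κ)
    ((((l4.inv₀ hp).mul (l1.inv₀ hb0)).mul l3).congr' (ev.mono fun y hy =>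
      (gaussianMoment_inv h hF hy).symm))
  have hcp : b₀ ^ (1 / 2 : ℂ) = ((τ ^ (1 / 2 : ℝ) : ℝ) : ℂ) * (-Complex.I) ^ (1 / 2 : ℂ) := by
    have : b₀ = (τ : ℂ) * (-Complex.I) := by rw [hb₀]; ring
    have hI : -Complex.I ≠ 0 := neg_ne_zero.2 Complex.I_ne_zero
    have hτ' : (τ : ℂ) ≠ 0 := by exact_mod_cast hτ.ne'
    rw [this, Complex.ofReal_cpow hτ.le, Complex.cpow_def_of_ne_zero (mul_ne_zero hτ' hI),
      Complex.cpow_def_of_ne_zero hτ', Complex.cpow_def_of_ne_zero hI,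
      Complex.log_ofReal_mul hτ hI, Complex.ofReal_log hτ.le, ← Complex.exp_add]
    push_cast
    ring_nf
  have hτp : τ ^ (-(3 / 2) : ℝ) = (τ ^ (1 / 2 : ℝ))⁻¹ * τ⁻¹ := by
    rw [← Real.rpow_neg hτ.le, ← Real.rpow_neg_one τ, ← Real.rpow_add hτ]; norm_num
  rw [oscillatoryMoment, oscillatoryMoment, ← hb0inv, ← hb₀, inversionMultiplier, hτp]
  rw [hcp] at lim
  have h1 : b₀⁻¹ = Complex.I * ((τ⁻¹ : ℝ) : ℂ) := by rw [hb0inv]; push_cast; ring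
  rw [h1] at lim ⊢
  rw [mul_inv] at lim
  push_cast at lim ⊢
  linear_combination κ * lim - gaussianMoment h b₀ * hκ

/-- The Fourier integral `τ ↦ ∫ φ(t) exp(π i τ t) dt`. -/
noncomputable def dilatedFourier (φ : ℝ → ℂ) (τ : ℝ) : ℂ := 𝓕 φ (-(τ / 2))

lemma dilatedFourier_eq (φ : ℝ → ℂ) (τ : ℝ) :
    dilatedFourier φ τ = ∫ t : ℝ, φ t * Complex.exp (π * Complex.I * τ * t) := by
  rw [dilatedFourier, Real.fourier_eq']
  refine integral_congr_ae (Filter.Eventually.of_forall fun t => ?_)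
  simp only [smul_eq_mul, RCLike.inner_apply, conj_trivial]
  rw [mul_comm]
  congr 2
  push_cast
  ring

lemma integrable_of_norm_le_inv_one_add_sq {φ : ℝ → ℂ} {C : ℝ} (hc : Continuous φ)
    (hC : ∀ t, ‖φ t‖ ≤ C * (1 + t ^ 2)⁻¹) : Integrable φ :=
  (integrable_inv_one_add_sq.const_mul C).mono' hc.aestronglyMeasurable
    (Filter.Eventually.of_forall hC)

lemma summable_norm_int_of_norm_le {φ : ℝ → ℂ} {C : ℝ} (hC : ∀ t, ‖φ t‖ ≤ C * (1 + t ^ 2)⁻¹) :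
    Summable fun n : ℤ => ‖φ n‖ := by
  have hC0 : 0 ≤ C := by have := (norm_nonneg _).trans (hC 0); simpa using this
  have h1 : Summable fun n : ℤ => (1 : ℝ) / (n : ℝ) ^ 2 :=
    Real.summable_one_div_int_pow.2 one_lt_two
  refine Summable.of_norm_bounded_eventually (h1.mul_left C) ?_
  have : ∀ᶠ n : ℤ in Filter.cofinite, n ≠ 0 := Set.finite_singleton 0 |>.compl_mem_cofinite
  filter_upwards [this] with n hn
  rw [norm_norm]
  refine (hC n).trans (mul_le_mul_of_nonneg_left ?_ hC0)
  rw [one_div]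
  have : (n : ℝ) ≠ 0 := by exact_mod_cast hn
  exact inv_anti₀ (by positivity) (by linarith)

section

variable {φ : ℝ → ℂ} {C C' : ℝ}

lemma norm_dilatedFourier_shift_le (hW : ∀ τ, 1 ≤ |τ| → ‖dilatedFourier φ τ‖ ≤ C' / τ ^ 2)
    {x : ℝ} (hx : |x| ≤ 1) (j : ℕ) :
    ‖dilatedFourier φ (x + 2 * (j + 1))‖ ≤ C' * (1 / ((j : ℝ) + 1) ^ 2) ∧
      ‖dilatedFourier φ (x - 2 * (j + 1))‖ ≤ C' * (1 / ((j : ℝ) + 1) ^ 2) := by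
  have hC0 : 0 ≤ C' := by simpa using (norm_nonneg _).trans (hW 1 (by simp))
  obtain ⟨hx1, hx2⟩ := abs_le.1 hx
  have hj : (0 : ℝ) ≤ j := j.cast_nonneg
  have key : ∀ τ : ℝ, (j : ℝ) + 1 ≤ |τ| → ‖dilatedFourier φ τ‖ ≤ C' * (1 / ((j : ℝ) + 1) ^ 2) := by
    intro τ hτ
    refine (hW τ (by linarith)).trans ?_
    rw [div_eq_mul_one_div, ← sq_abs τ]
    gcongr
  exact ⟨key _ (le_trans (by linarith) (le_abs_self _)),
    key _ (le_trans (by linarith) (neg_le_abs _))⟩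

lemma norm_tsum_shift_le (hc : Continuous φ) (hC : ∀ t, ‖φ t‖ ≤ C * (1 + t ^ 2)⁻¹)
    (hW : ∀ τ, 1 ≤ |τ| → ‖dilatedFourier φ τ‖ ≤ C' / τ ^ 2) {x : ℝ} (hx : |x| ≤ 1) :
    ‖(∑' j : ℕ, (dilatedFourier φ (x + 2 * (j + 1)) + dilatedFourier φ (x - 2 * (j + 1)))) +
      dilatedFourier φ x‖ ≤ ∑' n : ℤ, ‖φ n‖ := by
  have hs : Summable fun j : ℕ => C' * (1 / ((j : ℝ) + 1) ^ 2) := by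
    have := (summable_nat_add_iff 1).2 (Real.summable_one_div_nat_pow.2 one_lt_two)
    exact Summable.mul_left C' (by simpa using this)
  have hp : Summable fun j : ℕ => dilatedFourier φ (x + 2 * (j + 1)) :=
    Summable.of_norm_bounded hs fun j => (norm_dilatedFourier_shift_le hW hx j).1
  have hm : Summable fun j : ℕ => dilatedFourier φ (x - 2 * (j + 1)) :=
    Summable.of_norm_bounded hs fun j => (norm_dilatedFourier_shift_le hW hx j).2
  let φx : ℝ → ℂ := fun t => φ t * Complex.exp (π * Complex.I * x * t)
  have hnorm : ∀ t, ‖φx t‖ = ‖φ t‖ := fun t => by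
    have : (π * Complex.I * x * t : ℂ) = ((π * x * t : ℝ) : ℂ) * Complex.I := by push_cast; ring
    simp only [φx, norm_mul, this, Complex.norm_exp_ofReal_mul_I, mul_one]
  have hF : ∀ k : ℤ, 𝓕 φx k = dilatedFourier φ (x - 2 * k) := by
    intro k
    rw [dilatedFourier_eq, Real.fourier_eq']
    refine integral_congr_ae (Filter.Eventually.of_forall fun t => ?_)
    simp only [smul_eq_mul, RCLike.inner_apply, conj_trivial, φx]
    rw [mul_comm, mul_assoc, ← Complex.exp_add]
    congr 2
    push_cast
    ring
  have e1 := HasSum.of_add_one_of_neg_add_one (f := fun k : ℤ => dilatedFourier φ (x - 2 * k))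
    (m := ∑' j : ℕ, dilatedFourier φ (x - 2 * (j + 1)))
    (m' := ∑' j : ℕ, dilatedFourier φ (x + 2 * (j + 1)))
    (by simpa using hm.hasSum)
    (by
      have e : ∀ j : ℕ, x - 2 * (((-((j : ℤ) + 1) : ℤ)) : ℝ) = x + 2 * (j + 1) := fun j => by
        push_cast; ring
      simpa only [e] using hp.hasSum)
  have hcx : Continuous φx := by fun_prop
  have hO : φx =O[Filter.cocompact ℝ] fun t : ℝ => |t| ^ (-2 : ℝ) := by
    refine Asymptotics.IsBigO.of_bound C ?_
    have : ∀ᶠ t : ℝ in Filter.cocompact ℝ, t ≠ 0 :=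
      (isCompact_singleton (x := (0 : ℝ))).compl_mem_cocompact
    filter_upwards [this] with t ht
    have hC0 : 0 ≤ C := by simpa using (norm_nonneg _).trans (hC 0)
    rw [hnorm, Real.norm_of_nonneg (by positivity), Real.rpow_neg (abs_nonneg t), Real.rpow_two,
      sq_abs]
    exact (hC t).trans (mul_le_mul_of_nonneg_left (inv_anti₀ (by positivity) (by linarith)) hC0)
  have e2 := Real.tsum_eq_tsum_fourier_of_rpow_decay_of_summable hcx one_lt_two hO
    (by simpa only [hF] using e1.summable) 0
  simp only [hF, zero_add] at e2
  have e3 : ∑' n : ℤ, φx n = ∑' k : ℤ, dilatedFourier φ (x - 2 * k) := by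
    rw [e2]
    refine tsum_congr fun k => ?_
    have : fourier k (((0 : ℝ)) : UnitAddCircle) = 1 := by simp
    rw [this, mul_one]
  have hsum := summable_norm_int_of_norm_le hC
  have e4 : ‖∑' n : ℤ, φx n‖ ≤ ∑' n : ℤ, ‖φ n‖ := by
    have := norm_tsum_le_tsum_norm (f := fun n : ℤ => φx n) (by simpa only [hnorm] using hsum)
    simpa only [hnorm] using this
  rw [e3, e1.tsum_eq] at e4
  rw [hp.tsum_add hm]
  refine le_of_eq_of_le (congrArg _ ?_) e4
  simp only [Int.cast_zero, mul_zero, sub_zero]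
  ring

/-- Truncated Poisson summation: the sums of `∫ φ(t) exp(π i τ t) dt` over `τ ∈ x + 2ℤ`. -/
lemma eventually_norm_sum_shift_le (hc : Continuous φ) (hC : ∀ t, ‖φ t‖ ≤ C * (1 + t ^ 2)⁻¹)
    (hW : ∀ τ, 1 ≤ |τ| → ‖dilatedFourier φ τ‖ ≤ C' / τ ^ 2) {η : ℝ} (hη : 0 < η) :
    ∀ᶠ K : ℕ in Filter.atTop, ∀ x : ℝ, |x| ≤ 1 →
      ‖dilatedFourier φ x + ∑ j ∈ Finset.range K,
        (dilatedFourier φ (x + 2 * (j + 1)) + dilatedFourier φ (x - 2 * (j + 1)))‖ ≤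
      (∑' n : ℤ, ‖φ n‖) + η := by
  have hs : Summable fun j : ℕ => 2 * (C' * (1 / ((j : ℝ) + 1) ^ 2)) := by
    have := (summable_nat_add_iff 1).2 (Real.summable_one_div_nat_pow.2 one_lt_two)
    exact (Summable.mul_left C' (by simpa using this)).mul_left 2
  have hu := Metric.tendstoUniformlyOn_iff.1 (tendstoUniformlyOn_tsum_nat (s := {x : ℝ | |x| ≤ 1})
    (f := fun (j : ℕ) (x : ℝ) =>
      dilatedFourier φ (x + 2 * (j + 1)) + dilatedFourier φ (x - 2 * (j + 1))) hs
    fun j x hx => (norm_add_le _ _).trans (by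
      have := norm_dilatedFourier_shift_le hW hx j
      linarith [this.1, this.2])) η hη
  filter_upwards [hu] with K hK x hx
  have h1 := hK x hx
  have h2 := norm_tsum_shift_le hc hC hW hx
  rw [dist_eq_norm, norm_sub_rev] at h1
  calc _ = ‖((∑' j : ℕ, (dilatedFourier φ (x + 2 * (j + 1)) +
        dilatedFourier φ (x - 2 * (j + 1)))) + dilatedFourier φ x) +
        (∑ j ∈ Finset.range K,
          (dilatedFourier φ (x + 2 * (j + 1)) + dilatedFourier φ (x - 2 * (j + 1))) -
        ∑' j : ℕ, (dilatedFourier φ (x + 2 * (j + 1)) + dilatedFourier φ (x - 2 * (j + 1))))‖ := by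
        congr 1; ring
    _ ≤ _ := (norm_add_le _ _).trans (add_le_add h2 h1.le)

end

lemma continuous_dilatedFourier {φ : ℝ → ℂ} (hφ : Integrable φ) :
    Continuous (dilatedFourier φ) := by
  have : Continuous (𝓕 φ) := VectorFourier.fourierIntegral_continuous continuous_fourierChar
    continuous_inner hφ
  exact this.comp (by fun_prop)

lemma hasDerivAt_dilatedFourier {φ : ℝ → ℂ} (hφ : Integrable φ)
    (hφ' : Integrable fun t : ℝ => π * Complex.I * t * φ t) (τ : ℝ) :
    HasDerivAt (dilatedFourier φ) (dilatedFourier (fun t : ℝ => π * Complex.I * t * φ t) τ) τ := by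
  have hπ : (π * Complex.I : ℂ) ≠ 0 := by simp [pi_ne_zero]
  have i1 : Integrable fun t : ℝ => t • φ t := by
    refine (hφ'.const_mul (π * Complex.I : ℂ)⁻¹).congr (Filter.Eventually.of_forall fun t => ?_)
    simp only [Complex.real_smul]
    field_simp
  have h1 := Real.hasDerivAt_fourier hφ i1 (-(τ / 2))
  have h2 : HasDerivAt (fun τ : ℝ => -(τ / 2)) (-(1 / 2)) τ := by
    simpa using ((hasDerivAt_id τ).div_const 2).fun_neg
  refine (h1.scomp τ h2).congr_deriv ?_
  rw [dilatedFourier, Real.fourier_eq', Real.fourier_eq', ← integral_smul]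
  refine integral_congr_ae (Filter.Eventually.of_forall fun t => ?_)
  simp only [smul_eq_mul, Complex.real_smul]
  push_cast
  ring

/-- The function `t ↦ h(√t)`. -/
noncomputable def sqrtProfile (h : SchwartzMap ℝ ℂ) (t : ℝ) : ℂ := h (√t)

section

variable {h : SchwartzMap ℝ ℂ}

lemma continuous_sqrtProfile (h : SchwartzMap ℝ ℂ) : Continuous (sqrtProfile h) :=
  h.continuous.comp continuous_sqrt

lemma sqrtProfile_of_nonpos (h0 : h 0 = 0) {t : ℝ} (ht : t ≤ 0) : sqrtProfile h t = 0 := by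
  rw [sqrtProfile, Real.sqrt_eq_zero_of_nonpos ht, h0]

lemma exists_norm_sqrtProfile_le (h0 : h 0 = 0) : ∃ C : ℝ,
    (∀ t, ‖sqrtProfile h t‖ ≤ C * (1 + t ^ 2)⁻¹) ∧
    ∀ t : ℝ, ‖π * Complex.I * t * sqrtProfile h t‖ ≤ C * (1 + t ^ 2)⁻¹ := by
  have dec : ∀ k : ℕ, ∃ D : ℝ, 0 < D ∧ ∀ x : ℝ, |x| ^ k * ‖h x‖ ≤ D := fun k => by
    simpa using h.decay k 0
  obtain ⟨D0, p0, d0⟩ := dec 0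
  obtain ⟨D2, p2, d2⟩ := dec 2
  obtain ⟨D4, p4, d4⟩ := dec 4
  obtain ⟨D6, p6, d6⟩ := dec 6
  have hπ := pi_pos
  refine ⟨(D0 + D4) + π * (D2 + D6), fun t => ?_, fun t => ?_⟩
  all_goals
    rcases le_total t 0 with ht | ht
    · rw [sqrtProfile_of_nonpos h0 ht]; simp; positivity
    rw [← div_eq_mul_inv, le_div_iff₀ (by positivity)]
    obtain ⟨x, hx0, rfl⟩ : ∃ x : ℝ, 0 ≤ x ∧ t = x ^ 2 := ⟨√t, Real.sqrt_nonneg t, (Real.sq_sqrt ht).symm⟩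
    have := d0 x
    have := d2 x
    have := d4 x
    have := d6 x
    rw [abs_of_nonneg hx0] at *
  · rw [sqrtProfile, Real.sqrt_sq hx0]
    have : 0 ≤ π * (D2 + D6) := by positivity
    nlinarith
  · rw [sqrtProfile, Real.sqrt_sq hx0, norm_mul, norm_mul, norm_mul, Complex.norm_I,
      Complex.norm_real, Complex.norm_real, Real.norm_of_nonneg hπ.le,
      Real.norm_of_nonneg (sq_nonneg x)]
    have e : π * (x ^ 2 * ‖h x‖ + x ^ 6 * ‖h x‖) ≤ π * (D2 + D6) := by gcongr
    linarith

lemma dilatedFourier_sqrtProfile (hodd : ∀ x, h (-x) = -h x) (τ : ℝ) :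
    dilatedFourier (sqrtProfile h) τ = oscillatoryMoment h τ := by
  have h0 : h 0 = 0 := by
    have := hodd 0
    rw [neg_zero] at this
    linear_combination this / 2
  let G : ℝ → ℂ := fun x => ((x : ℂ) ^ 1 * h x) * Complex.exp (-π * (-(Complex.I * τ)) * x ^ 2)
  let g : ℝ → ℂ := fun t => sqrtProfile h t * Complex.exp (π * Complex.I * τ * t)
  have iG : Integrable G := (h.integrable_pow_smul 1).mul_cexp_neg_pi_mul_sq (by simp)
  have even : ∀ x, G (-x) = G x := fun x => by simp [G, hodd]
  have e1 : ∫ x, G x = 2 * ∫ x in Set.Ioi (0 : ℝ), G x := by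
    rw [← intervalIntegral.integral_Iic_add_Ioi (b := (0 : ℝ)) iG.integrableOn iG.integrableOn]
    have : ∫ x in Set.Iic (0 : ℝ), G x = ∫ x in Set.Ioi (0 : ℝ), G x := by
      have := integral_comp_neg_Iic (0 : ℝ) G
      simpa only [even, neg_zero] using this
    rw [this]; ring
  have e2 : ∫ t, g t = ∫ t in Set.Ioi (0 : ℝ), g t := by
    refine (setIntegral_eq_integral_of_forall_compl_eq_zero fun t ht => ?_).symm
    simp [g, sqrtProfile_of_nonpos h0 (not_lt.1 ht)]
  rw [dilatedFourier_eq, oscillatoryMoment, gaussianMoment]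
  change ∫ t, g t = ∫ x, G x
  rw [e1, e2, ← integral_comp_rpow_Ioi g two_ne_zero, ← integral_const_mul]
  refine setIntegral_congr_fun measurableSet_Ioi fun x hx => ?_
  have hx0 : 0 ≤ x := le_of_lt hx
  have e3 : x ^ ((2 : ℝ) - 1) = x := by norm_num
  simp only [G, g, e3, Real.rpow_two, sqrtProfile, Real.sqrt_sq hx0, Complex.real_smul, abs_two]
  push_cast
  ring_nf

end

namespace InversionPair

variable {c : ℂ} {U u : ℝ → ℂ}

lemma norm_le_mul_abs (h : InversionPair c U u) {r S : ℝ} (hS : ∀ y, |y| ≤ r → ‖u y‖ ≤ S)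
    {y : ℝ} (hy : |y| ≤ r) : ‖U y‖ ≤ S * |y| := by
  have hr : 0 ≤ r := (abs_nonneg y).trans hy
  have := (convex_Icc (-r) r).norm_image_sub_le_of_norm_hasDerivWithin_le
    (fun x _ => (h.deriv x).hasDerivWithinAt) (fun x hx => hS x (abs_le.2 hx))
    (x := 0) (y := y) ⟨by linarith, hr⟩ (abs_le.1 hy)
  simpa [h.zero] using this

lemma exists_decay_pos (h : InversionPair c U u) :
    ∃ C : ℝ, ∀ τ, 1 ≤ τ → ‖U τ‖ ≤ C / τ ^ 2 ∧ ‖u τ‖ ≤ C / τ ^ 2 := by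
  obtain ⟨S, hS⟩ := isCompact_Icc.exists_bound_of_continuousOn (s := Set.Icc (-1 : ℝ) 1)
    h.cont.continuousOn
  have hS' : ∀ y : ℝ, |y| ≤ 1 → ‖u y‖ ≤ S := fun y hy => hS y (abs_le.1 hy)
  have hS0 : 0 ≤ S := (norm_nonneg _).trans (hS' 0 (by simp))
  refine ⟨3 * S, fun τ hτ => ?_⟩
  have h0 : 0 < τ := by linarith
  have hi1 : |-τ⁻¹| = τ⁻¹ := by rw [abs_neg, abs_of_pos (inv_pos.2 h0)]
  have hi : |-τ⁻¹| ≤ 1 := hi1.trans_le (inv_le_one_of_one_le₀ hτ)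
  have hU := h.norm_le_mul_abs hS' hi
  have hu := hS' _ hi
  have hU1 : ‖U (-τ⁻¹)‖ ≤ S := hU.trans (mul_le_of_le_one_right hS0 hi)
  have e2 : τ ^ (-2 : ℝ) = (τ ^ 2)⁻¹ := by rw [Real.rpow_neg h0.le, Real.rpow_two]
  have p5 : τ ^ (-(5 / 2) : ℝ) ≤ (τ ^ 2)⁻¹ :=
    e2 ▸ Real.rpow_le_rpow_of_exponent_le hτ (by norm_num)
  have p7 : τ ^ (-(7 / 2) : ℝ) ≤ (τ ^ 2)⁻¹ :=
    e2 ▸ Real.rpow_le_rpow_of_exponent_le hτ (by norm_num)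
  have e5 : τ ^ (-(3 / 2) : ℝ) * τ⁻¹ = τ ^ (-(5 / 2) : ℝ) := by
    rw [← Real.rpow_neg_one τ, ← Real.rpow_add h0]; norm_num
  have n5 : 0 ≤ τ ^ (-(5 / 2) : ℝ) := Real.rpow_nonneg h0.le _
  have n7 : 0 ≤ τ ^ (-(7 / 2) : ℝ) := Real.rpow_nonneg h0.le _
  have q5 : τ ^ (-(5 / 2) : ℝ) * S ≤ (τ ^ 2)⁻¹ * S := by gcongr
  have q7 : τ ^ (-(7 / 2) : ℝ) * S ≤ (τ ^ 2)⁻¹ * S := by gcongr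
  have q0 : 0 ≤ (τ ^ 2)⁻¹ * S := by positivity
  have n3 : 0 ≤ τ ^ (-(3 / 2) : ℝ) := Real.rpow_nonneg h0.le _
  have e3 : 3 * S / τ ^ 2 = 3 * ((τ ^ 2)⁻¹ * S) := by ring
  constructor
  · rw [h.norm_inv_pos h0, e3]
    calc _ ≤ τ ^ (-(3 / 2) : ℝ) * (S * τ⁻¹) := by
          rw [hi1] at hU; gcongr
      _ = τ ^ (-(5 / 2) : ℝ) * S := by rw [← e5]; ring
      _ ≤ _ := by linarith
  · refine (h.norm_deriv_inv_pos h0).trans ?_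
    rw [e3]
    calc _ ≤ 3 / 2 * τ ^ (-(5 / 2) : ℝ) * S + τ ^ (-(7 / 2) : ℝ) * S := by gcongr
      _ ≤ _ := by linarith

lemma exists_decay (h : InversionPair c U u) :
    ∃ C : ℝ, ∀ τ, 1 ≤ |τ| → ‖U τ‖ ≤ C / τ ^ 2 ∧ ‖u τ‖ ≤ C / τ ^ 2 := by
  obtain ⟨C, hC⟩ := h.exists_decay_pos
  obtain ⟨D, hD⟩ := h.mirror.exists_decay_pos
  refine ⟨max C D, fun τ hτ => ?_⟩
  rcases le_total 0 τ with h0 | h0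
  · rw [abs_of_nonneg h0] at hτ
    have : C / τ ^ 2 ≤ max C D / τ ^ 2 := by gcongr; exact le_max_left _ _
    exact ⟨(hC τ hτ).1.trans this, (hC τ hτ).2.trans this⟩
  · rw [abs_of_nonpos h0] at hτ
    have : D / τ ^ 2 ≤ max C D / τ ^ 2 := by gcongr; exact le_max_right _ _
    have := hD _ hτ
    simp only [neg_neg, norm_neg, neg_sq] at this
    exact ⟨by linarith [this.1], by linarith [this.2]⟩

end InversionPair

lemma inversionMultiplier_norm {κ : ℂ} (hκ : κ ^ 2 = 1) : ‖inversionMultiplier κ‖ = 1 := by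
  have := congrArg norm (inversionMultiplier_sq hκ)
  rw [norm_pow, norm_neg, Complex.norm_I] at this
  exact (pow_eq_one_iff_of_nonneg (norm_nonneg _) two_ne_zero).1 this

lemma inversionMultiplier_re_sq {κ : ℂ} (hκ : κ ^ 2 = 1) :
    (inversionMultiplier κ).re ^ 2 = 1 / 2 := by
  have h1 := congrArg Complex.re (inversionMultiplier_sq hκ)
  have h2 : (inversionMultiplier κ).re ^ 2 + (inversionMultiplier κ).im ^ 2 = 1 := by
    have := Complex.sq_norm (inversionMultiplier κ)
    rw [inversionMultiplier_norm hκ, Complex.normSq_apply] at this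
    linarith
  rw [sq, Complex.mul_re, Complex.neg_re, Complex.I_re] at h1
  linarith

/-- The function `t ↦ π i t h(√t)`. -/
noncomputable def momentProfile (h : SchwartzMap ℝ ℂ) (t : ℝ) : ℂ :=
  π * Complex.I * t * sqrtProfile h t

/-- The lattice sum controlling `h`. -/
noncomputable def latticeNorm (h : SchwartzMap ℝ ℂ) : ℝ := ∑' n : ℤ, ‖momentProfile h n‖

section

variable {h : SchwartzMap ℝ ℂ} {κ : ℂ}

lemma apply_zero_of_odd (hodd : ∀ x, h (-x) = -h x) : h 0 = 0 := by
  have := hodd 0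
  rw [neg_zero] at this
  linear_combination this / 2

lemma continuous_momentProfile (h : SchwartzMap ℝ ℂ) : Continuous (momentProfile h) := by
  have := continuous_sqrtProfile h
  unfold momentProfile
  fun_prop

lemma inversionPair_dilatedFourier (hodd : ∀ x, h (-x) = -h x) (hκ : κ ^ 2 = 1)
    (hF : ∀ ξ, 𝓕 (⇑h) ξ = -(Complex.I * κ) * h ξ) (hd : deriv (⇑h) 0 = 0) :
    InversionPair (inversionMultiplier κ) (dilatedFourier (sqrtProfile h))
      (dilatedFourier (momentProfile h)) := by
  obtain ⟨C, hC, hC'⟩ := exists_norm_sqrtProfile_le (apply_zero_of_odd hodd)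
  have i0 := integrable_of_norm_le_inv_one_add_sq (continuous_sqrtProfile h) hC
  have i1 := integrable_of_norm_le_inv_one_add_sq (continuous_momentProfile h) hC'
  refine ⟨inversionMultiplier_norm hκ, (inversionMultiplier_re_sq hκ).le,
    fun x => hasDerivAt_dilatedFourier i0 i1 x, continuous_dilatedFourier i1, ?_, fun x hx => ?_⟩
  · have i2 : Integrable fun x : ℝ => x • h x := by
      simpa using h.integrable_pow_smul 1
    have e1 := congrFun (Real.deriv_fourier h.integrable i2) 0
    have e2 : 𝓕 (⇑h) = fun ξ => -(Complex.I * κ) * h ξ := funext hF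
    rw [e2, deriv_const_mul _ h.differentiableAt, hd, mul_zero, Real.fourier_eq'] at e1
    rw [dilatedFourier_sqrtProfile hodd, oscillatoryMoment, gaussianMoment]
    have hπ : (-2 * π * Complex.I : ℂ) ≠ 0 := by simp [pi_ne_zero]
    refine mul_left_cancel₀ hπ ?_
    rw [mul_zero, e1, ← integral_const_mul]
    refine integral_congr_ae (Filter.Eventually.of_forall fun t => ?_)
    simp
    ring
  · rw [dilatedFourier_sqrtProfile hodd, dilatedFourier_sqrtProfile hodd]
    exact oscillatoryMoment_inv h hκ hF hx

lemma tsum_norm_sqrtProfile_le (h0 : h 0 = 0) :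
    ∑' n : ℤ, ‖sqrtProfile h n‖ ≤ latticeNorm h := by
  obtain ⟨C, hC, hC'⟩ := exists_norm_sqrtProfile_le h0
  refine Summable.tsum_le_tsum (fun n => ?_) (summable_norm_int_of_norm_le hC)
    (summable_norm_int_of_norm_le (φ := momentProfile h) hC')
  rcases eq_or_ne n 0 with rfl | hn
  · simp [momentProfile, sqrtProfile, h0]
  rw [momentProfile, norm_mul, norm_mul, norm_mul, Complex.norm_I, Complex.norm_real,
    Complex.norm_real, Real.norm_of_nonneg pi_pos.le, mul_one]
  have h1 : (1 : ℝ) ≤ ‖(n : ℝ)‖ := by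
    rw [Real.norm_eq_abs]; exact_mod_cast Int.one_le_abs hn
  have h2 : 1 ≤ π * ‖(n : ℝ)‖ := by nlinarith [Real.pi_gt_three]
  exact le_mul_of_one_le_left (norm_nonneg _) h2

lemma exists_inversionSystem (hodd : ∀ x, h (-x) = -h x) (hκ : κ ^ 2 = 1)
    (hF : ∀ ξ, 𝓕 (⇑h) ξ = -(Complex.I * κ) * h ξ) (hd : deriv (⇑h) 0 = 0) {η : ℝ} (hη : 0 < η) :
    ∃ K, InversionSystem (inversionMultiplier κ) (dilatedFourier (sqrtProfile h))
      (dilatedFourier (momentProfile h)) K (latticeNorm h + η) := by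
  have hp := inversionPair_dilatedFourier hodd hκ hF hd
  obtain ⟨C, hC, hC'⟩ := exists_norm_sqrtProfile_le (apply_zero_of_odd hodd)
  obtain ⟨D, hD⟩ := hp.exists_decay
  obtain ⟨K, ⟨h1, h2⟩, h3⟩ := ((eventually_norm_sum_shift_le (continuous_sqrtProfile h) hC
    (fun τ hτ => (hD τ hτ).1) hη).and (eventually_norm_sum_shift_le (continuous_momentProfile h) hC'
    (fun τ hτ => (hD τ hτ).2) hη)).and (Filter.eventually_ge_atTop 1) |>.exists
  exact ⟨K, hp, h3, fun x hx => (h1 x hx).trans (by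
    linarith [tsum_norm_sqrtProfile_le (apply_zero_of_odd hodd)]), h2⟩

lemma norm_dilatedFourier_sqrtProfile_le (hodd : ∀ x, h (-x) = -h x) (hκ : κ ^ 2 = 1)
    (hF : ∀ ξ, 𝓕 (⇑h) ξ = -(Complex.I * κ) * h ξ) (hd : deriv (⇑h) 0 = 0) {y : ℝ} (hy : |y| ≤ 1) :
    ‖dilatedFourier (sqrtProfile h) y‖ ≤ 10 ^ 6 * latticeNorm h ∧
      (1 - y ^ 2) * ‖dilatedFourier (momentProfile h) y‖ ≤ 10 ^ 8 * latticeNorm h := by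
  constructor <;> refine le_of_forall_pos_le_add fun η hη => ?_
  · obtain ⟨K, hK⟩ := exists_inversionSystem hodd hκ hF hd (η := η / 10 ^ 6) (by positivity)
    exact (hK.norm_le hy).trans_eq (by ring)
  · obtain ⟨K, hK⟩ := exists_inversionSystem hodd hκ hF hd (η := η / 10 ^ 8) (by positivity)
    exact (hK.one_sub_sq_mul_norm_le hy).trans_eq (by ring)

end

/-- The weight `(1 + |τ|) ^ (-3/2)`. -/
noncomputable def decayWeight (τ : ℝ) : ℝ := (1 + ‖τ‖) ^ (-(3 / 2) : ℝ)

lemma integrable_decayWeight : Integrable decayWeight :=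
  integrable_one_add_norm (E := ℝ) (by simp; norm_num)

lemma decayWeight_nonneg (τ : ℝ) : 0 ≤ decayWeight τ := Real.rpow_nonneg (by positivity) _

lemma decayWeight_le_one (τ : ℝ) : decayWeight τ ≤ 1 :=
  Real.rpow_le_one_of_one_le_of_nonpos (by linarith [norm_nonneg τ]) (by norm_num)

lemma rpow_three_half_le_of_sq {a b : ℝ} (ha : 0 ≤ a) (hb : 0 ≤ b) (h : a ^ 3 ≤ b ^ 2) :
    a ^ (3 / 2 : ℝ) ≤ b := by
  refine (Real.rpow_le_rpow_iff (z := 2) (by positivity) hb two_pos).1 ?_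
  rw [← Real.rpow_mul ha]
  norm_num
  exact_mod_cast h

lemma rpow_le_mul_decayWeight {t : ℝ} {τ : ℝ} (ht : 1 ≤ t) (hτ : |τ| ≤ t) :
    t ^ (-(3 / 2) : ℝ) ≤ 3 * decayWeight τ := by
  have h0 : 0 < t := by linarith
  have h1 : (2 * t) ^ (-(3 / 2) : ℝ) ≤ decayWeight τ :=
    Real.rpow_le_rpow_of_nonpos (by positivity) (by rw [Real.norm_eq_abs]; linarith) (by norm_num)
  have h2 : (1 : ℝ) / 3 ≤ 2 ^ (-(3 / 2) : ℝ) := by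
    rw [Real.rpow_neg two_pos.le, one_div]
    exact inv_anti₀ (by positivity) (rpow_three_half_le_of_sq two_pos.le (by norm_num) (by norm_num))
  rw [Real.mul_rpow two_pos.le h0.le] at h1
  have h3 : 0 ≤ t ^ (-(3 / 2) : ℝ) := Real.rpow_nonneg h0.le _
  nlinarith

lemma decayWeight_le_of_abs_sub_le {τ σ : ℝ} (h : |τ - σ| ≤ 2) :
    decayWeight σ ≤ 6 * decayWeight τ := by
  have h0 : 0 ≤ |σ| := abs_nonneg σ
  have h1 : 1 + |τ| ≤ 3 * (1 + |σ|) := by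
    have : |τ| ≤ |τ - σ| + |σ| := by simpa using abs_add_le (τ - σ) σ
    linarith
  have h2 : (3 * (1 + |σ|)) ^ (-(3 / 2) : ℝ) ≤ decayWeight τ :=
    Real.rpow_le_rpow_of_nonpos (by positivity) (by rw [Real.norm_eq_abs]; exact h1) (by norm_num)
  have h3 : (1 : ℝ) / 6 ≤ 3 ^ (-(3 / 2) : ℝ) := by
    rw [Real.rpow_neg (by norm_num), one_div]
    exact inv_anti₀ (by positivity)
      (rpow_three_half_le_of_sq (by norm_num) (by norm_num) (by norm_num))
  rw [Real.mul_rpow (by norm_num) (by positivity)] at h2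
  have h4 := decayWeight_nonneg σ
  change _ * decayWeight σ ≤ _ at h2
  nlinarith

lemma integral_norm_shift_sub_le {g g' : ℝ → ℂ} {A s : ℝ} (hd : ∀ x, HasDerivAt g (g' x) x)
    (hA : 0 ≤ A) (hg : ∀ τ, ‖g τ‖ ≤ A * decayWeight τ)
    (hg' : ∀ τ, |(|τ| - 1)| * ‖g' τ‖ ≤ A * decayWeight τ) (hs : 0 < s) (hs2 : s ≤ 2) :
    ∫ τ, ‖g (τ + s) - g τ‖ ≤ (24 + 6 * ∫ τ, decayWeight τ) * A * √s := by
  set r := √s with hr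
  have hr0 : 0 < r := Real.sqrt_pos.2 hs
  have hrs : r ^ 2 = s := Real.sq_sqrt hs.le
  have hr2 : r ≤ 3 / 2 := by nlinarith
  let bump : ℝ → ℝ → ℝ := fun p => (Set.Icc (p - 3 * r) (p + 3 * r)).indicator fun _ => 2 * A
  have ib : ∀ p, Integrable (bump p) := fun p =>
    (integrable_indicator_iff measurableSet_Icc).2 (integrableOn_const (by simp))
  have vb : ∀ p, ∫ τ, bump p τ = 12 * r * A := fun p => by
    rw [integral_indicator measurableSet_Icc, setIntegral_const, Measure.real, Real.volume_Icc,
      ENNReal.toReal_ofReal (by linarith), smul_eq_mul]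
    ring
  have nb : ∀ p τ, 0 ≤ bump p τ := fun p τ => Set.indicator_nonneg (fun _ _ => by linarith) τ
  have ib2 : Integrable fun τ => bump 1 τ + bump (-1) τ := (ib 1).add (ib (-1))
  have iw := integrable_decayWeight.const_mul (6 * A * r)
  have key : ∀ τ, ‖g (τ + s) - g τ‖ ≤ (bump 1 τ + bump (-1) τ) + 6 * A * r * decayWeight τ := by
    intro τ
    have nw : 0 ≤ 6 * A * r * decayWeight τ := by have := decayWeight_nonneg τ; positivity
    by_cases hτ : |(|τ| - 1)| ≤ 3 * r
    · have h1 : 2 * A ≤ bump 1 τ + bump (-1) τ := by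
        obtain ⟨a1, a2⟩ := abs_le.1 hτ
        rcases le_total 0 τ with h0 | h0
        · rw [abs_of_nonneg h0] at a1 a2
          have : bump 1 τ = 2 * A := Set.indicator_of_mem (Set.mem_Icc.2 ⟨by linarith, by linarith⟩) _
          linarith [nb (-1) τ]
        · rw [abs_of_nonpos h0] at a1 a2
          have : bump (-1) τ = 2 * A := Set.indicator_of_mem (Set.mem_Icc.2 ⟨by linarith, by linarith⟩) _
          linarith [nb 1 τ]
      have h2 : ∀ σ, ‖g σ‖ ≤ A := fun σ =>
        (hg σ).trans (mul_le_of_le_one_right hA (decayWeight_le_one σ))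
      have := norm_sub_le (g (τ + s)) (g τ)
      linarith [h2 τ, h2 (τ + s)]
    · have hb : ∀ σ ∈ Set.Icc τ (τ + s), ‖g' σ‖ ≤ 6 * A * decayWeight τ / r := by
        intro σ hσ
        have hd : |τ - σ| ≤ s := abs_le.2 ⟨by linarith [hσ.2], by linarith [hσ.1]⟩
        have e1 : |(|τ| - 1)| ≤ |(|σ| - 1)| + |τ - σ| := by
          have h3 := abs_abs_sub_abs_le τ σ
          have h4 := abs_add_le (|σ| - 1) (|τ| - |σ|)
          have : |σ| - 1 + (|τ| - |σ|) = |τ| - 1 := by ring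
          rw [this] at h4
          linarith
        have e2 : r ≤ |(|σ| - 1)| := by nlinarith
        have e3 := hg' σ
        have e4 := decayWeight_le_of_abs_sub_le (hd.trans hs2)
        rw [le_div_iff₀ hr0]
        have e5 : ‖g' σ‖ * r ≤ |(|σ| - 1)| * ‖g' σ‖ := by
          rw [mul_comm]; gcongr
        have e6 : A * decayWeight σ ≤ A * (6 * decayWeight τ) := by gcongr
        linarith
      have := (convex_Icc τ (τ + s)).norm_image_sub_le_of_norm_hasDerivWithin_le
        (fun x _ => (hd x).hasDerivWithinAt) hb (x := τ) (y := τ + s) ⟨le_rfl, by linarith⟩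
        ⟨by linarith, le_rfl⟩
      have e7 : 6 * A * decayWeight τ / r * ‖τ + s - τ‖ = 6 * A * r * decayWeight τ := by
        rw [add_sub_cancel_left, Real.norm_of_nonneg hs.le, ← hrs]
        field_simp
      linarith [nb 1 τ, nb (-1) τ]
  calc _ ≤ ∫ τ, ((bump 1 τ + bump (-1) τ) + 6 * A * r * decayWeight τ) :=
        integral_mono_of_nonneg (Filter.Eventually.of_forall fun τ => norm_nonneg _)
          (ib2.add iw) (Filter.Eventually.of_forall key)
    _ = _ := by
      rw [integral_add ib2 iw, integral_add (ib 1) (ib (-1)), vb, vb,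
        integral_const_mul]
      ring

namespace InversionPair

variable {c : ℂ} {U u : ℝ → ℂ} {B : ℝ}

lemma norm_le_mul_abs_of_bounds (h : InversionPair c U u) {S : ℝ}
    (hU : ∀ y, |y| ≤ 1 → ‖U y‖ ≤ 10 ^ 6 * S)
    (hu : ∀ y, |y| ≤ 1 → (1 - y ^ 2) * ‖u y‖ ≤ 10 ^ 8 * S) {y : ℝ} (hy : |y| ≤ 1) :
    ‖U y‖ ≤ 2 * 10 ^ 8 * S * |y| ∧ (1 - |y|) * ‖u y‖ ≤ 2 * 10 ^ 8 * S := by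
  have hS : 0 ≤ S := by
    have := (norm_nonneg _).trans (hU 0 (by simp))
    linarith
  constructor
  · rcases le_total |y| (1 / 2) with h1 | h1
    · refine h.norm_le_mul_abs (r := 1 / 2) (fun z hz => ?_) h1
      have := hu z (by linarith)
      have hz2 : z ^ 2 ≤ 1 / 4 := by rw [← sq_abs]; nlinarith [abs_nonneg z]
      nlinarith [norm_nonneg (u z)]
    · have := hU y hy
      nlinarith
  · have := hu y hy
    have e : 1 - y ^ 2 = (1 - |y|) * (1 + |y|) := by rw [← sq_abs]; ring
    have h1 : 0 ≤ (1 - |y|) * ‖u y‖ := mul_nonneg (by linarith) (norm_nonneg _)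
    rw [e] at this
    nlinarith [abs_nonneg y]

lemma decay_bounds_of_one_lt (h : InversionPair c U u)
    (hB : ∀ y, |y| ≤ 1 → ‖U y‖ ≤ B * |y| ∧ (1 - |y|) * ‖u y‖ ≤ B) {τ : ℝ} (hτ : 1 < τ) :
    ‖U τ‖ ≤ 11 * B * decayWeight τ ∧ τ * ‖U τ‖ ≤ 11 * B * decayWeight τ ∧
      (τ - 1) * (‖U τ‖ + τ * ‖u τ‖) ≤ 11 * B * decayWeight τ := by
  have h0 : 0 < τ := by linarith
  have hB0 : 0 ≤ B := by simpa using hB 0 (by simp) |>.2.trans' (by simp)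
  have hi1 : |-τ⁻¹| = τ⁻¹ := by rw [abs_neg, abs_of_pos (inv_pos.2 h0)]
  have hi : |-τ⁻¹| ≤ 1 := hi1.trans_le (inv_le_one_of_one_le₀ hτ.le)
  obtain ⟨b1, b2⟩ := hB _ hi
  rw [hi1] at b1 b2
  have e5 : τ ^ (-(5 / 2) : ℝ) = τ ^ (-(3 / 2) : ℝ) * τ⁻¹ := by
    rw [← Real.rpow_neg_one τ, ← Real.rpow_add h0]; norm_num
  have e7 : τ ^ (-(7 / 2) : ℝ) = τ ^ (-(3 / 2) : ℝ) * τ⁻¹ * τ⁻¹ := by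
    rw [← e5, ← Real.rpow_neg_one τ, ← Real.rpow_add h0]; norm_num
  have hU := h.norm_inv_pos h0
  have hu := h.norm_deriv_inv_pos h0
  rw [e5, e7] at hu
  have hw := rpow_le_mul_decayWeight hτ.le (abs_of_pos h0).le
  have hp : 0 ≤ τ ^ (-(3 / 2) : ℝ) := Real.rpow_nonneg h0.le _
  generalize τ ^ (-(3 / 2) : ℝ) = p at *
  have hii : τ * τ⁻¹ = 1 := mul_inv_cancel₀ h0.ne'
  have hi0 : 0 < τ⁻¹ := inv_pos.2 h0
  have hi' : τ⁻¹ ≤ 1 := inv_le_one_of_one_le₀ hτ.le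
  generalize τ⁻¹ = i at *
  have hpB : p * B ≤ 3 * B * decayWeight τ := by nlinarith
  have hw0 : 0 ≤ B * decayWeight τ := mul_nonneg hB0 (decayWeight_nonneg τ)
  have f1 : ‖U τ‖ ≤ p * B * i := by rw [hU, mul_assoc]; gcongr
  have f2 : τ * ‖U τ‖ ≤ p * B := by
    calc _ ≤ τ * (p * B * i) := by gcongr
      _ = p * B := by linear_combination (p * B) * hii
  have hpB0 : 0 ≤ p * B := by positivity
  have f3 : τ * ‖u τ‖ ≤ 3 / 2 * p * B * i + p * i * ‖u (-i)‖ := by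
    calc _ ≤ τ * (3 / 2 * (p * i) * (B * i) + p * i * i * ‖u (-i)‖) := by
          refine mul_le_mul_of_nonneg_left (hu.trans ?_) h0.le
          gcongr
      _ = _ := by linear_combination (3 / 2 * p * B * i + p * i * ‖u (-i)‖) * hii
  refine ⟨f1.trans ?_, f2.trans ?_, ?_⟩
  · nlinarith
  · nlinarith
  · calc _ ≤ (τ - 1) * (p * B * i + (3 / 2 * p * B * i + p * i * ‖u (-i)‖)) := by
          refine mul_le_mul_of_nonneg_left (add_le_add f1 f3) (by linarith)
      _ = (1 - i) * (5 / 2 * (p * B)) + p * ((1 - i) * ‖u (-i)‖) := by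
          linear_combination (5 / 2 * p * B + p * ‖u (-i)‖) * hii
      _ ≤ (1 - i) * (5 / 2 * (p * B)) + p * B := by gcongr
      _ ≤ _ := by nlinarith

lemma decay_bounds (h : InversionPair c U u)
    (hB : ∀ y, |y| ≤ 1 → ‖U y‖ ≤ B * |y| ∧ (1 - |y|) * ‖u y‖ ≤ B) (τ : ℝ) :
    ‖U τ‖ ≤ 11 * B * decayWeight τ ∧ |τ| * ‖U τ‖ ≤ 11 * B * decayWeight τ ∧
      |(|τ| - 1)| * (‖U τ‖ + |τ| * ‖u τ‖) ≤ 11 * B * decayWeight τ := by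
  have hB0 : 0 ≤ B := by simpa using hB 0 (by simp) |>.2.trans' (by simp)
  rcases le_or_gt |τ| 1 with h1 | h1
  · have hw := rpow_le_mul_decayWeight le_rfl h1
    rw [Real.one_rpow] at hw
    have hw' : 3 * B ≤ 11 * B * decayWeight τ := by nlinarith
    obtain ⟨b1, b2⟩ := hB τ h1
    have a0 := abs_nonneg τ
    have n0 := norm_nonneg (U τ)
    have hUB : ‖U τ‖ ≤ B := b1.trans (mul_le_of_le_one_right hB0 h1)
    refine ⟨by linarith, by nlinarith, ?_⟩
    rw [abs_of_nonpos (by linarith), neg_sub, mul_add]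
    have f1 : (1 - |τ|) * ‖U τ‖ ≤ B := by nlinarith
    have f2 : (1 - |τ|) * (|τ| * ‖u τ‖) ≤ B := by
      have : |τ| * ((1 - |τ|) * ‖u τ‖) ≤ 1 * B :=
        mul_le_mul h1 b2 (mul_nonneg (by linarith) (norm_nonneg _)) zero_le_one
      linarith
    linarith
  · rcases le_total 0 τ with h0 | h0
    · rw [abs_of_nonneg h0] at h1 ⊢
      rw [abs_of_nonneg (by linarith : 0 ≤ τ - 1)]
      exact h.decay_bounds_of_one_lt hB h1
    · rw [abs_of_nonpos h0] at h1 ⊢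
      rw [abs_of_nonneg (by linarith : 0 ≤ -τ - 1)]
      have := h.mirror.decay_bounds_of_one_lt (B := B) (fun y hy => by
        simpa using hB (-y) (by simpa using hy)) h1
      simpa [decayWeight] using this

end InversionPair

section

variable {h : SchwartzMap ℝ ℂ} {κ : ℂ}

lemma norm_deriv_sqrtProfile_le (hodd : ∀ x, h (-x) = -h x) (hκ : κ ^ 2 = 1)
    (hF : ∀ ξ, 𝓕 (⇑h) ξ = -(Complex.I * κ) * h ξ) (hd : deriv (⇑h) 0 = 0) {t : ℝ}
    (ht : 1 / 2 ≤ t) : ∃ ψ' : ℂ, HasDerivAt (sqrtProfile h) ψ' t ∧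
      ‖ψ'‖ ≤ (24 + 6 * ∫ τ, decayWeight τ) * (22 * 10 ^ 8 * latticeNorm h) * √t⁻¹ := by
  have hp := inversionPair_dilatedFourier hodd hκ hF hd
  have hdec := hp.decay_bounds fun y hy => hp.norm_le_mul_abs_of_bounds
    (fun y hy => (norm_dilatedFourier_sqrtProfile_le hodd hκ hF hd hy).1)
    (fun y hy => (norm_dilatedFourier_sqrtProfile_le hodd hκ hF hd hy).2) hy
  obtain ⟨C, hC, -⟩ := exists_norm_sqrtProfile_le (apply_zero_of_odd hodd)
  have iψ := integrable_of_norm_le_inv_one_add_sq (continuous_sqrtProfile h) hC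
  set U := dilatedFourier (sqrtProfile h) with hU
  set u := dilatedFourier (momentProfile h)
  have hUc : Continuous U := continuous_dilatedFourier iψ
  set A : ℝ := 11 * (2 * 10 ^ 8 * latticeNorm h) with hAdef
  have hA : 0 ≤ A := by
    have : 0 ≤ latticeNorm h := tsum_nonneg fun n => norm_nonneg _
    positivity
  have iU : Integrable U := (integrable_decayWeight.const_mul A).mono' hUc.aestronglyMeasurable
    (Filter.Eventually.of_forall fun τ => (hdec τ).1)
  let g : ℝ → ℂ := fun τ => τ * U τ
  have gc : Continuous g := by fun_prop
  have ig : Integrable g := (integrable_decayWeight.const_mul A).mono' gc.aestronglyMeasurable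
    (Filter.Eventually.of_forall fun τ => by simpa [g] using (hdec τ).2.1)
  have gd : ∀ τ, HasDerivAt g (U τ + τ * u τ) τ := fun τ => by
    exact ((hasDerivAt_id τ).ofReal_comp.mul (hp.deriv τ)).congr_deriv (by simp)
  have ht0 : 0 < t := by linarith
  have hmod := integral_norm_shift_sub_le gd hA (fun τ => by simpa [g] using (hdec τ).2.1)
    (fun τ => le_trans (by gcongr; simpa using norm_add_le (U τ) (τ * u τ)) (hdec τ).2.2)
    (inv_pos.2 ht0) (by rw [inv_le_comm₀ ht0 two_pos]; linarith)
  let V : ℝ → ℂ := fun ξ => U (2 * ξ)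
  have iV : Integrable V := iU.comp_mul_left' two_ne_zero
  have iV' : Integrable fun ξ : ℝ => ξ • V ξ := by
    refine ((ig.comp_mul_left' two_ne_zero).const_mul (1 / 2 : ℂ)).congr
      (Filter.Eventually.of_forall fun ξ => ?_)
    simp only [g, V, Complex.real_smul]
    push_cast
    ring
  have hV : V = 𝓕⁻ (sqrtProfile h) := by
    funext ξ
    simp only [V, hU, dilatedFourier, Real.fourierInv_eq_fourier_neg]
    ring_nf
  have hψ : 𝓕 V = sqrtProfile h := by
    rw [hV]
    refine (continuous_sqrtProfile h).fourier_fourierInv_eq iψ ?_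
    have : 𝓕 (sqrtProfile h) = fun ξ => U (-2 * ξ) := by
      funext ξ
      simp only [hU, dilatedFourier]
      ring_nf
    rw [this]
    exact iU.comp_mul_left' (by norm_num)
  refine ⟨_, hψ ▸ Real.hasDerivAt_fourier iV iV' t, ?_⟩
  have e1 : (fun ξ : ℝ => (-2 * π * Complex.I * ξ) • V ξ) =
      fun ξ : ℝ => -(π * Complex.I) * g (2 * ξ) := by
    funext ξ
    simp only [g, V, smul_eq_mul]
    push_cast
    ring
  have iG : Integrable fun ξ : ℝ => -(π * Complex.I) * g (2 * ξ) :=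
    (ig.comp_mul_left' two_ne_zero).const_mul _
  have e2 := fourierIntegral_eq_half_sub_half_period_translate (V := ℝ) (w := t) ht0.ne' iG
  rw [e1, Real.fourier_eq, e2, norm_smul]
  refine (mul_le_mul_of_nonneg_left (norm_integral_le_integral_norm _) (norm_nonneg _)).trans ?_
  have e3 : ∀ ξ : ℝ, ‖-(π * Complex.I) * g (2 * ξ) -
      -(π * Complex.I) * g (2 * (ξ + (1 / (2 * ‖t‖ ^ 2)) • t))‖ =
        π * (fun τ => ‖g (τ + t⁻¹) - g τ‖) (2 * ξ) := by
    intro ξ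
    have : 2 * (ξ + (1 / (2 * ‖t‖ ^ 2)) • t) = 2 * ξ + t⁻¹ := by
      rw [Real.norm_of_nonneg ht0.le, smul_eq_mul]
      field_simp
    rw [this, ← mul_sub, norm_mul, norm_neg, norm_mul, Complex.norm_I, Complex.norm_real,
      Real.norm_of_nonneg pi_pos.le, norm_sub_rev, mul_one]
  simp only [Circle.norm_smul, e3]
  rw [integral_const_mul, Measure.integral_comp_mul_left (fun τ : ℝ => ‖g (τ + t⁻¹) - g τ‖) 2]
  have e4 : ‖(1 / 2 : ℂ)‖ = 1 / 2 := by norm_num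
  have e5 : 0 ≤ ∫ τ, ‖g (τ + t⁻¹) - g τ‖ := integral_nonneg fun _ => norm_nonneg _
  have e6 : 22 * 10 ^ 8 * latticeNorm h = A := by rw [hAdef]; ring
  rw [e4, e6, abs_of_pos (by norm_num), smul_eq_mul]
  nlinarith [Real.pi_lt_four]

lemma eq_zero_of_latticeNorm_eq_zero (hodd : ∀ x, h (-x) = -h x) (hκ : κ ^ 2 = 1)
    (hF : ∀ ξ, 𝓕 (⇑h) ξ = -(Complex.I * κ) * h ξ) (hd : deriv (⇑h) 0 = 0)
    (hS : latticeNorm h = 0) (x : ℝ) : h x = 0 := by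
  have hp := inversionPair_dilatedFourier hodd hκ hF hd
  obtain ⟨C, hC, -⟩ := exists_norm_sqrtProfile_le (apply_zero_of_odd hodd)
  have iψ := integrable_of_norm_le_inv_one_add_sq (continuous_sqrtProfile h) hC
  have hU : ∀ τ, dilatedFourier (sqrtProfile h) τ = 0 := fun τ => by
    have := (hp.decay_bounds (B := 0) (fun y hy => by
      simpa [hS] using hp.norm_le_mul_abs_of_bounds
        (fun y hy => (norm_dilatedFourier_sqrtProfile_le hodd hκ hF hd hy).1)
        (fun y hy => (norm_dilatedFourier_sqrtProfile_le hodd hκ hF hd hy).2) hy) τ).1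
    simpa using this
  have hF0 : 𝓕 (sqrtProfile h) = fun _ => 0 := by
    funext ξ
    have := hU (-2 * ξ)
    rw [dilatedFourier] at this
    convert this using 2
    ring
  have hψ : sqrtProfile h = fun _ => 0 := by
    rw [← (continuous_sqrtProfile h).fourierInv_fourier_eq iψ (by rw [hF0]; exact integrable_zero _ _ _),
      hF0]
    funext t
    simp [Real.fourierInv_eq']
  have hpos : ∀ x, 0 ≤ x → h x = 0 := fun x hx => by
    have := congrFun hψ (x ^ 2)
    rwa [sqrtProfile, Real.sqrt_sq hx] at this
  rcases le_total 0 x with hx | hx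
  · exact hpos x hx
  · have := hpos (-x) (by linarith)
    rw [hodd] at this
    exact neg_eq_zero.1 this

/-- The constant in the derivative bound for `t ↦ h(√t)`. -/
noncomputable def derivConstant : ℝ := (24 + 6 * ∫ τ, decayWeight τ) * (22 * 10 ^ 8)

lemma derivConstant_pos : 0 < derivConstant := by
  have : 0 ≤ ∫ τ, decayWeight τ := integral_nonneg decayWeight_nonneg
  unfold derivConstant
  positivity

lemma norm_sqrtProfile_natCast_le (hodd : ∀ x, h (-x) = -h x) (hκ : κ ^ 2 = 1)
    (hF : ∀ ξ, 𝓕 (⇑h) ξ = -(Complex.I * κ) * h ξ) (hd : deriv (⇑h) 0 = 0) {n : ℕ} (hn : 1 ≤ n)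
    {e : ℝ} (he : |e| ≤ 1 / 2) (hz : h √(n + e) = 0) :
    ‖sqrtProfile h n‖ ≤ derivConstant * latticeNorm h * √(2 / n) * |e| := by
  have hn' : (1 : ℝ) ≤ n := by exact_mod_cast hn
  obtain ⟨e1, e2⟩ := abs_le.1 he
  have hS : 0 ≤ latticeNorm h := tsum_nonneg fun n => norm_nonneg _
  have hQ := derivConstant_pos
  have key : ∀ t ∈ Set.Ici ((n : ℝ) / 2), HasDerivWithinAt (sqrtProfile h)
      (deriv (sqrtProfile h) t) (Set.Ici ((n : ℝ) / 2)) t ∧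
      ‖deriv (sqrtProfile h) t‖ ≤ derivConstant * latticeNorm h * √(2 / n) := by
    intro t ht
    have ht' : (n : ℝ) / 2 ≤ t := ht
    obtain ⟨d, hd1, hd2⟩ := norm_deriv_sqrtProfile_le hodd hκ hF hd (t := t) (by linarith)
    rw [hd1.deriv]
    refine ⟨hd1.hasDerivWithinAt, hd2.trans ?_⟩
    have : t⁻¹ ≤ 2 / n := by
      rw [← inv_div]; exact inv_anti₀ (by positivity) ht'
    calc _ = derivConstant * latticeNorm h * √t⁻¹ := by rw [derivConstant]; ring
      _ ≤ _ := by gcongr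
  have := (convex_Ici ((n : ℝ) / 2)).norm_image_sub_le_of_norm_hasDerivWithin_le
    (fun t ht => (key t ht).1) (fun t ht => (key t ht).2) (x := n + e) (y := n)
    (Set.mem_Ici.2 (by linarith)) (Set.mem_Ici.2 (by linarith))
  have hz' : sqrtProfile h (n + e) = 0 := hz
  rw [hz', sub_zero] at this
  simpa using this

lemma latticeNorm_le (hodd : ∀ x, h (-x) = -h x) (hκ : κ ^ 2 = 1)
    (hF : ∀ ξ, 𝓕 (⇑h) ξ = -(Complex.I * κ) * h ξ) (hd : deriv (⇑h) 0 = 0) {δ : ℝ} (hδ : 0 < δ)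
    (hδ2 : δ ≤ 1 / 2) {ε : ℕ → ℝ}
    (hε : ∀ n : ℕ, 1 ≤ n → |ε n| ≤ δ * (n : ℝ) ^ (-(7 / 4) : ℝ))
    (hz : ∀ n : ℕ, 1 ≤ n → h √((n : ℝ) + ε n) = 0) :
    latticeNorm h ≤
      8 * derivConstant * latticeNorm h * δ * ∑' n : ℤ, |(n : ℝ)| ^ (-(5 / 4) : ℝ) := by
  have h0 := apply_zero_of_odd hodd
  obtain ⟨C, -, hC'⟩ := exists_norm_sqrtProfile_le h0
  have hS : 0 ≤ latticeNorm h := tsum_nonneg fun n => norm_nonneg _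
  have hQ := derivConstant_pos
  rw [← tsum_mul_left]
  refine Summable.tsum_le_tsum (fun m => ?_)
    (summable_norm_int_of_norm_le (φ := momentProfile h) hC')
    ((Real.summable_abs_int_rpow (by norm_num)).mul_left _)
  rcases le_or_gt m 0 with hm | hm
  · have : (m : ℝ) ≤ 0 := by exact_mod_cast hm
    rw [momentProfile, sqrtProfile_of_nonpos h0 this, mul_zero, norm_zero]
    positivity
  · obtain ⟨n, rfl⟩ := Int.eq_ofNat_of_zero_le hm.le
    have hn : 1 ≤ n := by exact_mod_cast hm
    have hn' : (1 : ℝ) ≤ n := by exact_mod_cast hn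
    have hn0 : (0 : ℝ) < n := by linarith
    have hεn : |ε n| ≤ 1 / 2 := (hε n hn).trans ((mul_le_of_le_one_right hδ.le
      (Real.rpow_le_one_of_one_le_of_nonpos hn' (by norm_num))).trans hδ2)
    have b := norm_sqrtProfile_natCast_le hodd hκ hF hd hn hεn (hz n hn)
    simp only [Int.cast_natCast]
    rw [momentProfile, norm_mul, norm_mul, norm_mul, Complex.norm_I, Complex.norm_real,
      Complex.norm_real, Real.norm_of_nonneg pi_pos.le, mul_one, Real.norm_of_nonneg hn0.le,
      abs_of_pos hn0]
    have s1 : √(2 / n) = √2 * (n : ℝ) ^ (-(1 / 2) : ℝ) := by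
      rw [Real.sqrt_div two_pos.le, div_eq_mul_inv, Real.sqrt_eq_rpow n, Real.rpow_neg hn0.le]
    have s2 : (n : ℝ) * ((n : ℝ) ^ (-(1 / 2) : ℝ) * (n : ℝ) ^ (-(7 / 4) : ℝ)) =
        (n : ℝ) ^ (-(5 / 4) : ℝ) := by
      nth_rw 1 [← Real.rpow_one n]
      rw [← Real.rpow_add hn0, ← Real.rpow_add hn0]
      norm_num
    have s3 : √2 ≤ 2 := by rw [Real.sqrt_le_left two_pos.le]; norm_num
    have s4 : π * √2 ≤ 4 * 2 := mul_le_mul Real.pi_lt_four.le s3 (Real.sqrt_nonneg _) (by norm_num)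
    calc π * n * ‖sqrtProfile h n‖
        ≤ π * n * (derivConstant * latticeNorm h * (√2 * (n : ℝ) ^ (-(1 / 2) : ℝ)) *
          (δ * (n : ℝ) ^ (-(7 / 4) : ℝ))) := by
          rw [s1] at b
          refine mul_le_mul_of_nonneg_left (b.trans ?_) (by positivity)
          exact mul_le_mul_of_nonneg_left (hε n hn) (by positivity)
      _ = π * √2 * (derivConstant * latticeNorm h * δ * (n : ℝ) ^ (-(5 / 4) : ℝ)) := by
          rw [← s2]; ring
      _ ≤ 4 * 2 * (derivConstant * latticeNorm h * δ * (n : ℝ) ^ (-(5 / 4) : ℝ)) := by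
          gcongr
      _ = _ := by ring

end

lemma exists_perturbation_radius : ∃ δ : ℝ, 0 < δ ∧ ∀ (h : SchwartzMap ℝ ℂ) (κ : ℂ) (ε : ℕ → ℝ),
    (∀ x, h (-x) = -h x) → κ ^ 2 = 1 → (∀ ξ, 𝓕 (⇑h) ξ = -(Complex.I * κ) * h ξ) →
    deriv (⇑h) 0 = 0 → (∀ n : ℕ, 1 ≤ n → |ε n| ≤ δ * (n : ℝ) ^ (-(7 / 4) : ℝ)) →
    (∀ n : ℕ, 1 ≤ n → h √((n : ℝ) + ε n) = 0) → ∀ x, h x = 0 := by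
  set Z := ∑' n : ℤ, |(n : ℝ)| ^ (-(5 / 4) : ℝ) with hZ
  have hZ0 : 0 ≤ Z := tsum_nonneg fun n => Real.rpow_nonneg (abs_nonneg _) _
  have hQ := derivConstant_pos
  have hpos : 0 < min (1 / 2) (1 / (16 * derivConstant * (Z + 1))) := by positivity
  refine ⟨_, hpos, fun h κ ε hodd hκ hF hd hε hz => ?_⟩
  refine eq_zero_of_latticeNorm_eq_zero hodd hκ hF hd ?_
  have hS : 0 ≤ latticeNorm h := tsum_nonneg fun n => norm_nonneg _
  have b := latticeNorm_le hodd hκ hF hd hpos (min_le_left _ _) hε hz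
  have hδ := min_le_right (1 / 2) (1 / (16 * derivConstant * (Z + 1)))
  rw [← hZ] at b
  generalize min (1 / 2) (1 / (16 * derivConstant * (Z + 1))) = δ at *
  rw [le_div_iff₀ (by positivity)] at hδ
  have h1 : 8 * derivConstant * δ * Z ≤ 1 / 2 := by nlinarith [mul_pos hQ hpos]
  have h2 : latticeNorm h * (8 * derivConstant * δ * Z) ≤ latticeNorm h * (1 / 2) := by gcongr
  linarith

lemma fourier_neg_of_odd {f : ℝ → ℂ} (hodd : ∀ x, f (-x) = -f x) (x : ℝ) :
    𝓕 f (-x) = -𝓕 f x := by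
  rw [← Real.fourierInv_eq_fourier_neg, Real.fourierInv_eq_fourier_comp_neg]
  simp only [hodd, Real.fourier_eq', smul_neg, integral_neg]

theorem stmt10 :
    ∃ δ : ℝ, 0 < δ ∧
      ∀ ε : ℕ → ℝ, (∀ n : ℕ, 1 ≤ n → |ε n| ≤ δ * (n : ℝ) ^ (-(7/4) : ℝ)) →
        ∀ f : SchwartzMap ℝ ℂ,
          (∀ x : ℝ, f (-x) = -f x) →           -- f is odd
          (∀ x : ℝ, (f x).im = 0) →            -- f is real-valued
          (∀ n : ℕ, 1 ≤ n → f (Real.sqrt ((n : ℝ) + ε n)) = 0) →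
          (∀ n : ℕ, 1 ≤ n → 𝓕 (⇑f) (Real.sqrt ((n : ℝ) + ε n)) = 0) →
          deriv (⇑f) 0 = 0 →
          deriv (𝓕 (⇑f)) 0 = 0 →
          ∀ x : ℝ, f x = 0 := by
  obtain ⟨δ, hδ, hmain⟩ := exists_perturbation_radius
  refine ⟨δ, hδ, fun ε hε f hodd _ hf hFf hd hFd x => ?_⟩
  let g : SchwartzMap ℝ ℂ := 𝓕 f
  have hg : ⇑g = 𝓕 (⇑f) := SchwartzMap.fourier_coe f
  have hgodd : ∀ x, 𝓕 (⇑f) (-x) = -𝓕 (⇑f) x := fourier_neg_of_odd hodd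
  have hgg : ∀ x, 𝓕 (𝓕 (⇑f)) x = -f x := fun x => by
    have e1 : 𝓕⁻ (𝓕 (⇑f)) = ⇑f :=
      f.continuous.fourierInv_fourier_eq f.integrable (hg ▸ g.integrable)
    have e2 := congrFun e1 x
    rw [Real.fourierInv_eq_fourier_neg, fourier_neg_of_odd hgodd] at e2
    rw [← e2, neg_neg]
  have key : ∀ κ : ℂ, κ ^ 2 = 1 → f x + Complex.I * κ * 𝓕 (⇑f) x = 0 := by
    intro κ hκ
    have happ : ∀ x, (f + (Complex.I * κ) • g) x = f x + Complex.I * κ * 𝓕 (⇑f) x := fun x => by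
      simp [hg]
    rw [← happ]
    refine hmain _ κ ε (fun x => ?_) hκ (fun ξ => ?_) ?_ hε (fun n hn => ?_) x
    · rw [happ, happ, hodd, hgodd]; ring
    · have e : 𝓕 (f + (Complex.I * κ) • g) = g + (Complex.I * κ) • 𝓕 g := by
        rw [FourierTransform.fourier_add, FourierTransform.fourier_smul]
      rw [← SchwartzMap.fourier_coe, e, happ]
      have e2 : (𝓕 g : SchwartzMap ℝ ℂ) ξ = -f ξ := by rw [SchwartzMap.fourier_coe, hg, hgg]
      simp only [add_apply, smul_apply, smul_eq_mul, e2, hg]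
      linear_combination (κ ^ 2 * 𝓕 (⇑f) ξ) * Complex.I_sq - 𝓕 (⇑f) ξ * hκ
    · have d1 : HasDerivAt (⇑f) 0 0 := hd ▸ f.differentiableAt.hasDerivAt
      have d2 : HasDerivAt (𝓕 (⇑f)) 0 0 := by
        have := g.differentiableAt (x := 0) |>.hasDerivAt
        rwa [hg, hFd] at this
      have := (d1.fun_add (d2.const_mul (Complex.I * κ))).deriv
      rw [show ⇑(f + (Complex.I * κ) • g) = _ from funext happ, this]
      simp
    · rw [happ, hf n hn, hFf n hn]; simp
  have k1 := key 1 (by norm_num)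
  have k2 := key (-1) (by norm_num)
  linear_combination (k1 + k2) / 2
end

section
/- Let (ε_n)_{n∈ℤ} be a sequence of real numbers with L = sup_{n∈ℤ} |ε_n| < 1. For a = (a_k)_{k∈ℤ} ∈ ℓ²(ℤ) define the perturbed discrete Hilbert transform H_ε(a)(n) = ∑_{k∈ℤ, k≠n} (−1)^{n−k} a_k / (n + ε_n − k); this series converges absolutely for each n. Then H_ε maps ℓ²(ℤ) to ℓ²(ℤ) and its operator norm satisfies ‖H_ε a‖_{ℓ²(ℤ)} ≤ ( π + (π²/3)·L/(1−L) )·‖a‖_{ℓ²(ℤ)} for all a ∈ ℓ²(ℤ). -/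
open Real

/-- The perturbed discrete Hilbert transform
`H_ε(a)(n) = ∑_{k ≠ n} (-1)^(n - k) * a k / (n + ε_n - k)`. -/
noncomputable def Hpert (ε : ℤ → ℝ) (a : ℤ → ℂ) (n : ℤ) : ℂ :=
  ∑' k : ℤ, if k = n then 0
    else (-1 : ℂ) ^ (n - k) * a k / (((n : ℝ) + ε n - (k : ℝ) : ℝ) : ℂ)

/-- Schur's bound for the bilinear form of a nonnegative summable convolution kernel on `ℤ`. -/
theorem sum_sum_conv_mul_le {w : ℤ → ℝ} {W : ℝ} (hw0 : ∀ m, 0 ≤ w m) (hw : HasSum w W)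
    (N F : Finset ℤ) (x y : ℤ → ℝ) :
    ∑ n ∈ N, ∑ k ∈ F, w (n - k) * (x n * y k) ≤
      W * ((∑ n ∈ N, x n ^ 2) + ∑ k ∈ F, y k ^ 2) / 2 := by
  have hrow : ∀ n, ∑ k ∈ F, w (n - k) ≤ W := fun n =>
    sum_le_hasSum F (fun _ _ => hw0 _) ((Equiv.subLeft n).hasSum_iff.2 hw)
  have hcol : ∀ k, ∑ n ∈ N, w (n - k) ≤ W := fun k =>
    sum_le_hasSum N (fun _ _ => hw0 _) ((Equiv.subRight k).hasSum_iff.2 hw)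
  have hx : ∑ n ∈ N, ∑ k ∈ F, w (n - k) * x n ^ 2 ≤ W * ∑ n ∈ N, x n ^ 2 := by
    rw [Finset.mul_sum]
    refine Finset.sum_le_sum fun n _ => ?_
    rw [← Finset.sum_mul]
    exact mul_le_mul_of_nonneg_right (hrow n) (sq_nonneg _)
  have hy : ∑ n ∈ N, ∑ k ∈ F, w (n - k) * y k ^ 2 ≤ W * ∑ k ∈ F, y k ^ 2 := by
    rw [Finset.mul_sum, Finset.sum_comm]
    refine Finset.sum_le_sum fun k _ => ?_
    rw [← Finset.sum_mul]
    exact mul_le_mul_of_nonneg_right (hcol k) (sq_nonneg _)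
  have hxy : ∑ n ∈ N, ∑ k ∈ F, w (n - k) * (x n * y k) ≤
      ∑ n ∈ N, ∑ k ∈ F, (w (n - k) * x n ^ 2 + w (n - k) * y k ^ 2) / 2 := by
    refine Finset.sum_le_sum fun n _ => Finset.sum_le_sum fun k _ => ?_
    nlinarith [mul_nonneg (hw0 (n - k)) (sq_nonneg (x n - y k))]
  simp only [← Finset.sum_div, Finset.sum_add_distrib] at hxy
  linarith

/-- Young's inequality `ℓ¹ * ℓ² ⊆ ℓ²` on finite sets. -/
theorem sum_conv_sq_le {w : ℤ → ℝ} {W : ℝ} (hw0 : ∀ m, 0 ≤ w m) (hw : HasSum w W) (hW : 0 < W)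
    (N F : Finset ℤ) (y : ℤ → ℝ) :
    ∑ n ∈ N, (∑ k ∈ F, w (n - k) * y k) ^ 2 ≤ W ^ 2 * ∑ k ∈ F, y k ^ 2 := by
  have h := sum_sum_conv_mul_le hw0 hw N F (fun n => ∑ k ∈ F, w (n - k) * y k) (fun k => W * y k)
  have e : ∑ n ∈ N, ∑ k ∈ F, w (n - k) * ((∑ k ∈ F, w (n - k) * y k) * (W * y k)) =
      W * ∑ n ∈ N, (∑ k ∈ F, w (n - k) * y k) ^ 2 := by
    rw [Finset.mul_sum]
    refine Finset.sum_congr rfl fun n _ => ?_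
    rw [sq, ← mul_assoc, Finset.mul_sum]
    exact Finset.sum_congr rfl fun k _ => by ring
  simp only [mul_pow, ← Finset.mul_sum] at h e
  rw [e, mul_div_assoc] at h
  linarith [le_of_mul_le_mul_left h hW]

theorem hasSum_int_inv_sq : HasSum (fun m : ℤ => ((m : ℝ)⁻¹) ^ 2) (π ^ 2 / 3) := by
  have h : HasSum (fun n : ℕ => ((n : ℝ)⁻¹) ^ 2) (π ^ 2 / 6) := by
    simpa using hasSum_zeta_two
  have := HasSum.of_nat_of_neg (f := fun m : ℤ => ((m : ℝ)⁻¹) ^ 2) (by simpa using h)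
    (by simpa using h)
  have e : π ^ 2 / 6 + π ^ 2 / 6 - (((0 : ℤ) : ℝ)⁻¹) ^ 2 = π ^ 2 / 3 := by
    simp
    ring
  rwa [e] at this

theorem summable_int_inv_mul_inv (j k : ℤ) :
    Summable fun n : ℤ => ((n - j : ℤ) : ℝ)⁻¹ * ((n - k : ℤ) : ℝ)⁻¹ := by
  have h : ∀ j : ℤ, Summable fun n : ℤ => (((n - j : ℤ) : ℝ)⁻¹) ^ 2 := fun j =>
    ((Equiv.subRight j).hasSum_iff.2 hasSum_int_inv_sq).summable
  refine Summable.of_norm_bounded ((h j).add (h k)) fun n => ?_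
  rw [Real.norm_eq_abs, abs_le]
  constructor <;> nlinarith [sq_nonneg (((n - j : ℤ) : ℝ)⁻¹ + ((n - k : ℤ) : ℝ)⁻¹),
    sq_nonneg (((n - j : ℤ) : ℝ)⁻¹ - ((n - k : ℤ) : ℝ)⁻¹),
    sq_nonneg (((n - j : ℤ) : ℝ)⁻¹), sq_nonneg (((n - k : ℤ) : ℝ)⁻¹)]

theorem hasSum_nat_inv_sub_inv_succ :
    HasSum (fun n : ℕ => (n : ℝ)⁻¹ - ((n + 1 : ℕ) : ℝ)⁻¹) 0 := by
  have hlim : Filter.Tendsto (fun n : ℕ => -((n : ℝ)⁻¹)) Filter.atTop (nhds 0) := by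
    simpa using (tendsto_inv_atTop_nhds_zero_nat (𝕜 := ℝ)).neg
  rw [← hasSum_nat_add_iff' 1]
  refine (hasSum_iff_tendsto_nat_of_nonneg (fun n => ?_) _).2 ?_
  · rw [sub_nonneg]
    gcongr
    omega
  · have e : ∀ M : ℕ, ∑ n ∈ Finset.range M, (((n + 1 : ℕ) : ℝ)⁻¹ - ((n + 1 + 1 : ℕ) : ℝ)⁻¹) =
        1 - ((M + 1 : ℕ) : ℝ)⁻¹ := fun M => by
      rw [Finset.sum_range_sub' (fun n : ℕ => ((n + 1 : ℕ) : ℝ)⁻¹)]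
      simp
    simp only [e]
    have := ((tendsto_inv_atTop_nhds_zero_nat (𝕜 := ℝ)).comp
      (Filter.tendsto_add_atTop_nat 1)).const_sub 1
    simpa [Function.comp_def] using this

theorem hasSum_int_inv_sub_inv_add (d : ℕ) :
    HasSum (fun m : ℤ => (m : ℝ)⁻¹ - ((m + d : ℤ) : ℝ)⁻¹) 0 := by
  have h1 : HasSum (fun m : ℤ => (m : ℝ)⁻¹ - ((m + 1 : ℤ) : ℝ)⁻¹) 0 := by
    have := HasSum.of_nat_of_neg_add_one (f := fun m : ℤ => (m : ℝ)⁻¹ - ((m + 1 : ℤ) : ℝ)⁻¹)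
      (m := 0) (m' := 0) (by simpa using hasSum_nat_inv_sub_inv_succ) (by
        convert hasSum_nat_inv_sub_inv_succ using 2 with n
        push_cast
        rw [show (-((n : ℝ) + 1) + 1) = -n by ring, inv_neg, inv_neg]
        ring)
    simpa using this
  induction d with
  | zero => simp
  | succ d ih =>
    have h2 := ih.add ((Equiv.addRight (d : ℤ)).hasSum_iff.2 h1)
    rw [add_zero] at h2
    convert h2 using 2 with m
    simp [add_assoc]

/-- The Gram matrix of the columns of the discrete Hilbert matrix. -/
theorem hasSum_int_inv_mul_inv (j k : ℤ) :
    HasSum (fun n : ℤ => ((n - j : ℤ) : ℝ)⁻¹ * ((n - k : ℤ) : ℝ)⁻¹)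
      (2 * (((j - k : ℤ) : ℝ)⁻¹) ^ 2 + if j = k then π ^ 2 / 3 else 0) := by
  wlog hkj : k ≤ j generalizing j k
  · convert this k j (by omega) using 1
    · ext n; ring
    · rw [← neg_sub k j, Int.cast_neg, inv_neg, neg_sq]
      simp only [eq_comm]
  obtain ⟨d, rfl⟩ := Int.le.dest hkj
  rcases Nat.eq_zero_or_pos d with rfl | hd
  · have := (Equiv.subRight k).hasSum_iff.2 hasSum_int_inv_sq
    simpa [sq, Function.comp_def] using this
  have hd' : (d : ℝ) ≠ 0 := by positivity
  have h1 := (Equiv.subRight (k + d)).hasSum_iff.2 (hasSum_int_inv_sub_inv_add d)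
  have h2 := hasSum_ite_eq (k + d : ℤ) ((d : ℝ)⁻¹)
  have h3 := hasSum_ite_eq (k : ℤ) ((d : ℝ)⁻¹)
  have h := ((h1.add h2).add h3).mul_left ((d : ℝ)⁻¹)
  have e : (d : ℝ)⁻¹ * (0 + (d : ℝ)⁻¹ + (d : ℝ)⁻¹) =
      2 * (((k + d - k : ℤ) : ℝ)⁻¹) ^ 2 + if k + (d : ℤ) = k then π ^ 2 / 3 else 0 := by
    simp [hd.ne']
    ring
  rw [e] at h
  refine h.congr_fun fun n => ?_
  have hne : k + (d : ℤ) ≠ k := by omega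
  simp only [Function.comp_apply, Equiv.subRight_apply]
  rw [show n - (k + d) + d = n - k by ring]
  by_cases h : n = k
  · subst h
    simp [hne.symm]
  by_cases h' : n = k + d
  · subst h'
    simp [hne]
  have e1 : ((n - k : ℤ) : ℝ) ≠ 0 := by exact_mod_cast sub_ne_zero.2 h
  have e2 : ((n - (k + d) : ℤ) : ℝ) ≠ 0 := by exact_mod_cast sub_ne_zero.2 h'
  simp only [h, h', if_false, add_zero]
  field_simp
  push_cast
  ring

/-- Hilbert's inequality for the two-sided discrete Hilbert transform, on finite sets. -/
theorem sum_norm_sq_discreteHilbert_le {E : Type*} [NormedAddCommGroup E] [InnerProductSpace ℝ E]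
    (N F : Finset ℤ) (b : ℤ → E) :
    ∑ n ∈ N, ‖∑ k ∈ F, ((n - k : ℤ) : ℝ)⁻¹ • b k‖ ^ 2 ≤ π ^ 2 * ∑ k ∈ F, ‖b k‖ ^ 2 := by
  have hsum : HasSum (fun n : ℤ => ‖∑ k ∈ F, ((n - k : ℤ) : ℝ)⁻¹ • b k‖ ^ 2)
      (∑ j ∈ F, ∑ k ∈ F, (2 * (((j - k : ℤ) : ℝ)⁻¹) ^ 2 + if j = k then π ^ 2 / 3 else 0) *
        inner ℝ (b j) (b k)) := by
    have := hasSum_sum fun j (_ : j ∈ F) => hasSum_sum fun k (_ : k ∈ F) =>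
      (hasSum_int_inv_mul_inv j k).mul_right (inner ℝ (b j) (b k))
    refine this.congr_fun fun n => ?_
    rw [← real_inner_self_eq_norm_sq, sum_inner]
    refine Finset.sum_congr rfl fun j _ => ?_
    rw [inner_sum]
    refine Finset.sum_congr rfl fun k _ => ?_
    rw [real_inner_smul_left, real_inner_smul_right, mul_assoc]
  refine (sum_le_hasSum N (fun _ _ => by positivity) hsum).trans ?_
  have hle : ∑ j ∈ F, ∑ k ∈ F, (2 * (((j - k : ℤ) : ℝ)⁻¹) ^ 2 + if j = k then π ^ 2 / 3 else 0) *
        inner ℝ (b j) (b k) ≤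
      ∑ j ∈ F, ∑ k ∈ F, (2 * ((((j - k : ℤ) : ℝ)⁻¹) ^ 2 * (‖b j‖ * ‖b k‖)) +
        if j = k then π ^ 2 / 3 * ‖b j‖ ^ 2 else 0) := by
    refine Finset.sum_le_sum fun j _ => Finset.sum_le_sum fun k _ => ?_
    rw [add_mul, mul_assoc]
    refine add_le_add ?_ ?_
    · gcongr
      exact real_inner_le_norm _ _
    · split_ifs with h
      · subst h
        rw [real_inner_self_eq_norm_sq]
      · simp
  have hS := sum_sum_conv_mul_le (fun m => sq_nonneg ((m : ℝ)⁻¹)) hasSum_int_inv_sq F F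
    (fun k => ‖b k‖) (fun k => ‖b k‖)
  have hdiag : ∑ j ∈ F, ∑ k ∈ F, (if j = k then π ^ 2 / 3 * ‖b j‖ ^ 2 else 0) =
      π ^ 2 / 3 * ∑ k ∈ F, ‖b k‖ ^ 2 := by
    rw [Finset.mul_sum]
    exact Finset.sum_congr rfl fun j hj => by simp [hj]
  simp only [Finset.sum_add_distrib, ← Finset.mul_sum, hdiag] at hle
  linarith

/-- Minkowski's inequality for finite sums of squares, in terms of upper bounds. -/
theorem sum_add_sq_le {ι : Type*} (N : Finset ι) (x y : ι → ℝ) {A B : ℝ} (hA : 0 ≤ A) (hB : 0 ≤ B)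
    (hx : ∑ n ∈ N, x n ^ 2 ≤ A ^ 2) (hy : ∑ n ∈ N, y n ^ 2 ≤ B ^ 2) :
    ∑ n ∈ N, (x n + y n) ^ 2 ≤ (A + B) ^ 2 := by
  have hxy : ∑ n ∈ N, x n * y n ≤ A * B :=
    (Real.sum_mul_le_sqrt_mul_sqrt N x y).trans
      (mul_le_mul (Real.sqrt_le_left hA |>.2 hx) (Real.sqrt_le_left hB |>.2 hy)
        (Real.sqrt_nonneg _) hA)
  have e : ∑ n ∈ N, (x n + y n) ^ 2 =
      ∑ n ∈ N, x n ^ 2 + 2 * ∑ n ∈ N, x n * y n + ∑ n ∈ N, y n ^ 2 := by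
    rw [Finset.mul_sum, ← Finset.sum_add_distrib, ← Finset.sum_add_distrib]
    exact Finset.sum_congr rfl fun n _ => by ring
  rw [e]
  nlinarith

/-- The kernel of the perturbed discrete Hilbert transform, without the alternating sign. -/
noncomputable def perturbedHilbertKernel (ε : ℤ → ℝ) (n k : ℤ) : ℝ :=
  if k = n then 0 else ((n : ℝ) + ε n - k)⁻¹

section Kernel

variable {ε : ℤ → ℝ} {L : ℝ}

theorem one_sub_mul_abs_le (hLbd : ∀ n : ℤ, |ε n| ≤ L) {n k : ℤ} (h : k ≠ n) :
    (1 - L) * |((n - k : ℤ) : ℝ)| ≤ |(n : ℝ) + ε n - k| := by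
  have h1 : (1 : ℝ) ≤ |((n - k : ℤ) : ℝ)| := by
    exact_mod_cast Int.one_le_abs (sub_ne_zero.2 h.symm)
  have h2 := abs_sub_abs_le_abs_sub ((n - k : ℤ) : ℝ) (-ε n)
  rw [abs_neg, sub_neg_eq_add] at h2
  have h3 := hLbd n
  have h0 := (abs_nonneg _).trans h3
  rw [show (n : ℝ) + ε n - k = ((n - k : ℤ) : ℝ) + ε n by push_cast; ring]
  nlinarith

theorem abs_perturbedHilbertKernel_le (hLbd : ∀ n : ℤ, |ε n| ≤ L) (hL : L < 1) (n k : ℤ) :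
    |perturbedHilbertKernel ε n k| ≤ (1 - L)⁻¹ * |((n - k : ℤ) : ℝ)⁻¹| := by
  have hL' : 0 < 1 - L := by linarith
  rw [perturbedHilbertKernel]
  split_ifs with h
  · rw [abs_zero]; positivity
  · have h1 : 0 < |((n - k : ℤ) : ℝ)| := abs_pos.2 (by exact_mod_cast sub_ne_zero.2 (Ne.symm h))
    rw [abs_inv, abs_inv, ← mul_inv]
    exact inv_anti₀ (by positivity) (one_sub_mul_abs_le hLbd h)

theorem abs_perturbedHilbertKernel_sub_le (hLbd : ∀ n : ℤ, |ε n| ≤ L) (hL : L < 1) (n k : ℤ) :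
    |perturbedHilbertKernel ε n k - ((n - k : ℤ) : ℝ)⁻¹| ≤
      L / (1 - L) * (((n - k : ℤ) : ℝ)⁻¹) ^ 2 := by
  have hL' : 0 < 1 - L := by linarith
  have h0 : 0 ≤ L := (abs_nonneg _).trans (hLbd 0)
  by_cases h : k = n
  · simp [perturbedHilbertKernel, h]
  have hm : ((n - k : ℤ) : ℝ) ≠ 0 := by exact_mod_cast sub_ne_zero.2 (Ne.symm h)
  have hd : (n : ℝ) + ε n - k ≠ 0 := by
    have := one_sub_mul_abs_le hLbd h
    have h1 : 0 < |((n - k : ℤ) : ℝ)| := abs_pos.2 hm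
    exact abs_pos.1 (lt_of_lt_of_le (by positivity) this)
  have e : perturbedHilbertKernel ε n k - ((n - k : ℤ) : ℝ)⁻¹ =
      -ε n * perturbedHilbertKernel ε n k * ((n - k : ℤ) : ℝ)⁻¹ := by
    simp only [perturbedHilbertKernel, h, if_false]
    field_simp
    push_cast
    ring
  rw [e, abs_mul, abs_mul, abs_neg]
  calc |ε n| * |perturbedHilbertKernel ε n k| * |((n - k : ℤ) : ℝ)⁻¹|
      ≤ L * ((1 - L)⁻¹ * |((n - k : ℤ) : ℝ)⁻¹|) * |((n - k : ℤ) : ℝ)⁻¹| := by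
        gcongr
        · exact hLbd n
        · exact abs_perturbedHilbertKernel_le hLbd hL n k
    _ = L / (1 - L) * |((n - k : ℤ) : ℝ)⁻¹| ^ 2 := by ring
    _ = _ := by rw [sq_abs]

theorem summable_perturbedHilbertKernel_smul {E : Type*} [NormedAddCommGroup E] [NormedSpace ℝ E]
    (hLbd : ∀ n : ℤ, |ε n| ≤ L) (hL : L < 1)
    {b : ℤ → E} (hb : Summable fun k => ‖b k‖ ^ 2) (n : ℤ) :
    Summable fun k => ‖perturbedHilbertKernel ε n k • b k‖ := by
  have h : Summable fun k : ℤ => (((n - k : ℤ) : ℝ)⁻¹) ^ 2 :=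
    ((Equiv.subLeft n).hasSum_iff.2 hasSum_int_inv_sq).summable
  refine Summable.of_nonneg_of_le (fun _ => norm_nonneg _) (fun k => ?_)
    ((h.mul_left ((1 - L)⁻¹ ^ 2)).add hb)
  have h1 := abs_perturbedHilbertKernel_le hLbd hL n k
  have h2 : |perturbedHilbertKernel ε n k| ^ 2 ≤ (1 - L)⁻¹ ^ 2 * (((n - k : ℤ) : ℝ)⁻¹) ^ 2 := by
    rw [← sq_abs (((n - k : ℤ) : ℝ)⁻¹), ← mul_pow]
    gcongr
  rw [norm_smul, Real.norm_eq_abs]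
  nlinarith [sq_nonneg (|perturbedHilbertKernel ε n k| - ‖b k‖),
    sq_nonneg (|perturbedHilbertKernel ε n k|), sq_nonneg ‖b k‖]

theorem sum_norm_sq_perturbedHilbert_le {E : Type*} [NormedAddCommGroup E] [InnerProductSpace ℝ E]
    (hLbd : ∀ n : ℤ, |ε n| ≤ L) (hL : L < 1) (N F : Finset ℤ) (b : ℤ → E) :
    ∑ n ∈ N, ‖∑ k ∈ F, perturbedHilbertKernel ε n k • b k‖ ^ 2 ≤
      (π + (π ^ 2 / 3) * (L / (1 - L))) ^ 2 * ∑ k ∈ F, ‖b k‖ ^ 2 := by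
  have hL' : 0 < 1 - L := by linarith
  have h0 : 0 ≤ L := (abs_nonneg _).trans (hLbd 0)
  set S := ∑ k ∈ F, ‖b k‖ ^ 2 with hS
  have hS0 : 0 ≤ S := by positivity
  have hyoung := sum_conv_sq_le (fun m => sq_nonneg ((m : ℝ)⁻¹)) hasSum_int_inv_sq (by positivity)
    N F (fun k => ‖b k‖)
  have key := sum_add_sq_le N (fun n => ‖∑ k ∈ F, ((n - k : ℤ) : ℝ)⁻¹ • b k‖)
    (fun n => L / (1 - L) * ∑ k ∈ F, (((n - k : ℤ) : ℝ)⁻¹) ^ 2 * ‖b k‖)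
    (A := π * √S) (B := (π ^ 2 / 3) * (L / (1 - L)) * √S) (by positivity) (by positivity)
    (by rw [mul_pow, Real.sq_sqrt hS0]; exact sum_norm_sq_discreteHilbert_le N F b)
    (by
      simp only [mul_pow, ← Finset.mul_sum, Real.sq_sqrt hS0]
      calc _ ≤ (L / (1 - L)) ^ 2 * ((π ^ 2 / 3) ^ 2 * S) := by gcongr
        _ = _ := by ring)
  rw [← add_mul, mul_pow, Real.sq_sqrt hS0] at key
  refine le_trans (Finset.sum_le_sum fun n _ => ?_) key
  gcongr
  have e : ∑ k ∈ F, perturbedHilbertKernel ε n k • b k =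
      ∑ k ∈ F, ((n - k : ℤ) : ℝ)⁻¹ • b k +
        ∑ k ∈ F, (perturbedHilbertKernel ε n k - ((n - k : ℤ) : ℝ)⁻¹) • b k := by
    rw [← Finset.sum_add_distrib]
    exact Finset.sum_congr rfl fun k _ => by rw [← add_smul, add_sub_cancel]
  rw [e]
  refine (norm_add_le _ _).trans (add_le_add le_rfl ((norm_sum_le _ _).trans ?_))
  rw [Finset.mul_sum]
  refine Finset.sum_le_sum fun k _ => ?_
  rw [norm_smul, ← mul_assoc]
  gcongr
  exact abs_perturbedHilbertKernel_sub_le hLbd hL n k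

theorem Hpert_term_eq (ε : ℤ → ℝ) (a : ℤ → ℂ) (n k : ℤ) :
    (if k = n then 0
      else (-1 : ℂ) ^ (n - k) * a k / (((n : ℝ) + ε n - (k : ℝ) : ℝ) : ℂ)) =
    (-1 : ℂ) ^ n * perturbedHilbertKernel ε n k • ((-1 : ℂ) ^ (-k) * a k) := by
  rw [perturbedHilbertKernel]
  split_ifs
  · simp
  · rw [sub_eq_add_neg n k, zpow_add₀ (by norm_num), Complex.real_smul, Complex.ofReal_inv]
    ring

end Kernel

theorem stmt11 (ε : ℤ → ℝ) (L : ℝ) (hLbd : ∀ n : ℤ, |ε n| ≤ L) (hL : L < 1)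
    (a : ℤ → ℂ) (ha : Summable fun k : ℤ => ‖a k‖ ^ 2) :
    -- the defining series converges absolutely for each `n`
    (∀ n : ℤ, Summable fun k : ℤ =>
      ‖(if k = n then 0
        else (-1 : ℂ) ^ (n - k) * a k / (((n : ℝ) + ε n - (k : ℝ) : ℝ) : ℂ))‖) ∧
    -- `H_ε a ∈ ℓ²(ℤ)` with the asserted operator norm bound
    Summable (fun n : ℤ => ‖Hpert ε a n‖ ^ 2) ∧
    Real.sqrt (∑' n : ℤ, ‖Hpert ε a n‖ ^ 2) ≤
      (π + (π ^ 2 / 3) * (L / (1 - L))) * Real.sqrt (∑' k : ℤ, ‖a k‖ ^ 2) := by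
  have hnorm : ∀ m : ℤ, ‖(-1 : ℂ) ^ m‖ = 1 := fun m => by simp [norm_zpow]
  set b : ℤ → ℂ := fun k => (-1 : ℂ) ^ (-k) * a k with hb
  have hbn : ∀ k, ‖b k‖ = ‖a k‖ := fun k => by rw [hb, norm_mul, hnorm, one_mul]
  have hbs : Summable fun k => ‖b k‖ ^ 2 := by simpa only [hbn] using ha
  have hsm := summable_perturbedHilbertKernel_smul hLbd hL hbs
  have hH : ∀ n, ‖Hpert ε a n‖ = ‖∑' k, perturbedHilbertKernel ε n k • b k‖ := fun n => by
    simp only [Hpert, Hpert_term_eq]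
    rw [tsum_mul_left, norm_mul, hnorm, one_mul]
  set C := π + (π ^ 2 / 3) * (L / (1 - L)) with hC
  have hC0 : 0 ≤ C := by
    have h0 : 0 ≤ L := (abs_nonneg _).trans (hLbd 0)
    have hL' : 0 < 1 - L := by linarith
    positivity
  have hfin : ∀ N : Finset ℤ, ∑ n ∈ N, ‖Hpert ε a n‖ ^ 2 ≤ C ^ 2 * ∑' k, ‖a k‖ ^ 2 := by
    intro N
    simp only [hH]
    have hlim := tendsto_finsetSum N fun n _ => ((hsm n).of_norm.hasSum.norm.pow 2)
    refine le_of_tendsto hlim (Filter.Eventually.of_forall fun F => ?_)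
    refine (sum_norm_sq_perturbedHilbert_le hLbd hL N F b).trans ?_
    simp only [hbn]
    gcongr
    exact ha.sum_le_tsum F fun _ _ => by positivity
  have hsum := summable_of_sum_le (fun n => by positivity) hfin
  refine ⟨fun n => ?_, hsum, ?_⟩
  · simp only [Hpert_term_eq, norm_mul ((-1 : ℂ) ^ n), hnorm, one_mul]
    exact hsm n
  · rw [← Real.sqrt_sq hC0, ← Real.sqrt_mul (sq_nonneg C)]
    exact Real.sqrt_le_sqrt (hsum.tsum_le_of_sum_le hfin)
end
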